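/- arXiv:1010.6217 — 3 statements merged into one kernel-verified Lean document; each statement's English description precedes it below -/
import Mathlib

section
/- There is an absolute constant C such that for all x ≥ 2 one has |N(x) − c₀·x| ≤ C·x^{2/3}·log x, where N(x) is the number of positive integers n ≤ x for which n²+1 is squarefree and c₀ = ∏_{p prime, p ≡ 1 (mod 4)} (1 − 2p^{-2}). -/
/-- `c₀ = ∏_{p prime, p ≡ 1 (mod 4)} (1 − 2 p⁻²)`. -/
noncomputable def squarefreeConstant : ℝ :=
  ∏' p : {p : ℕ // p.Prime ∧ p % 4 = 1}, (1 - 2 / (p : ℝ) ^ 2)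

/-- `N(x)`: the number of positive integers `n ≤ x` with `n² + 1` squarefree. -/
noncomputable def countSquarefreeVals (x : ℝ) : ℕ :=
  ((Finset.Icc 1 ⌊x⌋₊).filter (fun n => Squarefree (n ^ 2 + 1))).card

namespace Esterm

/-- number of square roots of `-1` modulo `d ^ 2`. -/
noncomputable def rho (d : ℕ) : ℕ := Nat.card {r : ZMod (d ^ 2) // r ^ 2 = -1}

lemma rho_zero : rho 0 = 0 := by
  unfold rho
  have : IsEmpty {r : ZMod (0 ^ 2) // r ^ 2 = -1} := by
    refine ⟨fun ⟨r, hr⟩ => ?_⟩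
    have h2 : ∀ r : ℤ, r ^ 2 ≠ -1 := fun r hr => by nlinarith [sq_nonneg r]
    exact h2 r hr
  exact Nat.card_of_isEmpty

lemma rho_one : rho 1 = 1 := by
  unfold rho
  rw [Nat.card_eq_one_iff_unique]
  refine ⟨⟨fun a b => Subtype.ext ?_⟩, ⟨⟨0, ?_⟩⟩⟩
  · have : Subsingleton (ZMod (1 ^ 2)) := by rw [one_pow]; infer_instance
    exact Subsingleton.elim _ _
  · have : Subsingleton (ZMod (1 ^ 2)) := by rw [one_pow]; infer_instance
    exact Subsingleton.elim _ _

lemma rho_mul {m n : ℕ} (h : m.Coprime n) : rho (m * n) = rho m * rho n := by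
  unfold rho
  rw [mul_pow, ← Nat.card_prod]
  have e := ZMod.chineseRemainder (Nat.Coprime.pow 2 2 h)
  refine Nat.card_congr ((Equiv.subtypeEquiv e.toEquiv (q := fun x => x.1 ^ 2 = -1 ∧ x.2 ^ 2 = -1)
    ?_).trans (Equiv.subtypeProdEquivProd (p := fun x => x ^ 2 = -1) (q := fun x => x ^ 2 = -1)))
  intro a
  have : a ^ 2 = -1 ↔ e (a ^ 2) = e (-1) := e.injective.eq_iff.symm
  rw [this, map_pow, map_neg, map_one, Prod.ext_iff]
  rfl

lemma rho_two : rho 2 = 0 := by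
  unfold rho
  have : IsEmpty {r : ZMod (2 ^ 2) // r ^ 2 = -1} := by
    refine ⟨fun ⟨r, hr⟩ => ?_⟩
    revert r; decide
  exact Nat.card_of_isEmpty

lemma rho_three {p : ℕ} (hp : p.Prime) (h3 : p % 4 = 3) : rho p = 0 := by
  unfold rho
  have : IsEmpty {r : ZMod (p ^ 2) // r ^ 2 = -1} := by
    refine ⟨fun ⟨r, hr⟩ => ?_⟩
    have := Fact.mk hp
    have h := congrArg (ZMod.castHom (dvd_pow_self p two_ne_zero) (ZMod p)) hr
    rw [map_pow, map_neg, map_one] at h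
    exact ZMod.mod_four_ne_three_of_sq_eq_neg_one h h3
  exact Nat.card_of_isEmpty

lemma roots_eq {p : ℕ} (hp : p.Prime) (h2 : p ≠ 2) (r s : ZMod (p ^ 2))
    (hr : r ^ 2 = -1) (hs : s ^ 2 = -1) : r = s ∨ r = -s := by
  have hne : NeZero (p ^ 2) := ⟨pow_ne_zero _ hp.ne_zero⟩
  obtain ⟨a, rfl⟩ := ZMod.intCast_surjective r
  obtain ⟨b, rfl⟩ := ZMod.intCast_surjective s
  have hpi : Prime (p : ℤ) := Nat.prime_iff_prime_int.mp hp
  have ha : ((p ^ 2 : ℕ) : ℤ) ∣ a ^ 2 + 1 := by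
    rw [← ZMod.intCast_zmod_eq_zero_iff_dvd]; push_cast at hr ⊢; rw [hr]; ring
  have hb : ((p ^ 2 : ℕ) : ℤ) ∣ b ^ 2 + 1 := by
    rw [← ZMod.intCast_zmod_eq_zero_iff_dvd]; push_cast at hs ⊢; rw [hs]; ring
  have hab : (p : ℤ) ^ 2 ∣ (a - b) * (a + b) := by
    push_cast at ha hb
    have := dvd_sub ha hb
    rwa [show a ^ 2 + 1 - (b ^ 2 + 1) = (a - b) * (a + b) by ring] at this
  have key : (p : ℤ) ^ 2 ∣ a - b ∨ (p : ℤ) ^ 2 ∣ a + b := by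
    by_cases h1 : (p : ℤ) ∣ a - b
    · by_cases h3 : (p : ℤ) ∣ a + b
      · exfalso
        have h4 : (p : ℤ) ∣ 2 * a := by
          have := dvd_add h1 h3
          rwa [show a - b + (a + b) = 2 * a by ring] at this
        rcases hpi.dvd_or_dvd h4 with h5 | h5
        · have : p ∣ 2 := by exact_mod_cast h5
          exact h2 ((Nat.prime_dvd_prime_iff_eq hp Nat.prime_two).mp this)
        · have h6 : (p : ℤ) ∣ a ^ 2 + 1 := (Dvd.intro_left (p : ℤ) (by push_cast; ring)).trans ha
          have h7 : (p : ℤ) ∣ 1 := by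
            have := dvd_sub h6 (h5.mul_left a)
            rwa [show a ^ 2 + 1 - a * a = 1 by ring] at this
          exact hpi.not_dvd_one h7
      · left
        exact (IsCoprime.pow_left ((Irreducible.coprime_iff_not_dvd hpi.irreducible).mpr h3)).dvd_of_dvd_mul_right hab
    · right
      exact (IsCoprime.pow_left ((Irreducible.coprime_iff_not_dvd hpi.irreducible).mpr h1)).dvd_of_dvd_mul_left hab
  rcases key with h | h
  · left
    have := (ZMod.intCast_zmod_eq_zero_iff_dvd (a - b) (p ^ 2)).mpr (by push_cast; exact h)
    push_cast at this
    exact sub_eq_zero.mp this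
  · right
    have := (ZMod.intCast_zmod_eq_zero_iff_dvd (a + b) (p ^ 2)).mpr (by push_cast; exact h)
    push_cast at this
    exact eq_neg_of_add_eq_zero_left this

lemma exists_root {p : ℕ} (hp : p.Prime) (h1 : p % 4 = 1) : ∃ r : ZMod (p ^ 2), r ^ 2 = -1 := by
  have := Fact.mk hp
  obtain ⟨y, hy⟩ := (ZMod.exists_sq_eq_neg_one_iff (p := p)).mpr (by omega)
  obtain ⟨a, rfl⟩ := ZMod.intCast_surjective y
  have ha : (p : ℤ) ∣ a ^ 2 - (-1) := by
    rw [← ZMod.intCast_zmod_eq_zero_iff_dvd]; push_cast; rw [sq, ← hy]; ring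
  have h := dvd_sub_pow_of_dvd_sub ha 1
  refine ⟨(a : ZMod (p ^ 2)) ^ p, ?_⟩
  have h2 := (ZMod.intCast_zmod_eq_zero_iff_dvd _ (p ^ 2)).mpr (by push_cast; exact h)
  have hodd : Odd p := by rw [Nat.odd_iff]; omega
  push_cast at h2
  rw [pow_one, hodd.neg_one_pow] at h2
  rw [pow_right_comm, ← sub_eq_zero]; exact h2

lemma rho_prime_one {p : ℕ} (hp : p.Prime) (h1 : p % 4 = 1) : rho p = 2 := by
  obtain ⟨r, hr⟩ := exists_root hp h1
  have hp2 : p ≠ 2 := by rintro rfl; omega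
  unfold rho
  rw [Nat.card_eq_two_iff]
  refine ⟨⟨r, hr⟩, ⟨-r, by rw [neg_sq, hr]⟩, ?_, ?_⟩
  · intro h
    have h : r = -r := congrArg Subtype.val h
    have h4 : (2 : ZMod (p ^ 2)) * r = 0 := by linear_combination h
    have h5 : (2 : ZMod (p ^ 2)) = 0 := by linear_combination (-r) * h4 + 2 * hr
    have h6 : ((2 : ℕ) : ZMod (p ^ 2)) = 0 := by exact_mod_cast h5
    rw [ZMod.natCast_eq_zero_iff] at h6
    have := Nat.le_of_dvd (by norm_num) h6
    have := hp.two_le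
    nlinarith
  · ext ⟨s, hs⟩
    simp only [Set.mem_insert_iff, Set.mem_singleton_iff, Set.mem_univ, iff_true, Subtype.mk.injEq]
    exact roots_eq hp hp2 s r hs hr

lemma rho_prime_le {p : ℕ} (hp : p.Prime) : rho p ≤ 2 := by
  rcases hp.eq_two_or_odd with rfl | h
  · rw [rho_two]; norm_num
  · rcases (show p % 4 = 1 ∨ p % 4 = 3 by omega) with h | h
    · rw [rho_prime_one hp h]
    · rw [rho_three hp h]; norm_num

lemma rho_le {d : ℕ} (hd : Squarefree d) : rho d ≤ d.divisors.card := by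
  induction d using Nat.recOnMul with
  | zero => simp at hd
  | one => simp [rho_one]
  | prime p hp =>
    rw [hp.divisors, Finset.card_pair hp.one_lt.ne]; exact rho_prime_le hp
  | mul a b iha ihb =>
    have hc := Nat.coprime_of_squarefree_mul hd
    rw [rho_mul hc, hc.card_divisors_mul]
    exact Nat.mul_le_mul (iha hd.of_mul_left) (ihb hd.of_mul_right)

lemma two_mul_le {m n₁ n₂ d₁ d₂ : ℤ} (hn1 : 0 < n₁) (hlt : n₁ < n₂) (hd1 : 0 < d₁) (hd2 : 0 < d₂)
    (h1 : n₁ ^ 2 + 1 = d₁ ^ 2 * m) (h2 : n₂ ^ 2 + 1 = d₂ ^ 2 * m) : 2 * n₁ ≤ n₂ := by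
  have hm : 0 < m := by
    by_contra h
    push Not at h
    nlinarith [mul_nonneg (sq_nonneg d₁) (sub_nonneg.mpr h), sq_nonneg n₁]
  obtain ⟨a, ha⟩ : ∃ a, a = m * d₁ * d₂ - n₁ * n₂ := ⟨_, rfl⟩
  obtain ⟨b, hb⟩ : ∃ b, b = n₂ * d₁ - n₁ * d₂ := ⟨_, rfl⟩
  have hab : a ^ 2 = 1 + m * b ^ 2 := by
    rw [ha, hb]
    linear_combination (-d₂ ^ 2 * m + n₂ ^ 2) * h1 - h2
  have hn2 : n₂ = a * n₁ + b * m * d₁ := by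
    rw [ha, hb]; linear_combination n₂ * h1
  have hn2pos : 0 < n₂ := by omega
  have hbpos : 0 < b := by
    have : (n₁ * d₂) ^ 2 < (n₂ * d₁) ^ 2 := by
      have : m * (n₁ * d₂) ^ 2 < m * (n₂ * d₁) ^ 2 := by
        have e1 : m * (n₁ * d₂) ^ 2 = n₁ ^ 2 * (n₂ ^ 2 + 1) := by rw [h2]; ring
        have e2 : m * (n₂ * d₁) ^ 2 = n₂ ^ 2 * (n₁ ^ 2 + 1) := by rw [h1]; ring
        rw [e1, e2]; nlinarith
      exact lt_of_mul_lt_mul_left this hm.le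
    have := lt_of_pow_lt_pow_left₀ 2 (by positivity) this
    omega
  have hapos : 0 < a := by
    have : (n₁ * n₂) ^ 2 < (m * d₁ * d₂) ^ 2 := by
      have : (m * d₁ * d₂) ^ 2 = (n₁ ^ 2 + 1) * (n₂ ^ 2 + 1) := by rw [h1, h2]; ring
      rw [this]; nlinarith [sq_nonneg n₁, sq_nonneg n₂]
    have := lt_of_pow_lt_pow_left₀ 2 (by positivity) this
    omega
  have ha2 : 2 ≤ a := by
    by_contra h
    have : a = 1 := by omega
    rw [this] at hab
    have : 0 < m * b ^ 2 := by positivity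
    omega
  have : 0 < b * m * d₁ := by positivity
  nlinarith

lemma card_solutions (m N : ℕ) (S : Finset ℕ)
    (hS : ∀ n ∈ S, 1 ≤ n ∧ n ≤ N ∧ ∃ d : ℕ, n ^ 2 + 1 = d ^ 2 * m) : S.card ≤ Nat.log 2 N + 1 := by
  have : S.card ≤ (Finset.range (Nat.log 2 N + 1)).card := by
    refine Finset.card_le_card_of_injOn (Nat.log 2) ?_ ?_
    · intro n hn
      have := Nat.log_mono_right (b := 2) (hS n hn).2.1
      simp; omega
    · have key : ∀ n₁ ∈ S, ∀ n₂ ∈ S, n₁ < n₂ → Nat.log 2 n₁ < Nat.log 2 n₂ := by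
        intro n₁ h1 n₂ h2 hlt
        obtain ⟨p1, -, d₁, e1⟩ := hS n₁ h1
        obtain ⟨p2, -, d₂, e2⟩ := hS n₂ h2
        have hd1 : 0 < d₁ := by rcases Nat.eq_zero_or_pos d₁ with rfl | h; · simp at e1
                                exact h
        have hd2 : 0 < d₂ := by rcases Nat.eq_zero_or_pos d₂ with rfl | h; · simp at e2
                                exact h
        have : 2 * (n₁ : ℤ) ≤ n₂ := two_mul_le (m := m) (d₁ := d₁) (d₂ := d₂) (by exact_mod_cast p1) (by exact_mod_cast hlt)
          (by exact_mod_cast hd1) (by exact_mod_cast hd2) (by exact_mod_cast e1) (by exact_mod_cast e2)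
        have h3 : n₁ * 2 ≤ n₂ := by omega
        have := Nat.log_mono_right (b := 2) h3
        rw [Nat.log_mul_base (by norm_num) (by omega)] at this
        omega
      intro n₁ h1 n₂ h2 h
      rcases lt_trichotomy n₁ n₂ with hl | hl | hl
      · have := key _ h1 _ h2 hl; omega
      · exact hl
      · have := key _ h2 _ h1 hl; omega
  simpa using this

lemma sum_moebius (n N : ℕ) (hn : 0 < n) (hN : ∀ d, d ^ 2 ∣ n → d ≤ N) :
    ∑ d ∈ (Finset.Icc 1 N).filter (fun d => d ^ 2 ∣ n), ArithmeticFunction.moebius d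
      = if Squarefree n then 1 else 0 := by
  obtain ⟨b, a, hab, hb⟩ := Nat.sq_mul_squarefree n
  have ha : a ≠ 0 := by rintro rfl; simp at hab; omega
  have hdvd : ∀ d, d ^ 2 ∣ n ↔ d ∣ a := by
    intro d
    constructor
    · intro h
      rcases Nat.eq_zero_or_pos d with rfl | hd
      · simp at h; omega
      obtain ⟨g, d', a', hg, hc, rfl, rfl⟩ := Nat.exists_coprime' (m := d) (n := a) (Nat.gcd_pos_of_pos_left _ hd)
      rw [← hab, mul_pow, mul_pow, mul_right_comm] at h
      have h2 := Nat.dvd_of_mul_dvd_mul_right (by positivity) h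
      have h3 := (Nat.Coprime.pow 2 2 hc).dvd_of_dvd_mul_left h2
      rw [sq] at h3
      have := Nat.isUnit_iff.mp (hb d' h3)
      rw [this, one_mul]; exact dvd_mul_left _ _
    · intro h
      rw [← hab]; exact (pow_dvd_pow_of_dvd h 2).mul_right b
  have hset : (Finset.Icc 1 N).filter (fun d => d ^ 2 ∣ n) = a.divisors := by
    ext d
    simp only [Finset.mem_filter, Finset.mem_Icc, Nat.mem_divisors]
    constructor
    · rintro ⟨_, h⟩; exact ⟨(hdvd d).mp h, ha⟩
    · rintro ⟨h, _⟩
      exact ⟨⟨Nat.pos_of_dvd_of_pos h (Nat.pos_of_ne_zero ha), hN d ((hdvd d).mpr h)⟩, (hdvd d).mpr h⟩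
  rw [hset, ← ArithmeticFunction.coe_mul_zeta_apply, ArithmeticFunction.moebius_mul_coe_zeta,
    ArithmeticFunction.one_apply]
  congr 1
  rw [eq_iff_iff]
  constructor
  · rintro rfl; rw [← hab]; simpa using hb
  · intro h
    have := h a (by rw [← sq, hdvd])
    exact Nat.isUnit_iff.mp this

open Classical in
/-- `n ≤ N` with `d ^ 2 ∣ n ^ 2 + 1`. -/
noncomputable def A (N d : ℕ) : Finset ℕ := (Finset.Ioc 0 N).filter (fun n => d ^ 2 ∣ n ^ 2 + 1)

lemma card_residue (N D v : ℕ) (hD : 0 < D) :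
    |(((Finset.Ioc 0 N).filter (fun n => n ≡ v [MOD D])).card : ℝ) - N / D| ≤ 1 := by
  have h := Nat.Ioc_filter_modEq_card 0 N hD v
  have hDq : (0 : ℚ) < D := by exact_mod_cast hD
  rw [max_eq_left (by
    rw [sub_nonneg]; apply Int.floor_le_floor; gcongr; simp)] at h
  have h1 := Int.floor_le (((N : ℚ) - v) / D)
  have h2 := Int.lt_floor_add_one (((N : ℚ) - v) / D)
  have h3 := Int.floor_le ((((0 : ℕ) : ℚ) - v) / D)
  have h4 := Int.lt_floor_add_one ((((0 : ℕ) : ℚ) - v) / D)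
  have h5 : (((N : ℚ) - v) / D) - ((((0 : ℕ) : ℚ) - v) / D) = N / D := by
    push_cast; field_simp; ring
  have hq : |(((Finset.Ioc 0 N).filter (fun n => n ≡ v [MOD D])).card : ℚ) - N / D| ≤ 1 := by
    have : (((Finset.Ioc 0 N).filter (fun n => n ≡ v [MOD D])).card : ℚ) =
      ((⌊((N : ℚ) - v) / D⌋ - ⌊(((0 : ℕ) : ℚ) - v) / D⌋ : ℤ) : ℚ) := by
        rw [← h]; simp
    rw [this, abs_le]
    push_cast at h1 h2 h3 h4 h5 ⊢
    constructor <;> linarith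
  have hr : |((((Finset.Ioc 0 N).filter (fun n => n ≡ v [MOD D])).card : ℚ) : ℝ) - ((N : ℚ) : ℝ) / ((D : ℚ) : ℝ)| ≤ 1 := by
    exact_mod_cast hq
  simpa only [Rat.cast_natCast] using hr

lemma card_A (N d : ℕ) (hd : 0 < d) :
    |((A N d).card : ℝ) - N * (rho d / d ^ 2)| ≤ rho d := by
  classical
  have hD : 0 < d ^ 2 := by positivity
  have : NeZero (d ^ 2) := ⟨hD.ne'⟩
  let R : Finset (ZMod (d ^ 2)) := Finset.univ.filter (fun r => r ^ 2 = -1)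
  have hR : R.card = rho d := by
    unfold rho; rw [Nat.card_eq_fintype_card, Fintype.card_subtype]
  have hmem : ∀ n : ℕ, d ^ 2 ∣ n ^ 2 + 1 ↔ ((n : ZMod (d ^ 2))) ^ 2 = -1 := by
    intro n
    rw [← ZMod.natCast_eq_zero_iff]; push_cast
    exact add_eq_zero_iff_eq_neg
  have h1 : (A N d).card = ∑ r ∈ R, ((A N d).filter (fun n : ℕ => (n : ZMod (d ^ 2)) = r)).card := by
    apply Finset.card_eq_sum_card_fiberwise
    intro n hn
    have hn : n ∈ A N d := hn
    simp only [A, Finset.mem_filter] at hn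
    simp only [R, Finset.coe_filter, Finset.mem_univ, true_and, Set.mem_ofPred_eq]
    exact (hmem n).mp hn.2
  have h2 : ∀ r ∈ R, (A N d).filter (fun n : ℕ => (n : ZMod (d ^ 2)) = r)
      = (Finset.Ioc 0 N).filter (fun n : ℕ => n ≡ r.val [MOD (d ^ 2)]) := by
    intro r hr
    simp only [R, Finset.mem_filter, Finset.mem_univ, true_and] at hr
    ext n
    simp only [A, Finset.mem_filter]
    rw [← ZMod.natCast_eq_natCast_iff, ZMod.natCast_zmod_val, hmem]
    constructor
    · rintro ⟨⟨a, b⟩, c⟩; exact ⟨a, c⟩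
    · rintro ⟨a, c⟩; exact ⟨⟨a, by rw [c, hr]⟩, c⟩
  rw [h1, ← hR, Finset.sum_congr rfl (fun r hr => by rw [h2 r hr])]
  have e : (N : ℝ) * ((R.card : ℝ) / (d : ℝ) ^ 2) = ∑ r ∈ R, (N : ℝ) / ((d ^ 2 : ℕ) : ℝ) := by
    rw [Finset.sum_const, nsmul_eq_mul]; push_cast; ring
  rw [e]
  push_cast only [Nat.cast_sum]
  rw [← Finset.sum_sub_distrib]
  refine (Finset.abs_sum_le_sum_abs _ _).trans ?_
  refine (Finset.sum_le_sum (fun r _ => card_residue N (d ^ 2) r.val hD)).trans ?_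
  simp

lemma large (N Y M B : ℕ) (h : N ^ 2 + 1 < (M + 1) * (Y + 1) ^ 2) :
    ∑ d ∈ Finset.Ioc Y B, (A N d).card ≤ M * (Nat.log 2 N + 1) := by
  classical
  let S : ℕ → Finset ℕ := fun m => (Finset.Ioc 0 N).filter (fun n => ∃ d : ℕ, n ^ 2 + 1 = d ^ 2 * m)
  have hS : ∑ m ∈ Finset.Icc 1 M, (S m).card ≤ M * (Nat.log 2 N + 1) := by
    refine (Finset.sum_le_card_nsmul _ _ (Nat.log 2 N + 1) ?_).trans (by simp)
    intro m _
    apply card_solutions m N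
    intro n hn
    simp only [S, Finset.mem_filter, Finset.mem_Ioc] at hn
    exact ⟨hn.1.1, hn.1.2, hn.2⟩
  refine le_trans ?_ hS
  rw [← Finset.card_sigma, ← Finset.card_sigma]
  have key : ∀ d n, d ∈ Finset.Ioc Y B → n ∈ A N d → n ^ 2 + 1 = d ^ 2 * ((n ^ 2 + 1) / d ^ 2) := by
    intro d n _ hn
    simp only [A, Finset.mem_filter] at hn
    exact (Nat.mul_div_cancel' hn.2).symm
  refine Finset.card_le_card_of_injOn (fun x => ⟨(x.2 ^ 2 + 1) / x.1 ^ 2, x.2⟩) ?_ ?_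
  · rintro ⟨d, n⟩ hx
    have hx := Finset.mem_sigma.mp hx
    have e := key d n hx.1 hx.2
    have hd := hx.1
    have hn := hx.2
    simp only [A, Finset.mem_filter, Finset.mem_Ioc] at hd hn
    apply Finset.mem_sigma.mpr
    simp only [S, Finset.mem_filter, Finset.mem_Ioc, Finset.mem_Icc]
    set m := (n ^ 2 + 1) / d ^ 2
    refine ⟨⟨?_, ?_⟩, hn.1, d, e⟩
    · by_contra h0
      have : m = 0 := Nat.lt_one_iff.mp (not_le.mp h0)
      rw [this] at e; simp at e
    · by_contra h0
      have h1 : M + 1 ≤ m := not_le.mp h0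
      have h2 : (Y + 1) ^ 2 ≤ d ^ 2 := Nat.pow_le_pow_left hd.1 2
      have h3 : n ^ 2 ≤ N ^ 2 := Nat.pow_le_pow_left hn.1.2 2
      have := Nat.mul_le_mul h2 h1
      linarith
  · rintro ⟨d, n⟩ hx ⟨d', n'⟩ hx' heq
    have hx := Finset.mem_sigma.mp hx
    have hx' := Finset.mem_sigma.mp hx'
    have e := key d n hx.1 hx.2
    have e' := key d' n' hx'.1 hx'.2
    simp only [Sigma.mk.injEq, heq_eq_eq] at heq
    obtain ⟨h1, rfl⟩ := heq
    rw [h1] at e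
    have hm : 0 < (n ^ 2 + 1) / d' ^ 2 := by
      rcases Nat.eq_zero_or_pos ((n ^ 2 + 1) / d' ^ 2) with h0 | h0
      · rw [h0] at e; simp at e
      · exact h0
    have h2 : d ^ 2 = d' ^ 2 := Nat.eq_of_mul_eq_mul_right hm (e.symm.trans e')
    have : d = d' := Nat.pow_left_injective (n := 2) (by norm_num) h2
    rw [this]

noncomputable def f (d : ℕ) : ℝ := (ArithmeticFunction.moebius d : ℝ) * (rho d / d ^ 2)

lemma abs_moebius_rho (d : ℕ) :
    |(ArithmeticFunction.moebius d : ℝ)| * rho d ≤ d.divisors.card := by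
  by_cases h : Squarefree d
  · have h1 : |(ArithmeticFunction.moebius d : ℝ)| ≤ 1 := by
      exact_mod_cast ArithmeticFunction.abs_moebius_le_one (n := d)
    have h2 : (rho d : ℝ) ≤ d.divisors.card := by exact_mod_cast rho_le h
    calc _ ≤ 1 * (rho d : ℝ) := by gcongr
      _ ≤ _ := by rw [one_mul]; exact h2
  · rw [ArithmeticFunction.moebius_eq_zero_of_not_squarefree h]; simp

noncomputable def g (d : ℕ) : ℝ := (d.divisors.card : ℝ) / (d : ℝ) ^ (3 / 2 : ℝ)

lemma summable_g : Summable g := by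
  have hz : LSeriesSummable (fun n => (((ArithmeticFunction.zeta : ArithmeticFunction ℕ) : ArithmeticFunction ℂ) n)) (3 / 2 : ℂ) := by
    have := (ArithmeticFunction.LSeriesSummable_zeta_iff (s := (3 / 2 : ℂ))).mpr (by norm_num)
    simpa using this
  have h := (ArithmeticFunction.LSeriesSummable_mul hz hz).norm
  refine h.congr ?_
  intro n
  rcases Nat.eq_zero_or_pos n with rfl | hn
  · simp [g]
  rw [LSeries.term_of_ne_zero hn.ne', norm_div, Complex.norm_natCast_cpow_of_pos hn]
  unfold g
  congr 1
  · rw [ArithmeticFunction.coe_mul_zeta_apply]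
    have : ∑ i ∈ n.divisors, ((ArithmeticFunction.zeta : ArithmeticFunction ℂ) i) = (n.divisors.card : ℂ) := by
      rw [Finset.sum_congr rfl (g := fun _ => (1 : ℂ))]
      · simp
      · intro i hi
        have := Nat.pos_of_mem_divisors hi
        simp [ArithmeticFunction.natCoe_apply, ArithmeticFunction.zeta_apply, this.ne']
    rw [this]; simp
  · norm_num

lemma g_nonneg (d : ℕ) : 0 ≤ g d := by unfold g; positivity

lemma abs_f_le (d : ℕ) : |f d| ≤ d.divisors.card / (d : ℝ) ^ 2 := by
  unfold f
  rw [abs_mul, abs_of_nonneg (show (0 : ℝ) ≤ rho d / d ^ 2 by positivity), ← mul_div_assoc]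
  gcongr
  exact abs_moebius_rho d

lemma abs_f_le_g (d : ℕ) (y : ℝ) (hy : 0 < y) (h : y ≤ d) : |f d| ≤ y ^ (-(1 / 2) : ℝ) * g d := by
  refine (abs_f_le d).trans ?_
  have hd : (0 : ℝ) < d := hy.trans_le h
  unfold g
  have e : (d : ℝ) ^ 2 = (d : ℝ) ^ (3 / 2 : ℝ) * (d : ℝ) ^ (1 / 2 : ℝ) := by
    rw [← Real.rpow_add hd]; norm_num
  have h2 : (d : ℝ) ^ (-(1 / 2) : ℝ) ≤ y ^ (-(1 / 2) : ℝ) :=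
    Real.rpow_le_rpow_of_nonpos hy h (by norm_num)
  calc (d.divisors.card : ℝ) / (d : ℝ) ^ 2 = (d : ℝ) ^ (-(1 / 2) : ℝ) * (d.divisors.card / (d : ℝ) ^ (3 / 2 : ℝ)) := by
        rw [e, Real.rpow_neg hd.le]; field_simp
    _ ≤ _ := by gcongr

lemma f_zero : f 0 = 0 := by simp [f]

lemma summable_abs_f : Summable (fun d => |f d|) := by
  refine Summable.of_nonneg_of_le (fun _ => abs_nonneg _) ?_ summable_g
  intro d
  rcases Nat.eq_zero_or_pos d with rfl | hd
  · simp [f_zero, g_nonneg]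
  · have := abs_f_le_g d 1 one_pos (by exact_mod_cast hd)
    simpa using this

lemma tail (y : ℝ) (hy : 0 < y) :
    |∑' d, f d - ∑ d ∈ Finset.Ioc 0 ⌊y⌋₊, f d| ≤ y ^ (-(1 / 2) : ℝ) * ∑' d, g d := by
  have hf : Summable f := summable_abs_f.of_abs
  have h1 := hf.sum_add_tsum_nat_add (⌊y⌋₊ + 1)
  have h2 : ∑ d ∈ Finset.range (⌊y⌋₊ + 1), f d = ∑ d ∈ Finset.Ioc 0 ⌊y⌋₊, f d := by
    rw [Finset.range_eq_Ico, Finset.sum_eq_sum_Ico_succ_bot (by omega), f_zero, zero_add]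
    rfl
  rw [← h1, h2, add_sub_cancel_left]
  have hs : Summable (fun i => |f (i + (⌊y⌋₊ + 1))|) := (summable_nat_add_iff (f := fun d => |f d|) _).mpr summable_abs_f
  have hg : Summable (fun i => g (i + (⌊y⌋₊ + 1))) := (summable_nat_add_iff _).mpr summable_g
  calc |∑' i, f (i + (⌊y⌋₊ + 1))| ≤ ∑' i, |f (i + (⌊y⌋₊ + 1))| := by
        simpa using norm_tsum_le_tsum_norm (f := fun i => f (i + (⌊y⌋₊ + 1))) hs
    _ ≤ ∑' i, y ^ (-(1 / 2) : ℝ) * g (i + (⌊y⌋₊ + 1)) := by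
        refine hs.tsum_le_tsum (fun i => abs_f_le_g _ y hy ?_) (hg.mul_left _)
        have := (Nat.lt_floor_add_one y).le
        push_cast
        have : (0 : ℝ) ≤ i := by positivity
        linarith
    _ = y ^ (-(1 / 2) : ℝ) * ∑' i, g (i + (⌊y⌋₊ + 1)) := tsum_mul_left
    _ ≤ _ := by
        have := summable_g.sum_add_tsum_nat_add (⌊y⌋₊ + 1)
        have h3 : 0 ≤ ∑ d ∈ Finset.range (⌊y⌋₊ + 1), g d := Finset.sum_nonneg (fun i _ => g_nonneg i)
        refine mul_le_mul_of_nonneg_left ?_ (by positivity)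
        linarith

lemma f_mul {m n : ℕ} (h : m.Coprime n) : f (m * n) = f m * f n := by
  unfold f
  rw [rho_mul h, ArithmeticFunction.isMultiplicative_moebius.map_mul_of_coprime h]
  push_cast
  rw [mul_pow, mul_div_mul_comm]; ring

lemma f_prime_pow {p : ℕ} (hp : p.Prime) : ∑' e, f (p ^ e) = 1 - rho p / (p : ℝ) ^ 2 := by
  rw [tsum_eq_sum (s := Finset.range 2)]
  · simp [Finset.sum_range_succ, f, rho_one, ArithmeticFunction.moebius_apply_prime hp]
    ring
  · intro e he
    have : 2 ≤ e := by
      have : 1 < e := by simpa using he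
      exact this
    unfold f
    rw [ArithmeticFunction.moebius_eq_zero_of_not_squarefree]
    · simp
    · intro hsq
      have h := hsq p (by rw [← sq]; exact pow_dvd_pow p this)
      exact hp.one_lt.ne' (Nat.isUnit_iff.mp h)

lemma tsum_f : ∑' d, f d = squarefreeConstant := by
  have h := EulerProduct.eulerProduct_hasProd_mulIndicator (f := f) (by simp [f, rho_one]) f_mul
    (by simpa using summable_abs_f) f_zero
  rw [← h.tprod_eq]
  unfold squarefreeConstant
  have h2 := tprod_subtype {p : ℕ | p.Prime ∧ p % 4 = 1} (fun p : ℕ => (1 - 2 / (p : ℝ) ^ 2))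
  refine Eq.trans ?_ h2.symm
  congr 1
  funext p
  by_cases hp : p.Prime
  · rw [Set.mulIndicator_of_mem (show p ∈ {p | Nat.Prime p} from hp), f_prime_pow hp]
    by_cases h1 : p % 4 = 1
    · rw [Set.mulIndicator_of_mem (show p ∈ {p : ℕ | p.Prime ∧ p % 4 = 1} from ⟨hp, h1⟩), rho_prime_one hp h1]
      norm_num
    · rw [Set.mulIndicator_of_notMem (fun h => h1 h.2)]
      have : rho p = 0 := by
        rcases hp.eq_two_or_odd with rfl | h
        · exact rho_two
        · exact rho_three hp (by omega)
      simp [this]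
  · rw [Set.mulIndicator_of_notMem (show p ∉ {p | Nat.Prime p} from hp),
      Set.mulIndicator_of_notMem (show p ∉ {p : ℕ | p.Prime ∧ p % 4 = 1} from fun h => hp h.1)]

lemma sum_divisors_le (Y : ℕ) :
    (∑ d ∈ Finset.Ioc 0 Y, (d.divisors.card : ℝ)) ≤ Y * (1 + Real.log Y) := by
  have h := ArithmeticFunction.sum_Ioc_sigma0_eq_sum_div Y
  simp only [ArithmeticFunction.sigma_zero_apply] at h
  have h' : (∑ d ∈ Finset.Ioc 0 Y, (d.divisors.card : ℝ)) = ∑ n ∈ Finset.Ioc 0 Y, ((Y / n : ℕ) : ℝ) := by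
    exact_mod_cast h
  rw [h']
  calc ∑ n ∈ Finset.Ioc 0 Y, ((Y / n : ℕ) : ℝ) ≤ ∑ n ∈ Finset.Ioc 0 Y, (Y : ℝ) * (n : ℝ)⁻¹ :=
        Finset.sum_le_sum (fun n _ => by rw [← div_eq_mul_inv]; exact Nat.cast_div_le)
    _ = Y * ((harmonic Y : ℚ) : ℝ) := by
        rw [← Finset.mul_sum, harmonic_eq_sum_Icc]; push_cast; rfl
    _ ≤ _ := by gcongr; exact harmonic_le_one_add_log Y

lemma count_eq (N B : ℕ) (hB : N ≤ B) :
    ((((Finset.Icc 1 N).filter (fun n => Squarefree (n ^ 2 + 1))).card : ℤ)) =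
      ∑ d ∈ Finset.Ioc 0 B, ArithmeticFunction.moebius d * (A N d).card := by
  classical
  rw [Finset.card_filter]
  push_cast
  have h1 : ∀ n ∈ Finset.Icc 1 N, (if Squarefree (n ^ 2 + 1) then (1 : ℤ) else 0) =
      ∑ d ∈ Finset.Icc 1 B, if d ^ 2 ∣ n ^ 2 + 1 then ArithmeticFunction.moebius d else 0 := by
    intro n hn
    rw [← Finset.sum_filter, sum_moebius _ _ (by omega)]
    intro d hd
    have hn := Finset.mem_Icc.mp hn
    have := Nat.le_of_dvd (by omega) hd
    have : d ≤ n := by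
      by_contra h
      have : (n + 1) ^ 2 ≤ d ^ 2 := Nat.pow_le_pow_left (by omega) 2
      nlinarith
    omega
  rw [Finset.sum_congr rfl h1, Finset.sum_comm]
  refine Finset.sum_congr rfl (fun d _ => ?_)
  rw [← Finset.sum_filter, Finset.sum_const, nsmul_eq_mul, mul_comm]
  rfl

lemma main_bound (y : ℝ) (hy : 0 < y) (N M : ℕ) (h : N ^ 2 + 1 < (M + 1) * (⌊y⌋₊ + 1) ^ 2) :
    |((((Finset.Icc 1 N).filter (fun n => Squarefree (n ^ 2 + 1))).card : ℝ)) - squarefreeConstant * N| ≤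
      ⌊y⌋₊ * (1 + Real.log ⌊y⌋₊) + N * (y ^ (-(1 / 2) : ℝ) * ∑' d, g d) + M * (Nat.log 2 N + 1) := by
  set Y := ⌊y⌋₊ with hY
  have h1 : ((((Finset.Icc 1 N).filter (fun n => Squarefree (n ^ 2 + 1))).card : ℝ)) =
      ∑ d ∈ Finset.Ioc 0 (N + Y), (ArithmeticFunction.moebius d : ℝ) * (A N d).card := by
    exact_mod_cast congrArg (fun z : ℤ => (z : ℝ)) (count_eq N (N + Y) (by omega))
  rw [h1, ← Finset.sum_Ioc_consecutive _ (Nat.zero_le Y) (show Y ≤ N + Y by omega)]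
  have a1 : |∑ d ∈ Finset.Ioc 0 Y, ((ArithmeticFunction.moebius d : ℝ) * (A N d).card - N * f d)| ≤
      Y * (1 + Real.log Y) := by
    refine (Finset.abs_sum_le_sum_abs _ _).trans (le_trans (Finset.sum_le_sum ?_) (sum_divisors_le Y))
    intro d hd
    have hd := (Finset.mem_Ioc.mp hd).1
    have e : (ArithmeticFunction.moebius d : ℝ) * (A N d).card - N * f d
      = (ArithmeticFunction.moebius d : ℝ) * ((A N d).card - N * (rho d / d ^ 2)) := by
        unfold f; ring
    rw [e, abs_mul]
    refine le_trans ?_ (abs_moebius_rho d)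
    gcongr
    exact card_A N d hd
  have a2 : |(N : ℝ) * (∑' d, f d - ∑ d ∈ Finset.Ioc 0 Y, f d)| ≤ N * (y ^ (-(1 / 2) : ℝ) * ∑' d, g d) := by
    rw [abs_mul, Nat.abs_cast]
    gcongr
    exact tail y hy
  have a3 : |∑ d ∈ Finset.Ioc Y (N + Y), (ArithmeticFunction.moebius d : ℝ) * (A N d).card| ≤
      M * (Nat.log 2 N + 1) := by
    refine (Finset.abs_sum_le_sum_abs _ _).trans ?_
    have : ((∑ d ∈ Finset.Ioc Y (N + Y), (A N d).card : ℕ) : ℝ) ≤ ((M * (Nat.log 2 N + 1) : ℕ) : ℝ) := by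
      exact_mod_cast large N Y M (N + Y) h
    push_cast at this
    refine le_trans (Finset.sum_le_sum ?_) this
    intro d _
    rw [abs_mul, Nat.abs_cast]
    have h1 : |(ArithmeticFunction.moebius d : ℝ)| ≤ 1 := by
      exact_mod_cast ArithmeticFunction.abs_moebius_le_one (n := d)
    exact mul_le_of_le_one_left (by positivity) h1
  rw [← tsum_f]
  rw [Finset.sum_sub_distrib, ← Finset.mul_sum] at a1
  rw [abs_le] at *
  constructor <;> nlinarith [a1.1, a1.2, a2.1, a2.2, a3.1, a3.2]

end Esterm

theorem estermann_squarefree_values :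
    ∃ C : ℝ, ∀ x : ℝ, 2 ≤ x →
      |(countSquarefreeVals x : ℝ) - squarefreeConstant * x| ≤
        C * x ^ (2 / 3 : ℝ) * Real.log x := by
  obtain ⟨K, hK⟩ : ∃ K, K = ∑' d, Esterm.g d := ⟨_, rfl⟩
  have hK0 : 0 ≤ K := hK ▸ tsum_nonneg Esterm.g_nonneg
  have hl2 : 0 < Real.log 2 := Real.log_pos (by norm_num)
  refine ⟨(1 / Real.log 2 + 1) + K / Real.log 2 + 4 / Real.log 2 + |squarefreeConstant| / Real.log 2, ?_⟩
  intro x hx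
  have hx0 : 0 < x := by linarith
  have hlx : Real.log 2 ≤ Real.log x := Real.log_le_log (by norm_num) hx
  obtain ⟨y, hy⟩ : ∃ y, y = x ^ (2 / 3 : ℝ) := ⟨_, rfl⟩
  have hy1 : 1 ≤ y := by rw [hy]; exact Real.one_le_rpow (by linarith) (by norm_num)
  have hy0 : 0 < y := by linarith
  have hyx : y ≤ x := by
    rw [hy]
    calc x ^ (2 / 3 : ℝ) ≤ x ^ (1 : ℝ) := Real.rpow_le_rpow_of_exponent_le (by linarith) (by norm_num)
      _ = x := Real.rpow_one x
  have hy3 : y * y ^ 2 = x ^ 2 := by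
    rw [hy, ← pow_succ', ← Real.rpow_natCast, ← Real.rpow_mul hx0.le, ← Real.rpow_natCast]
    norm_num
  have hxy : x * y ^ (-(1 / 2) : ℝ) = y := by
    rw [hy, ← Real.rpow_mul hx0.le]
    nth_rewrite 1 [← Real.rpow_one x]
    rw [← Real.rpow_add hx0]; norm_num
  set N := ⌊x⌋₊ with hN
  have hNx : (N : ℝ) ≤ x := Nat.floor_le hx0.le
  have hN2 : 2 ≤ N := Nat.le_floor (by exact_mod_cast hx)
  have hNx' : x < N + 1 := Nat.lt_floor_add_one x
  have hYy : (⌊y⌋₊ : ℝ) ≤ y := Nat.floor_le hy0.le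
  have hY1 : 1 ≤ ⌊y⌋₊ := Nat.le_floor (by exact_mod_cast hy1)
  have hM : (⌊2 * y⌋₊ : ℝ) ≤ 2 * y := Nat.floor_le (by positivity)
  have hcond : N ^ 2 + 1 < (⌊2 * y⌋₊ + 1) * (⌊y⌋₊ + 1) ^ 2 := by
    have h1 : 2 * y < (⌊2 * y⌋₊ : ℝ) + 1 := Nat.lt_floor_add_one _
    have h2 : y < (⌊y⌋₊ : ℝ) + 1 := Nat.lt_floor_add_one _
    have h3 : 2 * y * y ^ 2 < ((⌊2 * y⌋₊ : ℝ) + 1) * ((⌊y⌋₊ : ℝ) + 1) ^ 2 := by gcongr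
    have h4 : (N : ℝ) ^ 2 ≤ x ^ 2 := by gcongr
    have : (N : ℝ) ^ 2 + 1 < ((⌊2 * y⌋₊ : ℝ) + 1) * ((⌊y⌋₊ : ℝ) + 1) ^ 2 := by nlinarith
    exact_mod_cast this
  have hb := Esterm.main_bound y hy0 N _ hcond
  rw [← hK] at hb
  have hcount : (countSquarefreeVals x : ℝ) =
    (((Finset.Icc 1 N).filter (fun n => Squarefree (n ^ 2 + 1))).card : ℝ) := rfl
  rw [← hcount] at hb
  have b0 : 1 ≤ Real.log x / Real.log 2 := (one_le_div hl2).mpr hlx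
  have b1 : (⌊y⌋₊ : ℝ) * (1 + Real.log ⌊y⌋₊) ≤ y * ((1 / Real.log 2 + 1) * Real.log x) := by
    have h1 : Real.log ⌊y⌋₊ ≤ Real.log x :=
      Real.log_le_log (by exact_mod_cast hY1) (hYy.trans hyx)
    have h2 : 0 ≤ Real.log (⌊y⌋₊ : ℝ) := Real.log_natCast_nonneg _
    have h3 : 1 + Real.log ⌊y⌋₊ ≤ (1 / Real.log 2 + 1) * Real.log x := by
      have : (1 / Real.log 2 + 1) * Real.log x = Real.log x / Real.log 2 + Real.log x := by ring
      linarith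
    gcongr
  have b2 : (N : ℝ) * (y ^ (-(1 / 2) : ℝ) * K) ≤ y * (K / Real.log 2 * Real.log x) := by
    calc (N : ℝ) * (y ^ (-(1 / 2) : ℝ) * K) ≤ x * (y ^ (-(1 / 2) : ℝ) * K) := by gcongr
      _ = y * K * 1 := by rw [← mul_assoc, hxy, mul_one]
      _ ≤ y * K * (Real.log x / Real.log 2) := by gcongr
      _ = _ := by ring
  have b3 : (⌊2 * y⌋₊ : ℝ) * (Nat.log 2 N + 1) ≤ y * (4 / Real.log 2 * Real.log x) := by
    have h1 : (Nat.log 2 N : ℝ) ≤ Real.log x / Real.log 2 := by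
      rw [le_div_iff₀ hl2, ← Real.log_pow]
      apply Real.log_le_log (by positivity)
      have : 2 ^ Nat.log 2 N ≤ N := Nat.pow_log_le_self 2 (by omega)
      refine le_trans ?_ hNx
      exact_mod_cast this
    calc (⌊2 * y⌋₊ : ℝ) * (Nat.log 2 N + 1) ≤ (2 * y) * (Real.log x / Real.log 2 + Real.log x / Real.log 2) := by
          gcongr
      _ = _ := by ring
  have b4 : |squarefreeConstant * N - squarefreeConstant * x| ≤ y * (|squarefreeConstant| / Real.log 2 * Real.log x) := by
    rw [← mul_sub, abs_mul]
    have h1 : |(N : ℝ) - x| ≤ 1 := by rw [abs_le]; constructor <;> linarith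
    calc |squarefreeConstant| * |(N : ℝ) - x| ≤ |squarefreeConstant| * 1 := by gcongr
      _ = 1 * |squarefreeConstant| * 1 := by ring
      _ ≤ y * |squarefreeConstant| * (Real.log x / Real.log 2) := by gcongr
      _ = _ := by ring
  rw [← hy]
  calc |(countSquarefreeVals x : ℝ) - squarefreeConstant * x|
      ≤ |(countSquarefreeVals x : ℝ) - squarefreeConstant * N| + |squarefreeConstant * N - squarefreeConstant * x| :=
        abs_sub_le _ _ _
    _ ≤ y * ((1 / Real.log 2 + 1) * Real.log x) + y * (K / Real.log 2 * Real.log x)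
        + y * (4 / Real.log 2 * Real.log x) + y * (|squarefreeConstant| / Real.log 2 * Real.log x) := by linarith
    _ = _ := by ring
end

section
/- Let η > 0. There exist constants D = D(η), κ = κ(η), and x₀ = x₀(η) with the following property. Let x ≥ x₀, let E and F be reals with x^{1/2} ≤ E, x^{1/2} ≤ F, and x²/8 ≤ E²·F ≤ 8·x², and let M be an integer with x^{1/2} ≤ M ≤ x and log M ≥ (9/8)·(1+η)·(log E)·(log F)/(log x). Then for every real s₀ there exist nonzero polynomials C₁, C₂ ∈ ℤ[s, t], each of total degree at most D and with all coefficients of absolute value at most x^κ, such that every quadruple of integers (x₁, x₂, y₁, y₂) satisfying 2x₁x₂y₁ + (x₁² − x₂²)y₂ = 1, E/2 < x₁² + x₂² ≤ E, F/2 < y₁² + y₂² ≤ F, |x₁| ≤ |x₂|, and s₀ < x₁/x₂ ≤ s₀ + 1/M, satisfies C₁(x₁/x₂, y₁/y₂) = 0 or C₂(x₁/x₂, y₂/y₁) = 0. -/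
lemma dm_pigeon {ι τ : Type*} [Fintype ι] [DecidableEq ι] [DecidableEq τ] [Fintype τ]
    (L : τ → ι → ℝ) (G : ℝ) (hG : ∀ t i, |L t i| ≤ G) (H : ℕ)
    (ρ : τ → ℝ) (hρ : ∀ t, 0 < ρ t)
    (hc : ∏ t, (2 * (Fintype.card ι * G * H / ρ t) + 2) < ((H : ℝ) + 1) ^ (Fintype.card ι)) :
    ∃ c : ι → ℤ, c ≠ 0 ∧ (∀ i, |c i| ≤ H) ∧ ∀ t, |∑ i, L t i * c i| ≤ ρ t := by
  classical
  set B : τ → ℝ := fun t => Fintype.card ι * G * H / ρ t with hB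
  let s : Finset (ι → ℤ) := Fintype.piFinset fun _ => Finset.Icc (0 : ℤ) H
  let T : Finset (τ → ℤ) := Fintype.piFinset fun t => Finset.Icc ⌊-B t⌋ ⌊B t⌋
  let φ : (ι → ℤ) → (τ → ℤ) := fun c t => ⌊(∑ i, L t i * c i) / ρ t⌋
  have hbd : ∀ c ∈ s, ∀ t, |(∑ i, L t i * c i) / ρ t| ≤ B t := by
    intro c hcs t
    rw [abs_div, abs_of_pos (hρ t)]
    apply div_le_div_of_nonneg_right _ (hρ t).le
    calc |∑ i, L t i * (c i : ℝ)| ≤ ∑ i, |L t i * (c i : ℝ)| := Finset.abs_sum_le_sum_abs _ _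
      _ ≤ ∑ i : ι, G * H := by
        apply Finset.sum_le_sum
        intro i _
        have := Fintype.mem_piFinset.1 hcs i
        rw [Finset.mem_Icc] at this
        rw [abs_mul]
        have h0 : (0:ℝ) ≤ c i := by exact_mod_cast this.1
        have h1 : (c i : ℝ) ≤ H := by exact_mod_cast this.2
        rw [abs_of_nonneg h0]
        exact mul_le_mul (hG t i) h1 h0 ((abs_nonneg _).trans (hG t i))
      _ = _ := by simp [mul_assoc]
  have hmaps : ∀ c ∈ s, φ c ∈ T := by
    intro c hcs
    refine Fintype.mem_piFinset.2 fun t => Finset.mem_Icc.2 ?_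
    have := abs_le.1 (hbd c hcs t)
    exact ⟨Int.floor_le_floor this.1, Int.floor_le_floor this.2⟩
  have hcard : T.card < s.card := by
    have h1 : (s.card : ℝ) = ((H : ℝ) + 1) ^ (Fintype.card ι) := by
      simp only [s, Fintype.card_piFinset]
      simp
    have hz : (0 : ι → ℤ) ∈ s := Fintype.mem_piFinset.2 fun i => by simp
    have h2 : (T.card : ℝ) ≤ ∏ t, (2 * B t + 2) := by
      simp only [T, Fintype.card_piFinset]
      push_cast
      apply Finset.prod_le_prod
      · intros; positivity
      · intro t _
        have hB0 : 0 ≤ B t := (abs_nonneg _).trans (hbd 0 hz t)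
        rw [Int.card_Icc]
        have : (0:ℤ) ≤ ⌊B t⌋ + 1 - ⌊-B t⌋ := by
          have := Int.floor_le_floor (show -B t ≤ B t by linarith)
          omega
        have e : (((⌊B t⌋ + 1 - ⌊-B t⌋).toNat : ℕ) : ℝ) = ((⌊B t⌋ + 1 - ⌊-B t⌋ : ℤ) : ℝ) := by
          exact_mod_cast Int.toNat_of_nonneg this
        rw [e]
        push_cast
        have := Int.floor_le (B t)
        have := Int.lt_floor_add_one (-B t)
        linarith
    have : (T.card : ℝ) < s.card := by rw [h1]; exact h2.trans_lt hc
    exact_mod_cast this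
  obtain ⟨c, hcs, d, hds, hne, heq⟩ := Finset.exists_ne_map_eq_of_card_lt_of_maps_to hcard hmaps
  refine ⟨c - d, sub_ne_zero.2 hne, fun i => ?_, fun t => ?_⟩
  · have h1 := Finset.mem_Icc.1 (Fintype.mem_piFinset.1 hcs i)
    have h2 := Finset.mem_Icc.1 (Fintype.mem_piFinset.1 hds i)
    rw [Pi.sub_apply, abs_le]
    constructor <;> omega
  · have h := Int.abs_sub_lt_one_of_floor_eq_floor (congrFun heq t)
    have e : ∑ i, L t i * ((c - d) i : ℤ) = ∑ i, L t i * c i - ∑ i, L t i * d i := by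
      rw [← Finset.sum_sub_distrib]
      exact Finset.sum_congr rfl fun i _ => by rw [Pi.sub_apply]; push_cast; ring
    rw [← sub_div, abs_div, abs_of_pos (hρ t), div_lt_one (hρ t)] at h
    rw [e]; exact h.le

lemma dm_sum1 (n : ℕ) : ∀ y : ℝ, ∑ j ∈ Finset.range n, max (y - j) 0 ≤ (max (y + 1) 0) ^ 2 / 2 := by
  induction n with
  | zero => intro y; simp; positivity
  | succ n ih =>
    intro y
    rw [Finset.sum_range_succ']
    have h := ih (y - 1)
    have e : ∀ j : ℕ, y - ((j + 1 : ℕ) : ℝ) = y - 1 - j := fun j => by push_cast; ring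
    simp only [e]
    simp only [sub_add_cancel, Nat.cast_zero, sub_zero] at h ⊢
    rcases le_total 0 y with hy | hy
    · rw [max_eq_left hy] at *
      rw [max_eq_left (by linarith)]
      nlinarith
    · rw [max_eq_right hy] at *
      nlinarith [sq_nonneg (max (y+1) 0)]

lemma dm_sum2 (m : ℝ) (hm : 0 < m) (n : ℕ) : ∀ z : ℝ,
    ∑ i ∈ Finset.range n, (max (z - i * m) 0) ^ 2 / 2 ≤ (max (z + m) 0) ^ 3 / (6 * m) := by
  induction n with
  | zero => intro y; simp; positivity
  | succ n ih =>
    intro z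
    rw [Finset.sum_range_succ']
    have h := ih (z - m)
    have e : ∀ j : ℕ, z - ((j + 1 : ℕ) : ℝ) * m = z - m - j * m := fun j => by push_cast; ring
    simp only [e]
    simp only [sub_add_cancel, Nat.cast_zero, sub_zero, zero_mul] at h ⊢
    rcases le_total 0 z with hy | hy
    · rw [max_eq_left hy] at *
      rw [max_eq_left (by linarith)]
      have : (z + m) ^ 3 / (6 * m) = z ^ 3 / (6 * m) + z ^ 2 / 2 + (z * m / 2 + m ^ 2 / 6) := by
        field_simp; ring
      have : 0 ≤ z * m / 2 + m ^ 2 / 6 := by positivity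
      linarith
    · rw [max_eq_right hy] at *
      have : 0 ≤ (max (z + m) 0) ^ 3 / (6 * m) := by positivity
      norm_num at h ⊢
      linarith

lemma dm_sum (m k : ℝ) (hm : 0 < m) (hk : 0 ≤ k + m + 1) (n n' : ℕ) :
    ∑ i ∈ Finset.range n, ∑ j ∈ Finset.range n', max (k - i * m - j) 0
      ≤ (k + m + 1) ^ 3 / (6 * m) := by
  calc _ ≤ ∑ i ∈ Finset.range n, (max (k + 1 - i * m) 0) ^ 2 / 2 := by
        apply Finset.sum_le_sum
        intro i _
        have := dm_sum1 n' (k - i * m)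
        rwa [show k - i * m + 1 = k + 1 - i * m by ring] at this
    _ ≤ _ := dm_sum2 m hm n (k + 1)
    _ = _ := by rw [show k + 1 + m = k + m + 1 by ring, max_eq_left hk]

set_option maxHeartbeats 1000000 in
lemma dm_param (η A e f m : ℝ) (hη : 0 < η) (hA : 1 ≤ A) (hA' : 4 ≤ A * ((√(1 + η) - 1) / 2))
    (he : 1 / 2 ≤ e) (he1 : e ≤ 1) (hf : 1 / 2 ≤ f) (hf1 : f ≤ 2) (hm : 1 / 2 ≤ m) (hm1 : m ≤ 1)
    (h : 9 / 8 * (1 + η) * (e * f) ≤ m) :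
    ∃ (a b : ℕ) (k : ℝ), a ≤ 2 * A ∧ b ≤ 2 * A ∧ k ≤ 2 * A ∧
      ∀ n n', ∑ i ∈ Finset.range n, ∑ j ∈ Finset.range n', max (k - i * m - j) 0 + 1
        ≤ ((a : ℝ) + 1) * (b + 1) * (k - (a * e + b * f) / 2 - 1) := by
  obtain ⟨r, hr⟩ : ∃ r, r = √e := ⟨_, rfl⟩
  obtain ⟨g, hg⟩ : ∃ g, g = √f := ⟨_, rfl⟩
  obtain ⟨q, hq⟩ : ∃ q, q = √(2 * m) := ⟨_, rfl⟩
  obtain ⟨v, hv⟩ : ∃ v, v = √(1 + η) := ⟨_, rfl⟩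
  have hr2 : r ^ 2 = e := by rw [hr]; exact Real.sq_sqrt (by linarith)
  have hg2 : g ^ 2 = f := by rw [hg]; exact Real.sq_sqrt (by linarith)
  have hq2 : q ^ 2 = 2 * m := by rw [hq]; exact Real.sq_sqrt (by linarith)
  have hv2 : v ^ 2 = 1 + η := by rw [hv]; exact Real.sq_sqrt (by linarith)
  have hr0 : 0 < r := by rw [hr]; apply Real.sqrt_pos.2; linarith
  have hg0 : 0 < g := by rw [hg]; apply Real.sqrt_pos.2; linarith
  have hq0 : 0 < q := by rw [hq]; apply Real.sqrt_pos.2; linarith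
  have hv0 : 0 < v := by rw [hv]; apply Real.sqrt_pos.2; linarith
  rw [← hv] at hA'
  have hv1 : 1 < v := by nlinarith
  have hgr : g ≤ 2 * r := abs_le_of_sq_le_sq' (by nlinarith) (by linarith) |>.2
  have hrg : r ≤ 2 * g := abs_le_of_sq_le_sq' (by nlinarith) (by linarith) |>.2
  have hq1 : q ≤ 2 := abs_le_of_sq_le_sq' (by nlinarith) (by linarith) |>.2
  have hrg2 : 1 / 2 ≤ r * g := abs_le_of_sq_le_sq' (by rw [mul_pow, hr2, hg2]; nlinarith) (by positivity) |>.2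
  have hkey : v * (r * g) ≤ 2 / 3 * q := abs_le_of_sq_le_sq' (by
    rw [mul_pow, mul_pow, mul_pow, hr2, hg2, hv2, hq2]; linarith) (by positivity) |>.2
  have ha : (⌊A * g / r⌋₊ : ℝ) ≤ A * g / r := Nat.floor_le (by positivity)
  have hb : (⌊A * r / g⌋₊ : ℝ) ≤ A * r / g := Nat.floor_le (by positivity)
  have ha' := Nat.lt_floor_add_one (A * g / r)
  have hb' := Nat.lt_floor_add_one (A * r / g)
  refine ⟨⌊A * g / r⌋₊, ⌊A * r / g⌋₊, A * q - m - 1, ?_, ?_, ?_, ?_⟩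
  · refine ha.trans ?_
    rw [div_le_iff₀ hr0]; nlinarith
  · refine hb.trans ?_
    rw [div_le_iff₀ hg0]; nlinarith
  · nlinarith
  · intro n n'
    have hS := dm_sum m (A * q - m - 1) (by linarith) (by nlinarith) n n'
    have e1 : (A * q - m - 1 + m + 1) ^ 3 / (6 * m) = A ^ 3 * q / 3 := by
      have : m = q ^ 2 / 2 := by linarith
      rw [this]; field_simp; ring
    rw [e1] at hS
    have hN : A ^ 2 ≤ ((⌊A * g / r⌋₊ : ℝ) + 1) * (⌊A * r / g⌋₊ + 1) := by
      have : A ^ 2 = (A * g / r) * (A * r / g) := by field_simp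
      rw [this]
      gcongr
    have hl : (⌊A * g / r⌋₊ * e + ⌊A * r / g⌋₊ * f) / 2 ≤ A * (r * g) := by
      have : A * (r * g) = ((A * g / r) * e + (A * r / g) * f) / 2 := by
        rw [← hr2, ← hg2]; field_simp; ring
      rw [this]
      gcongr
    have hl2 : A * q / 3 + 1 ≤ A * q - m - 1 - (⌊A * g / r⌋₊ * e + ⌊A * r / g⌋₊ * f) / 2 - 1 := by
      have h0 : (v - 1) * (1 / 2) ≤ (v - 1) * (r * g) := by gcongr
      have h1 : (v - 1) / 2 ≤ 2 / 3 * q - r * g := by linarith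
      have h2 : A * ((v - 1) / 2) ≤ A * (2 / 3 * q - r * g) := by gcongr
      have h3 : A * (2 / 3 * q - r * g) = 2 / 3 * (A * q) - A * (r * g) := by ring
      linarith
    have hA2 : 1 ≤ A ^ 2 := one_le_pow₀ hA
    calc _ ≤ A ^ 3 * q / 3 + 1 := by linarith
      _ ≤ A ^ 3 * q / 3 + A ^ 2 := by linarith
      _ = A ^ 2 * (A * q / 3 + 1) := by ring
      _ ≤ _ := by
        apply mul_le_mul hN hl2 (by positivity) (by positivity)


open Polynomial in
lemma dm_polybd (R : ℝ[X]) : ∃ B : ℕ, R.natDegree < B ∧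
    ∀ i, ∀ y : ℝ, |y| ≤ 2 → |(taylor y R).coeff i| ≤ B := by
  let g : ℝ → ℝ := fun y => ∑ i ∈ Finset.range (R.natDegree + 1), |(hasseDeriv i R).eval y|
  have hg : Continuous g := by
    apply continuous_finsetSum
    intro i _
    exact (Polynomial.continuous _).abs
  obtain ⟨K, hK⟩ := (isCompact_Icc (a := (-2 : ℝ)) (b := 2)).exists_bound_of_continuousOn
    hg.continuousOn
  refine ⟨R.natDegree + 1 + ⌈K⌉₊, by omega, fun i y hy => ?_⟩
  have h1 := hK y (abs_le.1 hy)
  rcases lt_or_ge i (R.natDegree + 1) with hi | hi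
  · rw [taylor_coeff]
    have h2 : |(hasseDeriv i R).eval y| ≤ g y :=
      Finset.single_le_sum (f := fun i => |(hasseDeriv i R).eval y|)
        (fun _ _ => abs_nonneg _) (Finset.mem_range.2 hi)
    have h3 : g y ≤ K := (le_abs_self _).trans h1
    have h4 := Nat.le_ceil K
    push_cast
    have : (0:ℝ) ≤ R.natDegree := by positivity
    linarith
  · rw [coeff_eq_zero_of_natDegree_lt (by rw [natDegree_taylor]; omega)]
    simp; positivity

open Polynomial in
lemma dm_polybd_fin {ι : Type*} (s : Finset ι) (R : ι → ℝ[X]) : ∃ B : ℕ, ∀ j ∈ s, (R j).natDegree < B ∧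
    ∀ i, ∀ y : ℝ, |y| ≤ 2 → |(taylor y (R j)).coeff i| ≤ B := by
  choose B hB using fun j => dm_polybd (R j)
  refine ⟨s.sup B, fun j hj => ?_⟩
  have := Finset.le_sup (f := B) hj
  refine ⟨(hB j).1.trans_le this, fun i y hy => ((hB j).2 i y hy).trans ?_⟩
  exact_mod_cast this

open Polynomial in
noncomputable def dmR (p q : ℝ[X]) (α β b j : ℕ) : ℝ[X] :=
  C (β.choose j : ℝ) * X ^ α * q ^ (b - β) * p ^ (β - j)

open Polynomial in
lemma dm_expand (p q : ℝ[X]) (α β b n : ℕ) (hβ : β ≤ b)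
    (hn : ∀ j ≤ b, (dmR p q α β b j).natDegree < n) (s s0 t : ℝ) :
    q.eval s ^ b * (s ^ α * t ^ β) =
      ∑ i ∈ Finset.range n, ∑ j ∈ Finset.range (b + 1),
        (taylor s0 (dmR p q α β b j)).coeff i *
          ((s - s0) ^ i * (t * q.eval s - p.eval s) ^ j) := by
  set w := t * q.eval s - p.eval s with hw
  have htq : t * q.eval s = w + p.eval s := by rw [hw]; ring
  have e1 : q.eval s ^ b * (s ^ α * t ^ β) = s ^ α * q.eval s ^ (b - β) * (w + p.eval s) ^ β := by
    rw [← htq, mul_pow, ← Nat.sub_add_cancel hβ, pow_add, Nat.add_sub_cancel]; ring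
  have e2 : (w + p.eval s) ^ β =
      ∑ j ∈ Finset.range (b + 1), w ^ j * p.eval s ^ (β - j) * β.choose j := by
    rw [add_pow]
    apply Finset.sum_subset
    · intro j; simp only [Finset.mem_range]; omega
    · intro j _ hj
      rw [Nat.choose_eq_zero_of_lt (by simpa using hj)]; simp
  rw [e1, e2, Finset.mul_sum, Finset.sum_comm]
  apply Finset.sum_congr rfl
  intro j hj
  have e3 : s ^ α * q.eval s ^ (b - β) * (w ^ j * p.eval s ^ (β - j) * β.choose j)
      = w ^ j * (dmR p q α β b j).eval s := by
    simp [dmR]; ring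
  have e4 : (dmR p q α β b j).eval s = (taylor s0 (dmR p q α β b j)).eval (s - s0) := by
    rw [taylor_eval]; simp
  rw [e3, e4, eval_eq_sum_range' (n := n) (by
    rw [natDegree_taylor]; exact hn j (by simpa [Nat.lt_succ_iff] using hj)), Finset.mul_sum]
  apply Finset.sum_congr rfl
  intro i _
  ring

open Polynomial in
lemma dm_core (p q : ℝ[X]) (D : ℕ) : ∃ x1 : ℝ, ∀ x : ℝ, x1 ≤ x → ∀ a b : ℕ, a ≤ D → b ≤ D →
    ∀ m k l : ℝ, 0 ≤ m →
    (∀ n n' : ℕ, ∑ i ∈ Finset.range n, ∑ j ∈ Finset.range n', max (k - i * m - j) 0 + 1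
        ≤ ((a : ℝ) + 1) * (b + 1) * (k - l - 1)) →
    ∀ s0 : ℝ, |s0| ≤ 2 → ∃ c : Fin (a + 1) × Fin (b + 1) → ℤ, c ≠ 0 ∧
      (∀ i, ((|c i| : ℤ) : ℝ) ≤ x ^ (k - l - 1)) ∧
      ∀ s t : ℝ, |s - s0| ≤ x ^ (-m) → 1 / 2 ≤ |q.eval s| → |t * q.eval s - p.eval s| ≤ 100 / x →
        |∑ i, (c i : ℝ) * (s ^ (i.1 : ℕ) * t ^ (i.2 : ℕ))| < x ^ (-l) := by
  classical
  obtain ⟨B, hB⟩ := dm_polybd_fin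
    (Finset.range (D + 1) ×ˢ Finset.range (D + 1) ×ˢ Finset.range (D + 1) ×ˢ Finset.range (D + 1))
    (fun z => dmR p q z.1 z.2.1 z.2.2.1 z.2.2.2)
  have hB' : ∀ α ≤ D, ∀ β ≤ D, ∀ b ≤ D, ∀ j ≤ D, (dmR p q α β b j).natDegree < B ∧
    ∀ i, ∀ y : ℝ, |y| ≤ 2 → |(taylor y (dmR p q α β b j)).coeff i| ≤ B := by
    intro α h1 β h2 b h3 j h4
    exact hB (α, β, b, j) (by simp; omega)
  clear hB
  obtain ⟨P, hP⟩ : ∃ P : ℝ, P = 2 * (((D : ℝ) + 1) * (D + 1) * B) + 2 := ⟨_, rfl⟩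
  have hP1 : 1 ≤ P := by rw [hP]; have : (0:ℝ) ≤ 2 * (((D : ℝ) + 1) * (D + 1) * B) := by positivity
                         linarith
  refine ⟨P ^ (B * (D + 1)) + 200 ^ D * (B * (D + 1)) + 1, ?_⟩
  intro x hx a b ha hb m k l hm hcond s0 hs0
  have hPp : 1 ≤ P ^ (B * (D + 1)) := one_le_pow₀ hP1
  have hBD : (0:ℝ) ≤ 200 ^ D * (B * (D + 1)) := by positivity
  have hx1 : 1 < x := by linarith
  have hx0 : 0 < x := by linarith
  obtain ⟨h, hh⟩ : ∃ h, h = k - l - 1 := ⟨_, rfl⟩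
  rw [← hh] at hcond ⊢
  have hN : Fintype.card (Fin (a + 1) × Fin (b + 1)) = (a + 1) * (b + 1) := by simp
  have hND : (((a + 1) * (b + 1) : ℕ) : ℝ) ≤ ((D : ℝ) + 1) * (D + 1) := by
    have : (a : ℝ) ≤ D := by exact_mod_cast ha
    have : (b : ℝ) ≤ D := by exact_mod_cast hb
    push_cast; gcongr
  let L : Fin B × Fin (b + 1) → Fin (a + 1) × Fin (b + 1) → ℝ := fun t i =>
    (taylor s0 (dmR p q i.1 i.2 b t.2)).coeff t.1
  let μ : Fin B × Fin (b + 1) → ℝ := fun t => max (k - (t.1 : ℕ) * m - (t.2 : ℕ)) 0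
  let ρ : Fin B × Fin (b + 1) → ℝ := fun t => x ^ (h - μ t)
  have hH : ((⌊x ^ h⌋₊ : ℕ) : ℝ) ≤ x ^ h := Nat.floor_le (by positivity)
  have hH' : x ^ h < ((⌊x ^ h⌋₊ : ℕ) : ℝ) + 1 := Nat.lt_floor_add_one _
  have hsum : ∑ t, μ t + 1 ≤ h * ((a + 1) * (b + 1) : ℕ) := by
    have := hcond B (b + 1)
    rw [Fintype.sum_prod_type]
    simp only [μ]
    rw [← Fin.sum_univ_eq_sum_range (fun i => ∑ j ∈ Finset.range (b + 1), max (k - i * m - j) 0)] at this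
    simp only [← Fin.sum_univ_eq_sum_range (fun j : ℕ => max (k - _ * m - (j : ℝ)) 0)] at this
    push_cast at this ⊢
    linarith
  obtain ⟨c, hc0, hcH, hcL⟩ := dm_pigeon L B (fun t i =>
      (hB' i.1 (by omega) i.2 (by omega) b hb t.2 (by omega)).2 _ _ hs0) ⌊x ^ h⌋₊ ρ
      (fun t => by positivity) (by
    rw [hN]
    calc ∏ t, (2 * ((((a + 1) * (b + 1) : ℕ) : ℝ) * B * ⌊x ^ h⌋₊ / ρ t) + 2)
        ≤ ∏ t, (P * x ^ μ t) := by
          apply Finset.prod_le_prod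
          · intro t _
            have : 0 < ρ t := by positivity
            positivity
          · intro t _
            have hμ : 1 ≤ x ^ μ t := Real.one_le_rpow hx1.le (le_max_right _ _)
            have e : (((a + 1) * (b + 1) : ℕ) : ℝ) * B * ⌊x ^ h⌋₊ / ρ t
                ≤ ((D : ℝ) + 1) * (D + 1) * B * x ^ μ t := by
              rw [div_le_iff₀ (by positivity), mul_assoc _ (x ^ μ t), ← Real.rpow_add hx0,
                add_sub_cancel]
              gcongr
            rw [hP]
            nlinarith
      _ = P ^ (B * (b + 1)) * x ^ (∑ t, μ t) := by
          rw [Finset.prod_mul_distrib, Real.rpow_sum_of_pos hx0]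
          simp
      _ ≤ P ^ (B * (D + 1)) * x ^ (∑ t, μ t) := by
          gcongr
      _ < x * x ^ (∑ t, μ t) := by
          gcongr
          linarith
      _ = x ^ (∑ t, μ t + 1) := by
          rw [Real.rpow_add hx0, Real.rpow_one, mul_comm]
      _ ≤ x ^ (h * ((a + 1) * (b + 1) : ℕ)) := Real.rpow_le_rpow_of_exponent_le hx1.le hsum
      _ = (x ^ h) ^ ((a + 1) * (b + 1)) := by rw [Real.rpow_mul_natCast hx0.le]
      _ ≤ _ := by gcongr)
  refine ⟨c, hc0, fun i => ?_, fun s t hs hq hw => ?_⟩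
  · refine le_trans ?_ hH
    exact_mod_cast hcH i
  · set Q := q.eval s with hQ
    set w := t * Q - p.eval s with hwdef
    have hexp : Q ^ b * ∑ i, (c i : ℝ) * (s ^ (i.1 : ℕ) * t ^ (i.2 : ℕ))
        = ∑ τ : Fin B × Fin (b + 1), (∑ i, L τ i * c i) * ((s - s0) ^ (τ.1 : ℕ) * w ^ (τ.2 : ℕ)) := by
      simp only [Finset.sum_mul]
      rw [Finset.sum_comm, Finset.mul_sum]
      apply Finset.sum_congr rfl
      intro i _
      have := dm_expand p q i.1 i.2 b B (by omega)
        (fun j hj => (hB' i.1 (by omega) i.2 (by omega) b hb j (by omega)).1) s s0 t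
      rw [← hQ, ← hwdef] at this
      rw [mul_left_comm, this, Fintype.sum_prod_type, Finset.mul_sum,
        ← Fin.sum_univ_eq_sum_range (fun i' => (c i : ℝ) * ∑ j ∈ Finset.range (b + 1),
          (taylor s0 (dmR p q i.1 i.2 b j)).coeff i' * ((s - s0) ^ i' * w ^ j))]
      apply Finset.sum_congr rfl
      intro i' _
      rw [Finset.mul_sum, ← Fin.sum_univ_eq_sum_range (fun j => (c i : ℝ) *
          ((taylor s0 (dmR p q i.1 i.2 b j)).coeff i' * ((s - s0) ^ (i' : ℕ) * w ^ j)))]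
      apply Finset.sum_congr rfl
      intro j _
      simp only [L]
      ring
    have hterm : ∀ τ : Fin B × Fin (b + 1),
        |(∑ i, L τ i * c i) * ((s - s0) ^ (τ.1 : ℕ) * w ^ (τ.2 : ℕ))| ≤ 100 ^ D * x ^ (h - k) := by
      intro τ
      rw [abs_mul, abs_mul, abs_pow, abs_pow]
      calc _ ≤ x ^ (h - μ τ) * ((x ^ (-m)) ^ (τ.1 : ℕ) * (100 / x) ^ (τ.2 : ℕ)) := by
            have := hcL τ
            gcongr
        _ = 100 ^ (τ.2 : ℕ) * x ^ (h - μ τ - (τ.1 : ℕ) * m - (τ.2 : ℕ)) := by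
            rw [Real.rpow_sub hx0 _ ((τ.2 : ℕ) : ℝ), Real.rpow_sub hx0 _ (((τ.1 : ℕ) : ℝ) * m), div_pow, Real.rpow_natCast,
              mul_comm ((τ.1 : ℕ) : ℝ) m, Real.rpow_mul_natCast hx0.le, Real.rpow_neg hx0.le, inv_pow]
            field_simp
        _ ≤ _ := by
            have : k - (τ.1 : ℕ) * m - (τ.2 : ℕ) ≤ μ τ := le_max_left _ _
            have h2 : (τ.2 : ℕ) ≤ D := by omega
            have h3 : x ^ (h - μ τ - (τ.1 : ℕ) * m - (τ.2 : ℕ)) ≤ x ^ (h - k) :=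
              Real.rpow_le_rpow_of_exponent_le hx1.le (by linarith)
            have h4 : (100 : ℝ) ^ (τ.2 : ℕ) ≤ 100 ^ D := pow_le_pow_right₀ (by norm_num) h2
            exact mul_le_mul h4 h3 (by positivity) (by positivity)
    have htot : |Q ^ b * ∑ i, (c i : ℝ) * (s ^ (i.1 : ℕ) * t ^ (i.2 : ℕ))|
        ≤ (B * (D + 1)) * (100 ^ D * x ^ (h - k)) := by
      rw [hexp]
      refine (Finset.abs_sum_le_sum_abs _ _).trans ((Finset.sum_le_sum fun τ _ => hterm τ).trans ?_)
      simp only [Finset.sum_const, Finset.card_univ, Fintype.card_prod, Fintype.card_fin, nsmul_eq_mul]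
      have : (b : ℝ) ≤ D := by exact_mod_cast hb
      push_cast
      gcongr
    rw [abs_mul, abs_pow] at htot
    have hQb : (1 / 2 : ℝ) ^ D ≤ |Q| ^ b :=
      (pow_le_pow_of_le_one (by norm_num) (by norm_num) hb).trans (by gcongr)
    have hfin : (1 / 2 : ℝ) ^ D * |∑ i, (c i : ℝ) * (s ^ (i.1 : ℕ) * t ^ (i.2 : ℕ))|
        < (1 / 2 : ℝ) ^ D * x ^ (-l) := by
      refine (mul_le_mul_of_nonneg_right hQb (abs_nonneg _)).trans_lt (htot.trans_lt ?_)
      have e : x ^ (h - k) = x ^ (-l) / x := by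
        rw [← Real.rpow_sub_one hx0.ne']; congr 1; rw [hh]; ring
      rw [e]
      have e2 : (B * (D + 1) : ℝ) * (100 ^ D * (x ^ (-l) / x))
          = (1 / 2 : ℝ) ^ D * ((200 ^ D * (B * (D + 1))) / x * x ^ (-l)) := by
        rw [show (200 : ℝ) = 2 * 100 by norm_num, mul_pow, div_pow]
        field_simp
        simp
      rw [e2]
      have : (200 ^ D * (B * (D + 1))) / x < 1 := by
        rw [div_lt_one hx0]; linarith
      have hxl : 0 < x ^ (-l) := by positivity
      gcongr
      nlinarith
    exact lt_of_mul_lt_mul_left hfin (by positivity)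

lemma dm_mkpoly (a b : ℕ) (c : Fin (a + 1) × Fin (b + 1) → ℤ) (hc : c ≠ 0) :
    ∃ C : MvPolynomial (Fin 2) ℤ, C ≠ 0 ∧ C.totalDegree ≤ a + b ∧
      (∀ m, C.coeff m = 0 ∨ ∃ i, C.coeff m = c i) ∧
      ∀ s t : ℝ, MvPolynomial.aeval ![s, t] C = ∑ i, (c i : ℝ) * (s ^ (i.1 : ℕ) * t ^ (i.2 : ℕ)) := by
  classical
  let v : Fin (a + 1) × Fin (b + 1) → (Fin 2 →₀ ℕ) := fun i =>
    Finsupp.single 0 (i.1 : ℕ) + Finsupp.single 1 (i.2 : ℕ)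
  have hv : Function.Injective v := by
    intro i j hij
    have h0 := DFunLike.congr_fun hij 0
    have h1 := DFunLike.congr_fun hij 1
    simp [v] at h0 h1
    ext
    · exact h0
    · exact h1
  let C : MvPolynomial (Fin 2) ℤ := ∑ i, MvPolynomial.monomial (v i) (c i)
  have hco : ∀ m, C.coeff m = ∑ i, if v i = m then c i else 0 := by
    intro m
    simp only [C, MvPolynomial.coeff_sum, MvPolynomial.coeff_monomial]
  have hcv : ∀ i, C.coeff (v i) = c i := by
    intro i
    rw [hco, Finset.sum_eq_single i]
    · simp
    · intro j _ hj; rw [if_neg (fun h => hj (hv h))]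
    · simp
  refine ⟨C, ?_, ?_, ?_, ?_⟩
  · intro h
    apply hc
    ext i
    rw [← hcv, h]; simp
  · refine MvPolynomial.totalDegree_finsetSum_le ?_
    intro i _
    refine (MvPolynomial.totalDegree_monomial_le _ _).trans ?_
    simp only [v]
    rw [Finsupp.sum_add_index' (by simp) (by simp)]
    simp
    omega
  · intro m
    by_cases h : ∃ i, v i = m
    · obtain ⟨i, rfl⟩ := h
      exact Or.inr ⟨i, hcv i⟩
    · left
      rw [hco]
      apply Finset.sum_eq_zero
      intro i _
      rw [if_neg (fun h' => h ⟨i, h'⟩)]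
  · intro s t
    simp only [C, map_sum, MvPolynomial.aeval_monomial]
    apply Finset.sum_congr rfl
    intro i _
    simp only [v]
    rw [Finsupp.prod_add_index' (by simp) (by intros; rw [pow_add])]
    simp

lemma dm_int (a b : ℕ) (c : Fin (a + 1) × Fin (b + 1) → ℤ) (X1 X2 Y Y' : ℤ) (hX : X2 ≠ 0)
    (hY : Y' ≠ 0) (V : ℝ) (hV : 0 < V) (hb : |(X2 : ℝ)| ^ a * |(Y' : ℝ)| ^ b ≤ V)
    (h : |∑ i, (c i : ℝ) * (((X1 : ℝ) / X2) ^ (i.1 : ℕ) * ((Y : ℝ) / Y') ^ (i.2 : ℕ))| < V⁻¹) :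
    ∑ i, (c i : ℝ) * (((X1 : ℝ) / X2) ^ (i.1 : ℕ) * ((Y : ℝ) / Y') ^ (i.2 : ℕ)) = 0 := by
  have hX' : (X2 : ℝ) ≠ 0 := by exact_mod_cast hX
  have hY' : (Y' : ℝ) ≠ 0 := by exact_mod_cast hY
  set S := ∑ i, (c i : ℝ) * (((X1 : ℝ) / X2) ^ (i.1 : ℕ) * ((Y : ℝ) / Y') ^ (i.2 : ℕ)) with hS
  have e : (X2 : ℝ) ^ a * (Y' : ℝ) ^ b * S = ((∑ i : Fin (a + 1) × Fin (b + 1),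
      c i * (X1 ^ (i.1 : ℕ) * X2 ^ (a - i.1) * (Y ^ (i.2 : ℕ) * Y' ^ (b - i.2))) : ℤ) : ℝ) := by
    push_cast
    rw [hS, Finset.mul_sum]
    apply Finset.sum_congr rfl
    intro i _
    have h1 : (X2 : ℝ) ^ a = X2 ^ (a - i.1) * X2 ^ (i.1 : ℕ) := by
      rw [← pow_add]; congr 1; omega
    have h2 : (Y' : ℝ) ^ b = Y' ^ (b - i.2) * Y' ^ (i.2 : ℕ) := by
      rw [← pow_add]; congr 1; omega
    rw [h1, h2, div_pow, div_pow]
    field_simp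
  have hlt : |(X2 : ℝ) ^ a * (Y' : ℝ) ^ b * S| < 1 := by
    rw [abs_mul, abs_mul, abs_pow, abs_pow]
    calc _ ≤ V * |S| := by gcongr
      _ < V * V⁻¹ := by gcongr
      _ = 1 := mul_inv_cancel₀ hV.ne'
  rw [e] at hlt
  have hz : (∑ i : Fin (a + 1) × Fin (b + 1),
      c i * (X1 ^ (i.1 : ℕ) * X2 ^ (a - i.1) * (Y ^ (i.2 : ℕ) * Y' ^ (b - i.2))) : ℤ) = 0 := by
    rw [← Int.abs_lt_one_iff]
    exact_mod_cast hlt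
  rw [hz] at e
  simpa [hX', hY'] using e

open Polynomial in
lemma dm_case (p q : ℝ[X]) (η : ℝ) (hη : 0 < η) :
    ∃ (D : ℕ) (κ x₀ : ℝ), 0 ≤ κ ∧ ∀ x E F : ℝ, x₀ ≤ x →
      x ^ ((1 : ℝ) / 2) ≤ E → x ^ ((1 : ℝ) / 2) ≤ F → E ^ 2 * F ≤ 8 * x ^ 2 →
      ∀ M : ℕ, x ^ ((1 : ℝ) / 2) ≤ (M : ℝ) → (M : ℝ) ≤ x →
      (9 / 8) * (1 + η) * (Real.log E * Real.log F) / Real.log x ≤ Real.log M →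
      ∀ s₀ : ℝ, |s₀| ≤ 2 → ∃ C : MvPolynomial (Fin 2) ℤ,
        C ≠ 0 ∧ C.totalDegree ≤ D ∧ (∀ m, ((|C.coeff m| : ℤ) : ℝ) ≤ x ^ κ) ∧
        ∀ X1 X2 Y Y' : ℤ, X2 ≠ 0 → Y' ≠ 0 → (X2 : ℝ) ^ 2 ≤ E → (Y' : ℝ) ^ 2 ≤ F →
          |(X1 : ℝ) / X2 - s₀| ≤ 1 / (M : ℝ) → 1 / 2 ≤ |q.eval ((X1 : ℝ) / X2)| →
          |(Y : ℝ) / Y' * q.eval ((X1 : ℝ) / X2) - p.eval ((X1 : ℝ) / X2)| ≤ 100 / x →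
          MvPolynomial.aeval ![(X1 : ℝ) / X2, (Y : ℝ) / Y'] C = 0 := by
  have hs : 1 < √(1 + η) := by rw [Real.lt_sqrt (by norm_num)]; linarith
  obtain ⟨A, hA, hA'⟩ : ∃ A : ℝ, 1 ≤ A ∧ 4 ≤ A * ((√(1 + η) - 1) / 2) := by
    refine ⟨max 1 (8 / (√(1 + η) - 1)), le_max_left _ _, ?_⟩
    have h1 : 0 < √(1 + η) - 1 := by linarith
    calc (4 : ℝ) = 8 / (√(1 + η) - 1) * ((√(1 + η) - 1) / 2) := by field_simp; norm_num
      _ ≤ _ := by gcongr; exact le_max_right _ _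
  obtain ⟨x1, hx1⟩ := dm_core p q ⌈2 * A⌉₊
  refine ⟨⌈2 * A⌉₊ + ⌈2 * A⌉₊, 2 * A, max x1 100, by linarith, ?_⟩
  intro x E F hx hE hF hEF M hM hMx hlog s₀ hs₀
  have hxx1 : x1 ≤ x := (le_max_left _ _).trans hx
  have hx100 : 100 ≤ x := (le_max_right _ _).trans hx
  have hx0 : 0 < x := by linarith
  have hx1' : 1 < x := by linarith
  rw [← Real.sqrt_eq_rpow] at hE hF hM
  have hsq : √x ^ 2 = x := Real.sq_sqrt hx0.le
  have hsq10 : 10 ≤ √x := Real.le_sqrt_of_sq_le (by linarith)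
  have hE0 : 0 < E := by linarith
  have hF0 : 0 < F := by linarith
  have hM0 : (0 : ℝ) < M := by linarith
  have hEx : E ≤ x := by
    by_contra hlt
    push Not at hlt
    have h1 : x ^ 2 * 10 ≤ E ^ 2 * F := by gcongr; linarith
    nlinarith
  have hFx : F ≤ x ^ 2 := by
    have h1 : √x ^ 2 * F ≤ E ^ 2 * F := by gcongr
    rw [hsq] at h1
    nlinarith
  have hlx : 0 < Real.log x := Real.log_pos hx1'
  have hee := Real.rpow_logb hx0 hx1'.ne' hE0
  have hff := Real.rpow_logb hx0 hx1'.ne' hF0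
  have hmm := Real.rpow_logb hx0 hx1'.ne' hM0
  have he2 : 1 / 2 ≤ Real.logb x E := by
    rw [Real.le_logb_iff_rpow_le hx1' hE0, ← Real.sqrt_eq_rpow]; exact hE
  have hf2 : 1 / 2 ≤ Real.logb x F := by
    rw [Real.le_logb_iff_rpow_le hx1' hF0, ← Real.sqrt_eq_rpow]; exact hF
  have hm2 : 1 / 2 ≤ Real.logb x M := by
    rw [Real.le_logb_iff_rpow_le hx1' hM0, ← Real.sqrt_eq_rpow]; exact hM
  have he1 : Real.logb x E ≤ 1 := by
    rw [Real.logb_le_iff_le_rpow hx1' hE0, Real.rpow_one]; exact hEx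
  have hm1 : Real.logb x M ≤ 1 := by
    rw [Real.logb_le_iff_le_rpow hx1' hM0, Real.rpow_one]; exact hMx
  have hf1 : Real.logb x F ≤ 2 := by
    rw [Real.logb_le_iff_le_rpow hx1' hF0]; exact_mod_cast hFx
  have hlog' : 9 / 8 * (1 + η) * (Real.logb x E * Real.logb x F) ≤ Real.logb x M := by
    simp only [Real.logb]
    rw [le_div_iff₀ hlx]
    refine le_trans (le_of_eq ?_) hlog
    field_simp
  obtain ⟨e, he⟩ : ∃ e, e = Real.logb x E := ⟨_, rfl⟩
  obtain ⟨f, hf⟩ : ∃ f, f = Real.logb x F := ⟨_, rfl⟩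
  obtain ⟨m, hm⟩ : ∃ m, m = Real.logb x M := ⟨_, rfl⟩
  rw [← he] at hee he1 he2 hlog'
  rw [← hf] at hff hf1 hf2 hlog'
  rw [← hm] at hmm hm1 hm2 hlog'
  obtain ⟨a, b, k, ha, hb, hk, hcond⟩ :=
    dm_param η A e f m hη hA hA' he2 he1 hf2 hf1 hm2 hm1 hlog'
  have ha' : a ≤ ⌈2 * A⌉₊ := by exact_mod_cast ha.trans (Nat.le_ceil _)
  have hb' : b ≤ ⌈2 * A⌉₊ := by exact_mod_cast hb.trans (Nat.le_ceil _)
  obtain ⟨c, hc0, hcb, hcz⟩ := hx1 x hxx1 a b ha' hb' m k ((a * e + b * f) / 2) (by linarith)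
    hcond s₀ hs₀
  obtain ⟨C, hC0, hCd, hCc, hCe⟩ := dm_mkpoly a b c hc0
  have hl0 : 0 ≤ (a * e + b * f) / 2 := by positivity
  refine ⟨C, hC0, hCd.trans (by omega), fun n => ?_, ?_⟩
  · rcases hCc n with h | ⟨i, h⟩
    · rw [h]; simp; positivity
    · rw [h]
      exact (hcb i).trans (Real.rpow_le_rpow_of_exponent_le hx1'.le (by linarith))
  · intro X1 X2 Y Y' hX2 hY' hXE hYF h1 h2 h3
    rw [hCe]
    have hXE' : |(X2 : ℝ)| ≤ x ^ (e / 2) := by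
      apply abs_le_of_sq_le_sq _ (by positivity)
      rw [← Real.rpow_mul_natCast hx0.le]
      push_cast
      rw [div_mul_cancel₀ _ (by norm_num), hee]; exact hXE
    have hYF' : |(Y' : ℝ)| ≤ x ^ (f / 2) := by
      apply abs_le_of_sq_le_sq _ (by positivity)
      rw [← Real.rpow_mul_natCast hx0.le]
      push_cast
      rw [div_mul_cancel₀ _ (by norm_num), hff]; exact hYF
    refine dm_int a b c X1 X2 Y Y' hX2 hY' (x ^ ((a * e + b * f) / 2)) (by positivity) ?_ ?_
    · calc _ ≤ (x ^ (e / 2)) ^ a * (x ^ (f / 2)) ^ b := by gcongr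
        _ = _ := by
          rw [← Real.rpow_mul_natCast hx0.le, ← Real.rpow_mul_natCast hx0.le, ← Real.rpow_add hx0]
          congr 1; ring
    · rw [← Real.rpow_neg hx0.le]
      apply hcz _ _ _ h2 h3
      rw [Real.rpow_neg hx0.le, hmm]
      simpa using h1

lemma dm_small (x E F Z u v : ℝ) (hx : 0 < x) (hE : 0 < E) (hF : 1000 ≤ F) (hZ : E / 4 < Z)
    (hEF : x ^ 2 / 8 ≤ E ^ 2 * F) (huv : F / 2 < u ^ 2 + v ^ 2) (h : |u| ≤ 2 * |v| + 2) :
    v ≠ 0 ∧ |1 / Z / v| ≤ 100 / x := by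
  have hv : F / 20 ≤ v ^ 2 := by
    have h1 : |u| ^ 2 ≤ (2 * |v| + 2) ^ 2 := by gcongr
    rw [sq_abs] at h1
    have h2 := sq_nonneg (|v| - 1)
    have h3 := sq_abs v
    nlinarith
  have hv0 : v ≠ 0 := by
    rintro rfl
    norm_num at hv; linarith
  refine ⟨hv0, ?_⟩
  apply abs_le_of_sq_le_sq _ (by positivity)
  have hZ0 : 0 < Z := by linarith
  rw [div_pow, div_pow, div_pow, div_div, div_le_div_iff₀ (by positivity) (by positivity)]
  have h1 : (E / 4) ^ 2 * (F / 20) ≤ Z ^ 2 * v ^ 2 := by gcongr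
  nlinarith

open MvPolynomial

set_option maxHeartbeats 1000000 in
/-- The determinant method (Lemma 1): auxiliary polynomials vanishing at all
solutions of `2x₁x₂y₁ + (x₁² − x₂²)y₂ = 1` with `x₁/x₂` in a short interval. -/
theorem determinant_method_aux_polynomial (η : ℝ) (hη : 0 < η) :
    ∃ (D : ℕ) (κ x₀ : ℝ), ∀ x E F : ℝ, x₀ ≤ x →
      x ^ ((1 : ℝ) / 2) ≤ E → x ^ ((1 : ℝ) / 2) ≤ F →
      x ^ 2 / 8 ≤ E ^ 2 * F → E ^ 2 * F ≤ 8 * x ^ 2 →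
      ∀ M : ℕ, x ^ ((1 : ℝ) / 2) ≤ (M : ℝ) → (M : ℝ) ≤ x →
      (9 / 8) * (1 + η) * (Real.log E * Real.log F) / Real.log x ≤ Real.log M →
      ∀ s₀ : ℝ, ∃ C₁ C₂ : MvPolynomial (Fin 2) ℤ,
        C₁ ≠ 0 ∧ C₂ ≠ 0 ∧
        C₁.totalDegree ≤ D ∧ C₂.totalDegree ≤ D ∧
        (∀ m, ((|C₁.coeff m| : ℤ) : ℝ) ≤ x ^ κ) ∧
        (∀ m, ((|C₂.coeff m| : ℤ) : ℝ) ≤ x ^ κ) ∧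
        ∀ x₁ x₂ y₁ y₂ : ℤ,
          2 * x₁ * x₂ * y₁ + (x₁ ^ 2 - x₂ ^ 2) * y₂ = 1 →
          E / 2 < (x₁ : ℝ) ^ 2 + (x₂ : ℝ) ^ 2 → (x₁ : ℝ) ^ 2 + (x₂ : ℝ) ^ 2 ≤ E →
          F / 2 < (y₁ : ℝ) ^ 2 + (y₂ : ℝ) ^ 2 → (y₁ : ℝ) ^ 2 + (y₂ : ℝ) ^ 2 ≤ F →
          |x₁| ≤ |x₂| →
          s₀ < (x₁ : ℝ) / (x₂ : ℝ) → (x₁ : ℝ) / (x₂ : ℝ) ≤ s₀ + 1 / (M : ℝ) →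
          (aeval ![(x₁ : ℝ) / (x₂ : ℝ), (y₁ : ℝ) / (y₂ : ℝ)]) C₁ = 0 ∨
          (aeval ![(x₁ : ℝ) / (x₂ : ℝ), (y₂ : ℝ) / (y₁ : ℝ)]) C₂ = 0 := by
  obtain ⟨D₁, κ₁, X₁, hκ₁, H₁⟩ := dm_case (1 - Polynomial.X ^ 2) (2 * Polynomial.X) η hη
  obtain ⟨D₂, κ₂, X₂, hκ₂, H₂⟩ := dm_case (2 * Polynomial.X) (1 - Polynomial.X ^ 2) η hη
  refine ⟨max D₁ D₂, max κ₁ κ₂, max (max X₁ X₂) 1000000, ?_⟩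
  intro x E F hx hE hF hEF1 hEF2 M hM hMx hlog s₀
  have hxX₁ : X₁ ≤ x := (le_max_left _ _).trans ((le_max_left _ _).trans hx)
  have hxX₂ : X₂ ≤ x := (le_max_right _ _).trans ((le_max_left _ _).trans hx)
  have hx6 : 1000000 ≤ x := (le_max_right _ _).trans hx
  have hx0 : 0 < x := by linarith
  have hs3 : 1000 ≤ x ^ ((1 : ℝ) / 2) := by
    rw [← Real.sqrt_eq_rpow]
    exact Real.le_sqrt_of_sq_le (by linarith)
  have hE3 : 1000 ≤ E := hs3.trans hE
  have hF3 : 1000 ≤ F := hs3.trans hF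
  have hM3 : 1000 ≤ (M : ℝ) := hs3.trans hM
  have hM' : 1 / (M : ℝ) ≤ 1 / 1000 := by gcongr
  have hone : ∀ m, ((|(1 : MvPolynomial (Fin 2) ℤ).coeff m| : ℤ) : ℝ) ≤ x ^ (max κ₁ κ₂) := by
    intro m
    have h1 : 1 ≤ x ^ (max κ₁ κ₂) :=
      Real.one_le_rpow (by linarith) (hκ₁.trans (le_max_left _ _))
    rw [coeff_one]
    split_ifs
    · simpa using h1
    · simp only [abs_zero, Int.cast_zero]; linarith
  have hone' : (1 : MvPolynomial (Fin 2) ℤ).totalDegree ≤ max D₁ D₂ := by simp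
  -- common facts about a quadruple
  have hfacts : ∀ x₁ x₂ y₁ y₂ : ℤ,
      2 * x₁ * x₂ * y₁ + (x₁ ^ 2 - x₂ ^ 2) * y₂ = 1 →
      E / 2 < (x₁ : ℝ) ^ 2 + (x₂ : ℝ) ^ 2 → |x₁| ≤ |x₂| →
      x₂ ≠ 0 ∧ E / 4 < (x₂ : ℝ) ^ 2 ∧ |(x₁ : ℝ) / x₂| ≤ 1 ∧
      2 * ((x₁ : ℝ) / x₂) * y₁ - (1 - ((x₁ : ℝ) / x₂) ^ 2) * y₂ = 1 / (x₂ : ℝ) ^ 2 ∧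
      1 / (x₂ : ℝ) ^ 2 ≤ 1 ∧ 0 ≤ 1 / (x₂ : ℝ) ^ 2 := by
    intro x₁ x₂ y₁ y₂ heq h1 h2
    have h2' : |(x₁ : ℝ)| ≤ |(x₂ : ℝ)| := by exact_mod_cast h2
    have h3 : (x₁ : ℝ) ^ 2 ≤ (x₂ : ℝ) ^ 2 := sq_le_sq.2 h2'
    have h4 : E / 4 < (x₂ : ℝ) ^ 2 := by linarith
    have h5 : (x₂ : ℝ) ≠ 0 := by
      intro h; rw [h] at h4; norm_num at h4; linarith
    have heq' : 2 * (x₁ : ℝ) * x₂ * y₁ + ((x₁ : ℝ) ^ 2 - (x₂ : ℝ) ^ 2) * y₂ = 1 := by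
      exact_mod_cast heq
    refine ⟨by exact_mod_cast h5, h4, ?_, ?_, ?_, by positivity⟩
    · rw [abs_div]
      exact div_le_one_of_le₀ h2' (abs_nonneg _)
    · field_simp
      linarith
    · rw [div_le_one (by positivity)]; linarith
  by_cases hs2 : |s₀| ≤ 2
  · by_cases hs13 : |s₀| ≤ 1 / 3
    · obtain ⟨C, hC0, hCd, hCc, hCz⟩ := H₂ x E F hxX₂ hE hF hEF2 M hM hMx hlog s₀ hs2
      refine ⟨1, C, one_ne_zero, hC0, hone', hCd.trans (le_max_right _ _), hone, fun m =>
        (hCc m).trans (Real.rpow_le_rpow_of_exponent_le (by linarith) (le_max_right _ _)), ?_⟩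
      intro x₁ x₂ y₁ y₂ heq h1 h2 h3 h4 h5 h6 h7
      right
      obtain ⟨hx2, hZ, hs1, hrel, hδ1, hδ0⟩ := hfacts x₁ x₂ y₁ y₂ heq h1 h5
      set s := (x₁ : ℝ) / x₂ with hs
      have habs : |s - s₀| ≤ 1 / (M : ℝ) := by rw [abs_le]; constructor <;> linarith
      have hsb : |s| ≤ 1 / 2 := by
        have := abs_le.1 hs13
        rw [abs_le]; constructor <;> linarith
      have hssq : s ^ 2 ≤ 1 / 4 := by
        rw [← sq_abs]; nlinarith [abs_nonneg s]
      have hu : |(y₂ : ℝ)| ≤ 2 * |(y₁ : ℝ)| + 2 := by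
        have e1 : (1 - s ^ 2) * |(y₂ : ℝ)| = |2 * s * y₁ - 1 / (x₂ : ℝ) ^ 2| := by
          rw [← abs_of_nonneg (show 0 ≤ 1 - s ^ 2 by linarith), ← abs_mul]
          congr 1; linarith
        have e2 : |2 * s * y₁ - 1 / (x₂ : ℝ) ^ 2| ≤ |2 * s * y₁| + |1 / (x₂ : ℝ) ^ 2| := abs_sub _ _
        rw [abs_of_nonneg hδ0, abs_mul, abs_mul, abs_two] at e2
        have e3 : 2 * |s| * |(y₁ : ℝ)| ≤ 1 * |(y₁ : ℝ)| := by gcongr; linarith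
        have e4 : 3 / 4 * |(y₂ : ℝ)| ≤ (1 - s ^ 2) * |(y₂ : ℝ)| := by gcongr; linarith
        have := abs_nonneg (y₁ : ℝ)
        linarith
      obtain ⟨hv0, hw⟩ := dm_small x E F ((x₂ : ℝ) ^ 2) y₂ y₁ hx0 (by linarith) hF3 hZ hEF1
        (by linarith) hu
      have hv0' : y₁ ≠ 0 := by exact_mod_cast hv0
      refine hCz x₁ x₂ y₂ y₁ hx2 hv0' (by linarith [sq_nonneg (x₁ : ℝ)])
        (by linarith [sq_nonneg (y₁ : ℝ), sq_nonneg (y₂ : ℝ)]) habs ?_ ?_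
      · simp only [Polynomial.eval_sub, Polynomial.eval_one, Polynomial.eval_pow, Polynomial.eval_X]
        rw [← hs]
        exact le_trans (by linarith) (le_abs_self _)
      · simp only [Polynomial.eval_sub, Polynomial.eval_one, Polynomial.eval_pow, Polynomial.eval_X,
          Polynomial.eval_mul, Polynomial.eval_ofNat]
        rw [← hs]
        rw [← abs_neg] at hw
        convert hw using 2
        rw [← hrel]
        field_simp
        ring
    · obtain ⟨C, hC0, hCd, hCc, hCz⟩ := H₁ x E F hxX₁ hE hF hEF2 M hM hMx hlog s₀ hs2
      refine ⟨C, 1, hC0, one_ne_zero, hCd.trans (le_max_left _ _), hone', fun m =>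
        (hCc m).trans (Real.rpow_le_rpow_of_exponent_le (by linarith) (le_max_left _ _)), hone, ?_⟩
      intro x₁ x₂ y₁ y₂ heq h1 h2 h3 h4 h5 h6 h7
      left
      obtain ⟨hx2, hZ, hs1, hrel, hδ1, hδ0⟩ := hfacts x₁ x₂ y₁ y₂ heq h1 h5
      set s := (x₁ : ℝ) / x₂ with hs
      have habs : |s - s₀| ≤ 1 / (M : ℝ) := by rw [abs_le]; constructor <;> linarith
      have hsb : 1 / 4 ≤ |s| := by
        have e1 : |s₀| ≤ |s| + |s - s₀| := by
          have := abs_sub s (s - s₀)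
          rwa [sub_sub_cancel] at this
        linarith
      have hssq : s ^ 2 ≤ 1 := by
        rw [← sq_abs]; nlinarith [abs_nonneg s]
      have hu : |(y₁ : ℝ)| ≤ 2 * |(y₂ : ℝ)| + 2 := by
        have e1 : 2 * |s| * |(y₁ : ℝ)| = |(1 - s ^ 2) * y₂ + 1 / (x₂ : ℝ) ^ 2| := by
          rw [← abs_two, ← abs_mul, ← abs_mul]
          congr 1; linarith
        have e2 := abs_add_le ((1 - s ^ 2) * y₂) (1 / (x₂ : ℝ) ^ 2)
        rw [abs_of_nonneg hδ0, abs_mul, abs_of_nonneg (show 0 ≤ 1 - s ^ 2 by linarith)] at e2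
        have e3 : (1 - s ^ 2) * |(y₂ : ℝ)| ≤ 1 * |(y₂ : ℝ)| := by
          gcongr; linarith [sq_nonneg s]
        have e4 : 2 * (1 / 4) * |(y₁ : ℝ)| ≤ 2 * |s| * |(y₁ : ℝ)| := by gcongr
        linarith
      obtain ⟨hv0, hw⟩ := dm_small x E F ((x₂ : ℝ) ^ 2) y₁ y₂ hx0 (by linarith) hF3 hZ hEF1 h3 hu
      have hv0' : y₂ ≠ 0 := by exact_mod_cast hv0
      refine hCz x₁ x₂ y₁ y₂ hx2 hv0' (by linarith [sq_nonneg (x₁ : ℝ)])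
        (by linarith [sq_nonneg (y₁ : ℝ), sq_nonneg (y₂ : ℝ)]) habs ?_ ?_
      · simp only [Polynomial.eval_mul, Polynomial.eval_ofNat, Polynomial.eval_X]
        rw [← hs, abs_mul, abs_two]
        linarith
      · simp only [Polynomial.eval_sub, Polynomial.eval_one, Polynomial.eval_pow, Polynomial.eval_X,
          Polynomial.eval_mul, Polynomial.eval_ofNat]
        rw [← hs]
        convert hw using 2
        rw [← hrel]
        field_simp
  · refine ⟨1, 1, one_ne_zero, one_ne_zero, hone', hone', hone, hone, ?_⟩
    intro x₁ x₂ y₁ y₂ heq h1 h2 h3 h4 h5 h6 h7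
    exfalso
    obtain ⟨-, -, hs1, -⟩ := hfacts x₁ x₂ y₁ y₂ heq h1 h5
    have := abs_le.1 hs1
    apply hs2
    rw [abs_le]; constructor <;> linarith
end

section
/- Let G(x₁, x₂; y₁, y₂) ∈ ℤ[x₁, x₂, y₁, y₂] be bi-homogeneous of degree (a, b) with a, b ≥ 1 (i.e., homogeneous of degree a in (x₁, x₂) and homogeneous of degree b in (y₁, y₂)), and suppose G is absolutely irreducible (irreducible as a polynomial over an algebraic closure of ℚ). Let ‖G‖ denote the maximum of the absolute values of the coefficients of G. Then for every ε > 0 there is a constant C = C(a, b, ε) such that for every real X ≥ 1, the number of quadruples (x₁, x₂, y₁, y₂) ∈ ℤ⁴ with gcd(x₁, x₂) = 1, gcd(y₁, y₂) = 1, G(x₁, x₂; y₁, y₂) = 0, and max(|x₁|, |x₂|) ≤ X, is at most C·X^{2/b+ε}·‖G‖^ε. -/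
open MvPolynomial

/-- A polynomial in `ℤ[x₁,x₂,y₁,y₂]` (variables indexed `0,1,2,3`) is bi-homogeneous of
degree `(a, b)` if every monomial has degree `a` in `x₁,x₂` and degree `b` in `y₁,y₂`. -/
def IsBihomogeneous (G : MvPolynomial (Fin 4) ℤ) (a b : ℕ) : Prop :=
  ∀ m ∈ G.support, m 0 + m 1 = a ∧ m 2 + m 3 = b

/-- `‖G‖`: the maximum absolute value of a coefficient of `G`. -/
def polyNorm (G : MvPolynomial (Fin 4) ℤ) : ℕ :=
  G.support.sup fun m => (G.coeff m).natAbs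

namespace BH

lemma aeval_sum {R : Type*} [CommRing R] [Algebra ℤ R] (G : MvPolynomial (Fin 4) ℤ) (x1 x2 y1 y2 : R) :
    aeval ![x1, x2, y1, y2] G =
      ∑ m ∈ G.support, ((G.coeff m : ℤ) : R) * (x1 ^ m 0 * x2 ^ m 1 * y1 ^ m 2 * y2 ^ m 3) := by
  rw [aeval_def, eval₂_eq']
  refine Finset.sum_congr rfl fun m _ => ?_
  simp [Fin.prod_univ_four]

lemma scale {R : Type*} [CommRing R] [Algebra ℤ R] {G : MvPolynomial (Fin 4) ℤ} {a b : ℕ}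
    (h : IsBihomogeneous G a b) (x1 x2 y1 y2 l m : R) :
    aeval ![l * x1, l * x2, m * y1, m * y2] G = l ^ a * m ^ b * aeval ![x1, x2, y1, y2] G := by
  rw [aeval_sum, aeval_sum, Finset.mul_sum]
  refine Finset.sum_congr rfl fun k hk => ?_
  obtain ⟨h1, h2⟩ := h k hk
  rw [← h1, ← h2]
  ring

lemma card_support {G : MvPolynomial (Fin 4) ℤ} {a b : ℕ}
    (h : IsBihomogeneous G a b) : G.support.card ≤ (a + 1) * (b + 1) := by
  have : G.support.card ≤ (Finset.range (a + 1) ×ˢ Finset.range (b + 1)).card := by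
    refine Finset.card_le_card_of_injOn (fun m => (m 0, m 2)) ?_ ?_
    · intro m hm
      obtain ⟨h1, h2⟩ := h m hm
      simp
      omega
    · intro m hm n hn e
      obtain ⟨h1, h2⟩ := h m hm
      obtain ⟨h3, h4⟩ := h n hn
      simp only [Prod.mk.injEq] at e
      ext i
      fin_cases i <;> simp <;> omega
  simpa using this

lemma coeff_le {G : MvPolynomial (Fin 4) ℤ} (m) : |G.coeff m| ≤ (polyNorm G : ℤ) := by
  by_cases hm : m ∈ G.support
  · have : (G.coeff m).natAbs ≤ polyNorm G :=
      Finset.le_sup (f := fun m => (G.coeff m).natAbs) hm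
    rw [Int.abs_eq_natAbs]; exact_mod_cast this
  · rw [notMem_support_iff.mp hm]; simp

lemma bound {G : MvPolynomial (Fin 4) ℤ} {a b : ℕ}
    (h : IsBihomogeneous G a b) {x1 x2 y1 y2 N Y : ℤ} (h1 : |x1| ≤ N) (h2 : |x2| ≤ N)
    (h3 : |y1| ≤ Y) (h4 : |y2| ≤ Y) :
    |aeval ![x1, x2, y1, y2] G| ≤ (a + 1) * (b + 1) * polyNorm G * N ^ a * Y ^ b := by
  rw [aeval_sum]
  have hN : 0 ≤ N := (abs_nonneg _).trans h1
  have hY : 0 ≤ Y := (abs_nonneg _).trans h3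
  calc _ ≤ ∑ m ∈ G.support, |((G.coeff m : ℤ) : ℤ) * (x1 ^ m 0 * x2 ^ m 1 * y1 ^ m 2 * y2 ^ m 3)| :=
        Finset.abs_sum_le_sum_abs _ _
    _ ≤ ∑ m ∈ G.support, (polyNorm G * (N ^ a * Y ^ b) : ℤ) := by
        refine Finset.sum_le_sum fun m hm => ?_
        obtain ⟨e1, e2⟩ := h m hm
        rw [abs_mul]
        refine mul_le_mul (coeff_le m) ?_ (abs_nonneg _) (by positivity)
        rw [abs_mul, abs_mul, abs_mul, abs_pow, abs_pow, abs_pow, abs_pow, ← e1, ← e2, pow_add,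
          pow_add, ← mul_assoc]
        gcongr
    _ = G.support.card * (polyNorm G * (N ^ a * Y ^ b) : ℤ) := by simp
    _ ≤ ((a + 1) * (b + 1) : ℕ) * (polyNorm G * (N ^ a * Y ^ b) : ℤ) := by
        gcongr
        exact card_support h
    _ = (a + 1) * (b + 1) * polyNorm G * N ^ a * Y ^ b := by push_cast; ring

lemma irrQ {G : MvPolynomial (Fin 4) ℤ}
    (h : Irreducible (MvPolynomial.map (Int.castRingHom (AlgebraicClosure ℚ)) G)) :
    Irreducible (MvPolynomial.map (Int.castRingHom ℚ) G) := by
  have e : MvPolynomial.map (Int.castRingHom (AlgebraicClosure ℚ)) G =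
      MvPolynomial.map (algebraMap ℚ (AlgebraicClosure ℚ)) (MvPolynomial.map (Int.castRingHom ℚ) G) := by
    rw [MvPolynomial.map_map]; congr 1
  rw [e] at h
  have : IsLocalHom (MvPolynomial.map (σ := Fin 4) (algebraMap ℚ (AlgebraicClosure ℚ))) := by
    constructor
    intro p hp
    rw [isUnit_iff_eq_C_of_isReduced] at hp ⊢
    obtain ⟨r, hr, hr'⟩ := hp
    have hp' : p = C (p.coeff 0) := by
      ext m
      have := congrArg (coeff m) hr'
      rw [coeff_map, coeff_C] at this
      rw [coeff_C]
      split_ifs at this ⊢ with h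
      · rw [h]
      · simpa using this
    refine ⟨p.coeff 0, ?_, hp'⟩
    rw [isUnit_iff_ne_zero]
    intro h0
    rw [h0] at hp'
    rw [hp'] at hr'
    rw [map_C, map_zero] at hr'
    rw [← C_injective _ _ hr'] at hr
    simp at hr
  exact h.of_map

lemma aeval_map {R : Type*} [CommRing R] [Algebra ℚ R] [Algebra ℤ R] (G : MvPolynomial (Fin 4) ℤ) (v : Fin 4 → R) :
    aeval v (MvPolynomial.map (Int.castRingHom ℚ) G) = aeval v G := by
  rw [aeval_def, aeval_def, eval₂_map]
  congr 1
  exact RingHom.ext_int _ _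

lemma zero_x {R : Type*} [CommRing R] [Algebra ℤ R] {G : MvPolynomial (Fin 4) ℤ} {a b : ℕ} (ha : 1 ≤ a)
    (h : IsBihomogeneous G a b) (y1 y2 : R) : aeval ![0, 0, y1, y2] G = 0 := by
  have := scale h (0:R) 0 y1 y2 0 1
  simpa [show a ≠ 0 by omega] using this

lemma zero_y {R : Type*} [CommRing R] [Algebra ℤ R] {G : MvPolynomial (Fin 4) ℤ} {a b : ℕ} (hb : 1 ≤ b)
    (h : IsBihomogeneous G a b) (x1 x2 : R) : aeval ![x1, x2, 0, 0] G = 0 := by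
  have := scale h x1 x2 0 0 1 0
  simpa [show b ≠ 0 by omega] using this

lemma exists_m {G : MvPolynomial (Fin 4) ℤ} {a b : ℕ} (ha : 1 ≤ a)
    (h : IsBihomogeneous G a b) (hi : Irreducible (MvPolynomial.map (Int.castRingHom ℚ) G)) :
    ∃ m ∈ G.support, m 2 = 0 := by
  by_contra! hc
  have hd : (X 2 : MvPolynomial (Fin 4) ℤ) ∣ G := by
    rw [G.as_sum]
    refine Finset.dvd_sum fun m hm => ?_
    rw [X_dvd_monomial]
    right; exact hc m hm
  obtain ⟨H, rfl⟩ := hd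
  rw [map_mul, map_X] at hi
  rcases hi.isUnit_or_isUnit rfl with h1 | h1
  · rw [isUnit_iff_eq_C_of_isReduced] at h1
    obtain ⟨r, hr, e⟩ := h1
    have := congrArg (aeval ![(0:ℚ),0,0,0]) e
    simp at this
    simp [← this] at hr
  · rw [isUnit_iff_eq_C_of_isReduced] at h1
    obtain ⟨r, hr, e⟩ := h1
    have := zero_x ha h (1:ℚ) 1
    rw [← aeval_map, map_mul, e] at this
    simp at this
    simp [this] at hr

lemma dvd_aeval_sub {R : Type*} [CommRing R] [Algebra ℤ R] (r : R) (v w : Fin 4 → R) (hvw : ∀ i, r ∣ v i - w i)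
    (G : MvPolynomial (Fin 4) ℤ) : r ∣ aeval v G - aeval w G := by
  induction G using MvPolynomial.induction_on with
  | C c => simp
  | add p q hp hq =>
    rw [map_add, map_add]
    convert dvd_add hp hq using 1; ring
  | mul_X p i hp =>
    rw [map_mul, map_mul, aeval_X, aeval_X]
    convert dvd_add (hp.mul_right (v i)) ((hvw i).mul_left (aeval w p)) using 1; ring

lemma lin_not_dvd {G : MvPolynomial (Fin 4) ℤ} {a b : ℕ} (hb : 1 ≤ b)
    (h : IsBihomogeneous G a b) (hi : Irreducible (MvPolynomial.map (Int.castRingHom ℚ) G))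
    (s t : ℚ) (hst : s ≠ 0 ∨ t ≠ 0) :
    ¬ (C s * X 0 - C t * X 1 ∣ MvPolynomial.map (Int.castRingHom ℚ) G) := by
  rintro ⟨H, hH⟩
  have hst2 : s ^ 2 + t ^ 2 ≠ 0 := by
    rcases hst with h | h <;> positivity
  rcases hi.isUnit_or_isUnit hH with h1 | h1
  · rw [isUnit_iff_eq_C_of_isReduced] at h1
    obtain ⟨r, hr, e⟩ := h1
    have := congrArg (aeval ![(0:ℚ),0,0,0]) e
    simp at this
    simp [← this] at hr
  · rw [isUnit_iff_eq_C_of_isReduced] at h1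
    obtain ⟨r, hr, e⟩ := h1
    have := zero_y hb h (s:ℚ) (-t)
    rw [← aeval_map, hH, map_mul, e] at this
    simp at this
    rcases this with h | h
    · apply hst2; linarith
    · simp [h] at hr

lemma spec_ne_zero {G : MvPolynomial (Fin 4) ℤ} {a b : ℕ} (hb : 1 ≤ b)
    (h : IsBihomogeneous G a b) (hi : Irreducible (MvPolynomial.map (Int.castRingHom ℚ) G))
    (x1 x2 : ℚ) (hx : x1 ≠ 0 ∨ x2 ≠ 0) :
    (aeval ![Polynomial.C x1, Polynomial.C x2, 1, Polynomial.X] G : Polynomial ℚ) ≠ 0 := by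
  intro h0
  have key : aeval ![C x1, C x2, X 2, X 3] G = (0 : MvPolynomial (Fin 4) ℚ) := by
    have : X 2 * aeval ![C x1, C x2, X 2, X 3] G = (0 : MvPolynomial (Fin 4) ℚ) := by
      apply MvPolynomial.funext
      intro v
      rw [map_mul, map_zero, eval_X]
      by_cases hv : v 2 = 0
      · simp [hv]
      have e1 : eval v (aeval ![C x1, C x2, X 2, X 3] G) = aeval ![x1, x2, v 2, v 3] G := by
        rw [aeval_sum, aeval_sum]; simp
      have e2 := congrArg (Polynomial.eval (v 3 / v 2)) h0
      rw [Polynomial.eval_zero] at e2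
      have e3 : Polynomial.eval (v 3 / v 2) (aeval ![Polynomial.C x1, Polynomial.C x2, 1, Polynomial.X] G)
        = aeval ![x1, x2, 1, v 3 / v 2] G := by
        rw [aeval_sum, aeval_sum]; simp [Polynomial.eval_finsetSum]
      rw [e3] at e2
      have e4 := scale h x1 x2 1 (v 3 / v 2) 1 (v 2)
      rw [e2, mul_div_cancel₀ _ hv] at e4
      simp only [one_mul, mul_one] at e4
      rw [e1, e4]
      simp
    exact (mul_eq_zero.mp this).resolve_left (X_ne_zero _)
  have gen : ∀ c : ℚ, ∀ Z : MvPolynomial (Fin 4) ℚ, c ≠ 0 → 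
      (C x2 * X 0 - C x1 * X 1 ∣ C c * X 0 - C x1 * Z) →
      (C x2 * X 0 - C x1 * X 1 ∣ C c * X 1 - C x2 * Z) → False := by
    intro c Z hc d0 d1
    refine lin_not_dvd hb h hi x2 x1 hx.symm ?_
    have hd := dvd_aeval_sub (C x2 * X 0 - C x1 * X 1) ![C c * X 0, C c * X 1, 1 * X 2, 1 * X 3]
      ![Z * C x1, Z * C x2, 1 * X 2, 1 * X 3] (by
        intro i; fin_cases i
        · simpa [mul_comm] using d0
        · simpa [mul_comm] using d1
        · simp
        · simp) G
    rw [scale h, scale h, key, mul_zero, sub_zero, ← aeval_map, one_pow, mul_one] at hd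
    have e0 : (![X 0, X 1, X 2, X 3] : Fin 4 → MvPolynomial (Fin 4) ℚ) = X := by
      ext i; fin_cases i <;> rfl
    rw [e0, aeval_X_left_apply] at hd
    have hu : IsUnit ((C c : MvPolynomial (Fin 4) ℚ) ^ a) := ((isUnit_iff_ne_zero.mpr hc).map C).pow a
    exact (hu.dvd_mul_left).mp hd
  rcases hx with hx | hx
  · refine gen x1 (X 0) hx ?_ ?_
    · simp
    · rw [← neg_sub, neg_dvd]
  · refine gen x2 (X 1) hx ?_ ?_
    · simp
    · simp

lemma spec_y_ne_zero {G : MvPolynomial (Fin 4) ℤ} {a b : ℕ} (ha : 1 ≤ a)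
    (h : IsBihomogeneous G a b) (hi : Irreducible (MvPolynomial.map (Int.castRingHom ℚ) G)) :
    (aeval ![1, Polynomial.X, 0, 1] G : Polynomial ℚ) ≠ 0 := by
  obtain ⟨m, hm, hm2⟩ := exists_m ha h hi
  intro h0
  have := congrArg (fun p => Polynomial.coeff p (m 1)) h0
  simp only [aeval_sum, Polynomial.finsetSum_coeff] at this
  rw [Finset.sum_eq_single m] at this
  · rw [mem_support_iff] at hm
    simp [hm2] at this
    exact hm this
  · intro n hn hnm
    obtain ⟨h1, h2⟩ := h m hm
    obtain ⟨h3, h4⟩ := h n hn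
    by_cases hn2 : n 2 = 0
    · have : m 1 ≠ n 1 := by
        intro e
        apply hnm
        ext i
        fin_cases i <;> simp <;> omega
      rw [← Polynomial.C_eq_intCast, Polynomial.coeff_C_mul]
      simp [hn2, Polynomial.coeff_X_pow, this]
    · simp [hn2]
  · intro h; exact absurd hm h

lemma pderiv_bh {G : MvPolynomial (Fin 4) ℤ} {a b : ℕ}
    (h : IsBihomogeneous G a b) : IsBihomogeneous (pderiv 3 G) a (b - 1) := by
  intro m hm
  rw [mem_support_iff, coeff_pderiv] at hm
  have := h (m + Finsupp.single 3 1) (by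
    rw [mem_support_iff]; exact left_ne_zero_of_mul hm)
  simp at this
  omega

lemma pderiv_ne {G : MvPolynomial (Fin 4) ℤ} {a b : ℕ} (ha : 1 ≤ a) (hb : 1 ≤ b)
    (h : IsBihomogeneous G a b) (hi : Irreducible (MvPolynomial.map (Int.castRingHom ℚ) G)) :
    pderiv 3 G ≠ 0 := by
  obtain ⟨m, hm, hm2⟩ := exists_m ha h hi
  intro h0
  have := congrArg (coeff (m - Finsupp.single 3 1)) h0
  obtain ⟨h1, h2⟩ := h m hm
  rw [coeff_pderiv, tsub_add_cancel_of_le (by simp; omega)] at this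
  rw [mem_support_iff] at hm
  simp only [coeff_zero, mul_eq_zero, hm, false_or] at this
  omega

lemma pderiv_norm {G : MvPolynomial (Fin 4) ℤ} {a b : ℕ} 
    (h : IsBihomogeneous G a b) : polyNorm (pderiv 3 G) ≤ b * polyNorm G := by
  refine Finset.sup_le fun m hm => ?_
  rw [mem_support_iff, coeff_pderiv] at hm
  have := h (m + Finsupp.single 3 1) (by
    rw [mem_support_iff]; exact left_ne_zero_of_mul hm)
  simp at this
  have h2 := coeff_le (G := G) (m + Finsupp.single 3 1)
  rw [coeff_pderiv, Int.natAbs_mul, mul_comm]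
  rw [Int.abs_eq_natAbs] at h2
  refine Nat.mul_le_mul ?_ ?_
  · omega
  · exact_mod_cast h2

lemma norm_pos {G : MvPolynomial (Fin 4) ℤ} (h : G ≠ 0) : 1 ≤ polyNorm G := by
  obtain ⟨m, hm⟩ := MvPolynomial.ne_zero_iff.mp h
  have := coeff_le (G := G) m
  have := abs_pos.mpr hm
  omega

lemma natDegree_spec {G : MvPolynomial (Fin 4) ℤ} {a b : ℕ} 
    (h : IsBihomogeneous G a b) {R : Type*} [CommRing R] (x1 x2 : R) :
    (aeval ![Polynomial.C x1, Polynomial.C x2, 1, Polynomial.X] G : Polynomial R).natDegree ≤ b := by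
  rw [aeval_sum]
  refine Polynomial.natDegree_sum_le_of_forall_le _ _ fun m hm => ?_
  obtain ⟨h1, h2⟩ := h m hm
  rw [one_pow, mul_one, ← Polynomial.C_pow, ← Polynomial.C_pow, ← Polynomial.C_mul,
    ← Polynomial.C_eq_intCast, ← mul_assoc, ← Polynomial.C_mul]
  exact (Polynomial.natDegree_C_mul_X_pow_le _ _).trans (by omega)

lemma eval_spec {G : MvPolynomial (Fin 4) ℤ} {R : Type*} [CommRing R] (x1 x2 y : R) :
    Polynomial.eval y (aeval ![Polynomial.C x1, Polynomial.C x2, 1, Polynomial.X] G)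
        = aeval ![x1, x2, 1, y] G := by
  rw [aeval_sum, aeval_sum]; simp [Polynomial.eval_finsetSum]

end BH

namespace BH

noncomputable def toS : MvPolynomial (Fin 4) ℚ ≃ₐ[ℚ] Polynomial (MvPolynomial (Fin 3) ℚ) :=
  (renameEquiv ℚ (finRotate 4)).trans (finSuccEquiv ℚ 3)

lemma toS_eval (p : MvPolynomial (Fin 4) ℚ) (x1 x2 y1 y2 : ℚ) :
    Polynomial.eval₂ (eval ![x1, x2, y1]) y2 (toS p) = aeval ![x1, x2, y1, y2] p := by
  induction p using MvPolynomial.induction_on with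
  | C c => 
    rw [← algebraMap_eq, AlgEquiv.commutes, AlgHom.commutes, Polynomial.algebraMap_apply,
      Polynomial.eval₂_C]
    simp
  | add p q hp hq => rw [map_add, map_add, Polynomial.eval₂_add, hp, hq]
  | mul_X p i hp => 
    rw [map_mul, map_mul, Polynomial.eval₂_mul, hp]
    congr 1
    have hs : ∀ (i : Fin 4) (j : Fin 3), finRotate 4 i = Fin.succ j →
        toS (X i) = Polynomial.C (X j) := by
      intro i j hij
      change finSuccEquiv ℚ 3 (rename (finRotate 4) (X i)) = _
      rw [rename_X, hij]
      exact finSuccEquiv_X_succ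
    have h3 : toS (X 3) = Polynomial.X := by
      change finSuccEquiv ℚ 3 (rename (finRotate 4) (X 3)) = _
      rw [rename_X]
      exact finSuccEquiv_X_zero
    fin_cases i
    · change Polynomial.eval₂ (eval ![x1, x2, y1]) y2 (toS (X 0)) = aeval ![x1, x2, y1, y2] (X 0)
      rw [hs 0 0 rfl]; simp
    · change Polynomial.eval₂ (eval ![x1, x2, y1]) y2 (toS (X 1)) = aeval ![x1, x2, y1, y2] (X 1)
      rw [hs 1 1 rfl]; simp
    · change Polynomial.eval₂ (eval ![x1, x2, y1]) y2 (toS (X 2)) = aeval ![x1, x2, y1, y2] (X 2)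
      rw [hs 2 2 rfl]; simp
    · change Polynomial.eval₂ (eval ![x1, x2, y1]) y2 (toS (X 3)) = aeval ![x1, x2, y1, y2] (X 3)
      rw [h3]; simp

lemma toS_natDegree (p : MvPolynomial (Fin 4) ℚ) : (toS p).natDegree = degreeOf 3 p := by
  have h3 : finRotate 4 3 = 0 := rfl
  simp only [toS, AlgEquiv.trans_apply, renameEquiv_apply]
  rw [natDegree_finSuccEquiv, ← h3, degreeOf_rename_of_injective (finRotate 4).injective]

lemma toS_coeff (p : MvPolynomial (Fin 4) ℚ) (i : ℕ) :
    ((toS p).coeff i).totalDegree ≤ totalDegree p := by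
  by_cases h : (toS p).coeff i = 0
  · simp [h]
  · have := totalDegree_coeff_finSuccEquiv_add_le (rename (finRotate 4) p) i (by simpa [toS] using h)
    have h2 := totalDegree_rename_le (finRotate 4) p
    have h3 : (toS p).coeff i = (finSuccEquiv ℚ 3 (rename (finRotate 4) p)).coeff i := rfl
    rw [h3]
    omega

lemma support_map (G : MvPolynomial (Fin 4) ℤ) : (MvPolynomial.map (Int.castRingHom ℚ) G).support = G.support :=
  support_map_of_injective _ (RingHom.injective_int _)

lemma totalDegree_map {G : MvPolynomial (Fin 4) ℤ} {a b : ℕ} (h : IsBihomogeneous G a b) :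
    (MvPolynomial.map (Int.castRingHom ℚ) G).totalDegree ≤ a + b := by
  refine Finset.sup_le fun m hm => ?_
  rw [support_map] at hm
  obtain ⟨h1, h2⟩ := h m hm
  rw [Finsupp.sum_fintype _ _ (by simp), Fin.sum_univ_four]
  omega

lemma degreeOf_map_le {G : MvPolynomial (Fin 4) ℤ} {a b : ℕ} (h : IsBihomogeneous G a b) :
    degreeOf 3 (MvPolynomial.map (Int.castRingHom ℚ) G) ≤ b := by
  rw [degreeOf_eq_sup, support_map]
  refine Finset.sup_le fun m hm => ?_
  obtain ⟨h1, h2⟩ := h m hm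
  omega

lemma degreeOf_map_eq {G : MvPolynomial (Fin 4) ℤ} {a b : ℕ} (ha : 1 ≤ a)
    (h : IsBihomogeneous G a b) (hi : Irreducible (MvPolynomial.map (Int.castRingHom ℚ) G)) :
    degreeOf 3 (MvPolynomial.map (Int.castRingHom ℚ) G) = b := by
  refine le_antisymm (degreeOf_map_le h) ?_
  obtain ⟨m, hm, h2⟩ := exists_m ha h hi
  obtain ⟨_, h4⟩ := h m hm
  rw [degreeOf_eq_sup, support_map]
  have := Finset.le_sup (f := fun m : Fin 4 →₀ ℕ => m 3) hm
  refine le_trans ?_ this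
  omega

lemma sylv_deg {σ : Type*} (f g : Polynomial (MvPolynomial σ ℚ)) (m n D : ℕ)
    (hf : ∀ i, (f.coeff i).totalDegree ≤ D) (hg : ∀ i, (g.coeff i).totalDegree ≤ D) :
    (Polynomial.resultant f g m n).totalDegree ≤ (m + n) * D := by
  rw [Polynomial.resultant, Matrix.det_apply]
  refine totalDegree_finsetSum_le fun s _ => ?_
  refine (totalDegree_smul_le _ _).trans ?_
  refine (totalDegree_finsetProd _ _).trans ?_
  calc _ ≤ ∑ i : Fin (m + n), D := by
        refine Finset.sum_le_sum fun i _ => ?_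
        rw [Polynomial.sylvester, Matrix.of_apply]
        induction i using Fin.addCases with
        | left j => 
          rw [Fin.addCases_left]
          split_ifs
          · exact hg _
          · simp
        | right j => 
          rw [Fin.addCases_right]
          split_ifs
          · exact hf _
          · simp
    _ = _ := by simp

lemma resultant_ne {G A : MvPolynomial (Fin 4) ℤ} {a b d : ℕ} (ha : 1 ≤ a) (hb : 1 ≤ b)
    (h : IsBihomogeneous G a b) (hi : Irreducible (MvPolynomial.map (Int.castRingHom ℚ) G))
    (hA : IsBihomogeneous A d (b - 1)) (hA0 : A ≠ 0) :
    Polynomial.resultant (toS (MvPolynomial.map (Int.castRingHom ℚ) G))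
      (toS (MvPolynomial.map (Int.castRingHom ℚ) A)) ≠ 0 := by
  set f := toS (MvPolynomial.map (Int.castRingHom ℚ) G) with hf
  set g := toS (MvPolynomial.map (Int.castRingHom ℚ) A) with hg
  have hfd : f.natDegree = b := by rw [hf, toS_natDegree, degreeOf_map_eq ha h hi]
  have hgd : g.natDegree ≤ b - 1 := by rw [hg, toS_natDegree]; exact degreeOf_map_le hA
  have hg0 : g ≠ 0 := by
    rw [hg, Ne, EmbeddingLike.map_eq_zero_iff]
    intro h0
    exact hA0 (MvPolynomial.map_injective _ (RingHom.injective_int _) (by rw [h0, map_zero]))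
  have hfi : Irreducible f := (MulEquiv.irreducible_iff toS).mpr hi
  have hfp : f.IsPrimitive := hfi.isPrimitive (by omega)
  let K := FractionRing (MvPolynomial (Fin 3) ℚ)
  have inj : Function.Injective (algebraMap (MvPolynomial (Fin 3) ℚ) K) := IsFractionRing.injective _ _
  have hfK : Irreducible (f.map (algebraMap _ K)) :=
    (hfp.irreducible_iff_irreducible_map_fraction_map (K := K)).mp hfi
  have hd1 : (f.map (algebraMap _ K)).natDegree = f.natDegree := Polynomial.natDegree_map_eq_of_injective inj _
  have hd2 : (g.map (algebraMap _ K)).natDegree = g.natDegree := Polynomial.natDegree_map_eq_of_injective inj _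
  have hcop : IsCoprime (f.map (algebraMap _ K)) (g.map (algebraMap _ K)) := by
    refine (EuclideanDomain.dvd_or_coprime _ _ hfK).resolve_left ?_
    intro hdv
    have := Polynomial.natDegree_le_of_dvd hdv (by
      rwa [Ne, Polynomial.map_eq_zero_iff inj])
    omega
  intro h0
  have h1 : Polynomial.resultant (f.map (algebraMap _ K)) (g.map (algebraMap _ K)) = 0 := by
    rw [hd1, hd2, Polynomial.resultant_map_map, h0, map_zero]
  rw [Polynomial.resultant_eq_zero_iff] at h1
  exact h1.2 hcop

lemma inter_x {G A : MvPolynomial (Fin 4) ℤ} {a b d : ℕ} (ha : 1 ≤ a) (hb : 1 ≤ b)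
    (h : IsBihomogeneous G a b) (hi : Irreducible (MvPolynomial.map (Int.castRingHom ℚ) G))
    (hA : IsBihomogeneous A d (b - 1)) (hA0 : A ≠ 0) :
    ∃ q : Polynomial ℚ, q ≠ 0 ∧ q.natDegree ≤ (b + b) * (a + b + d) ∧ 
      ∀ s t : ℚ, aeval ![1, s, 1, t] G = 0 → aeval ![1, s, 1, t] A = 0 → q.IsRoot s := by
  have hR := resultant_ne ha hb h hi hA hA0
  have hRd := sylv_deg (toS (MvPolynomial.map (Int.castRingHom ℚ) G))
      (toS (MvPolynomial.map (Int.castRingHom ℚ) A)) 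
      (toS (MvPolynomial.map (Int.castRingHom ℚ) G)).natDegree
      (toS (MvPolynomial.map (Int.castRingHom ℚ) A)).natDegree (a + b + d)
      (fun i => (toS_coeff _ _).trans ((totalDegree_map h).trans (by omega)))
      (fun i => (toS_coeff _ _).trans ((totalDegree_map hA).trans (by omega)))
  obtain ⟨u, v, -, -, huv⟩ := Polynomial.exists_mul_add_mul_eq_C_resultant 
      (toS (MvPolynomial.map (Int.castRingHom ℚ) G))
      (toS (MvPolynomial.map (Int.castRingHom ℚ) A)) le_rfl le_rfl 
      (by left; rw [toS_natDegree, degreeOf_map_eq ha h hi]; omega)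
  have hfd : (toS (MvPolynomial.map (Int.castRingHom ℚ) G)).natDegree = b := by
    rw [toS_natDegree, degreeOf_map_eq ha h hi]
  have hgd : (toS (MvPolynomial.map (Int.castRingHom ℚ) A)).natDegree ≤ b - 1 := by
    rw [toS_natDegree]; exact degreeOf_map_le hA
  set R := Polynomial.resultant (toS (MvPolynomial.map (Int.castRingHom ℚ) G))
      (toS (MvPolynomial.map (Int.castRingHom ℚ) A)) with hRdef
  have hRX : R * X 0 ≠ 0 := mul_ne_zero hR (X_ne_zero _)
  obtain ⟨r, hr⟩ : ∃ r, eval r (R * X 0) ≠ 0 := by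
    by_contra! hc
    exact hRX (MvPolynomial.funext fun r => by rw [hc, map_zero])
  rw [map_mul, eval_X] at hr
  have hr0 := right_ne_zero_of_mul hr
  have hr1 := left_ne_zero_of_mul hr
  have hev : ∀ s : ℚ, Polynomial.eval s (aeval ![Polynomial.C (r 0), Polynomial.C (r 0) * Polynomial.X, 
      Polynomial.C (r 2)] R) = eval ![r 0, r 0 * s, r 2] R := by
    intro s
    rw [← Polynomial.coe_aeval_eq_eval, ← AlgHom.comp_apply, comp_aeval, ← coe_aeval_eq_eval]
    refine congrArg (fun w => aeval w R) ?_
    ext i; fin_cases i <;> simp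
  refine ⟨aeval ![Polynomial.C (r 0), Polynomial.C (r 0) * Polynomial.X, Polynomial.C (r 2)] R, ?_, ?_, ?_⟩
  · intro h0
    have := hev (r 1 / r 0)
    rw [h0, mul_div_cancel₀ _ hr0, Polynomial.eval_zero] at this
    apply hr1
    rw [this]
    refine congrArg (fun w => eval w R) ?_
    ext i; fin_cases i <;> simp
  · refine (aeval_natDegree_le R (hRd.trans (Nat.mul_le_mul_right _ (by omega :_ ≤ b + b))) _ (n := 1) ?_).trans (by simp)
    intro i
    fin_cases i
    · simp
    · simpa using (Polynomial.natDegree_C_mul_le (r 0) Polynomial.X).trans Polynomial.natDegree_X_le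
    · simp
  · intro s t h1 h2
    rw [Polynomial.IsRoot, hev]
    have := congrArg (Polynomial.eval₂ (eval ![r 0, r 0 * s, r 2]) (r 2 * t)) huv
    rw [Polynomial.eval₂_add, Polynomial.eval₂_mul, Polynomial.eval₂_mul, toS_eval, toS_eval,
      Polynomial.eval₂_C, aeval_map, aeval_map] at this
    have e1 := scale h 1 s 1 t (r 0) (r 2)
    have e2 := scale hA 1 s 1 t (r 0) (r 2)
    simp only [mul_one] at e1 e2
    rw [e1, e2, h1, h2] at this
    simp only [mul_zero, zero_mul, add_zero] at this
    exact this.symm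

lemma card_eta {G : MvPolynomial (Fin 4) ℤ} {a b : ℕ} (hb : 1 ≤ b)
    (h : IsBihomogeneous G a b) (hi : Irreducible (MvPolynomial.map (Int.castRingHom ℚ) G))
    (x1 x2 : ℚ) (hx : x1 ≠ 0 ∨ x2 ≠ 0) (T : Finset ℚ) (hT : ∀ t ∈ T, aeval ![x1, x2, 1, t] G = 0) :
    T.card ≤ b := by
  have h0 := spec_ne_zero hb h hi x1 x2 hx
  refine (Polynomial.card_le_degree_of_subset_roots (Z := T) (p := aeval ![Polynomial.C x1, Polynomial.C x2, 1, Polynomial.X] G) ?_).trans (natDegree_spec h _ _)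
  intro t ht
  rw [Finset.mem_val] at ht
  rw [Polynomial.mem_roots h0, Polynomial.IsRoot, eval_spec, hT t ht]

lemma inter {G A : MvPolynomial (Fin 4) ℤ} {a b d : ℕ} (ha : 1 ≤ a) (hb : 1 ≤ b)
    (h : IsBihomogeneous G a b) (hi : Irreducible (MvPolynomial.map (Int.castRingHom ℚ) G))
    (hA : IsBihomogeneous A d (b - 1)) (hA0 : A ≠ 0) (T : Finset (ℚ × ℚ))
    (hT : ∀ z ∈ T, aeval ![1, z.1, 1, z.2] G = 0 ∧ aeval ![1, z.1, 1, z.2] A = 0) :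
    T.card ≤ b * ((b + b) * (a + b + d)) := by
  classical
  obtain ⟨q, hq0, hqd, hq⟩ := inter_x ha hb h hi hA hA0
  refine (Finset.card_le_mul_card_image (f := Prod.fst) T b ?_).trans ?_
  · intro s _
    have : (T.filter fun z => z.1 = s).card = ((T.filter fun z => z.1 = s).image Prod.snd).card := by
      rw [Finset.card_image_of_injOn]
      intro z hz w hw e
      simp at hz hw
      exact Prod.ext (hz.2.trans hw.2.symm) e
    rw [this]
    refine card_eta hb h hi 1 s (Or.inl one_ne_zero) _ ?_
    intro t ht
    simp at ht
    exact (hT _ ht).1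
  · refine Nat.mul_le_mul_left _ (le_trans ?_ hqd)
    refine Polynomial.card_le_degree_of_subset_roots ?_
    intro s hs
    simp at hs
    obtain ⟨t, ht⟩ := hs
    rw [Polynomial.mem_roots hq0]
    exact hq s t (hT _ ht).1 (hT _ ht).2

end BH

namespace BH

lemma derivative_spec {R : Type*} [CommRing R] [Algebra ℤ (Polynomial R)] (x : R) (G : MvPolynomial (Fin 4) ℤ) :
    Polynomial.derivative (aeval ![1, Polynomial.C x, 1, Polynomial.X] G) =
      aeval ![1, Polynomial.C x, 1, Polynomial.X] (pderiv 3 G) := by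
  induction G using MvPolynomial.induction_on with
  | C c => rw [aeval_C, pderiv_C, map_zero, eq_intCast, Polynomial.derivative_intCast]
  | add p q hp hq => rw [map_add, map_add, map_add, map_add, hp, hq]
  | mul_X p i hp =>
    rw [map_mul, Polynomial.derivative_mul, hp, (pderiv (3 : Fin 4)).leibniz]
    fin_cases i
    · simp [pderiv_X]
    · simp [pderiv_X]
      ring
    · simp [pderiv_X]
    · simp [pderiv_X]
      ring

lemma eval_spec1 {G : MvPolynomial (Fin 4) ℤ} {R : Type*} [CommRing R] [Algebra ℤ (Polynomial R)] [Algebra ℤ R] (x2 y : R) :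
    Polynomial.eval y (aeval ![1, Polynomial.C x2, 1, Polynomial.X] G)
        = aeval ![1, x2, 1, y] G := by
  rw [aeval_sum, aeval_sum]; simp [Polynomial.eval_finsetSum]

lemma aeval_pi {Ω S : Type*} [CommRing S] (X Y : Ω → S) (G : MvPolynomial (Fin 4) ℤ) (w : Ω) :
    (aeval ![1, X, 1, Y] G : Ω → S) w = aeval ![1, X w, 1, Y w] G := by
  rw [aeval_sum, aeval_sum]; simp [Finset.sum_apply]

lemma pow_K_zero (p K : ℕ) (x : ZMod (p ^ K)) (h : (p : ZMod (p ^ K)) ∣ x) (n : ℕ) (hn : K ≤ n) :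
    x ^ n = 0 := by
  have h1 : (p : ZMod (p ^ K)) ^ n = 0 := by
    rw [← Nat.cast_pow, ZMod.natCast_eq_zero_iff]
    exact pow_dvd_pow _ hn
  have := pow_dvd_pow_of_dvd h n
  rwa [h1, zero_dvd_iff] at this

lemma nil_fun {Ω : Type*} (p K : ℕ) (f : Ω → ZMod (p ^ K)) (h : ∀ w, (p : ZMod (p ^ K)) ∣ f w) :
    IsNilpotent f :=
  ⟨K, by ext w; exact pow_K_zero p K _ (h w) K le_rfl⟩

lemma range_card {Ω : Type*} (p K : ℕ) (hp : 0 < p) (t : Ω → ZMod (p ^ K))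
    (ht : ∀ w, (p : ZMod (p ^ K)) ∣ t w) :
    ∃ S : Finset (Ω → ZMod (p ^ K)), S.card ≤ p ^ (K * (K + 1) / 2) ∧
      ∀ f ∈ (Polynomial.aeval t : Polynomial ℤ →ₐ[ℤ] (Ω → ZMod (p ^ K))).range, f ∈ S := by
  classical
  refine ⟨(Fintype.piFinset fun k : Fin K => Finset.range (p ^ (K - k))).image
    (fun c => ∑ k : Fin K, (c k : Ω → ZMod (p ^ K)) * t ^ (k : ℕ)), ?_, ?_⟩
  · refine Finset.card_image_le.trans ?_
    rw [Fintype.card_piFinset]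
    simp only [Finset.card_range]
    rw [Finset.prod_pow_eq_pow_sum]
    refine Nat.pow_le_pow_right hp (le_of_eq ?_)
    rw [Fin.sum_univ_eq_sum_range (fun k => K - k)]
    have h1 : ∀ n, ∑ k ∈ Finset.range n, (n - k) * 2 = n * (n + 1) := by
      intro n
      induction n with
      | zero => simp
      | succ n ih =>
        rw [Finset.sum_range_succ']
        simp only [Nat.add_sub_add_right]
        rw [ih]
        simp
        ring
    have h2 := h1 K
    rw [← Finset.sum_mul] at h2
    omega
  · rintro f ⟨q, rfl⟩
    rw [Finset.mem_image]
    refine ⟨fun k => ((q.coeff k) % ((p ^ (K - k) : ℕ) : ℤ)).toNat, ?_, ?_⟩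
    · rw [Fintype.mem_piFinset]
      intro k
      rw [Finset.mem_range]
      have : (0 : ℤ) < (p ^ (K - k) : ℕ) := by positivity
      have h1 := Int.emod_nonneg (q.coeff k) this.ne'
      have h2 := Int.emod_lt_of_pos (q.coeff k) this
      omega
    · have hq : (Polynomial.aeval t : Polynomial ℤ →ₐ[ℤ] (Ω → ZMod (p ^ K))) q =
          ∑ k ∈ Finset.range K, ((q.coeff k : ℤ) : Ω → ZMod (p ^ K)) * t ^ k := by
        rw [Polynomial.aeval_eq_sum_range' (n := max K (q.natDegree + 1)) (by omega)]
        symm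
        rw [Finset.sum_subset (s₂ := Finset.range (max K (q.natDegree + 1)))]
        · refine Finset.sum_congr rfl fun k _ => ?_
          rw [zsmul_eq_mul]
        · intro k; simp; omega
        · intro k _ hk
          have : t ^ k = 0 := by
            ext w
            exact pow_K_zero p K _ (ht w) k (by simpa using hk)
          rw [this, mul_zero]
      change _ = (Polynomial.aeval t : Polynomial ℤ →ₐ[ℤ] (Ω → ZMod (p ^ K))) q
      rw [hq, ← Fin.sum_univ_eq_sum_range (fun k => ((q.coeff k : ℤ) : Ω → ZMod (p ^ K)) * t ^ k)]
      refine Finset.sum_congr rfl fun k _ => ?_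
      ext w
      simp only [Pi.mul_apply, Pi.pow_apply, Pi.natCast_apply, Pi.intCast_apply]
      obtain ⟨z, hz⟩ := ht w
      have hpos : (0 : ℤ) < (p ^ (K - k) : ℕ) := by positivity
      have h1 := Int.emod_nonneg (q.coeff k) hpos.ne'
      have h2 := Int.emod_add_mul_ediv (q.coeff k) ((p ^ (K - k) : ℕ) : ℤ)
      have h3 : (((q.coeff k % ((p ^ (K - k) : ℕ) : ℤ)).toNat : ℕ) : ZMod (p ^ K)) =
          ((q.coeff k % ((p ^ (K - k) : ℕ) : ℤ) : ℤ) : ZMod (p ^ K)) := by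
        rw [← Int.cast_natCast, Int.toNat_of_nonneg h1]
      have h4 : ((p ^ (K - k) : ℕ) : ZMod (p ^ K)) * (t w) ^ (k : ℕ) = 0 := by
        rw [hz, mul_pow, ← mul_assoc, Nat.cast_pow, ← pow_add, Nat.sub_add_cancel k.2.le,
          ← Nat.cast_pow, ZMod.natCast_self, zero_mul]
      rw [h3]
      conv_rhs => rw [← h2]
      push_cast at h4 ⊢
      linear_combination (-((q.coeff k / ((p : ℤ) ^ (K - (k:ℕ))) : ℤ) : ZMod (p ^ K))) * h4

lemma mem_range_Y {Ω : Type*} (p K : ℕ) (hp : 0 < p) (G : MvPolynomial (Fin 4) ℤ) (X Y : Ω → ZMod (p ^ K)) (u v : ℤ)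
    (hX : ∀ w, (p : ZMod (p ^ K)) ∣ X w - u) (hY : ∀ w, (p : ZMod (p ^ K)) ∣ Y w - v)
    (hG : ∀ w, aeval ![1, X w, 1, Y w] G = 0)
    (hD : ∀ w, IsUnit (aeval ![1, X w, 1, Y w] (pderiv 3 G))) :
    ∃ B : Subalgebra ℤ (Ω → ZMod (p ^ K)), X ∈ B ∧ Y ∈ B ∧ 
      ∃ S : Finset (Ω → ZMod (p ^ K)), S.card ≤ p ^ (K * (K + 1) / 2) ∧ ∀ f ∈ B, f ∈ S := by
  obtain ⟨S, hS, hB⟩ := range_card p K hp (fun w => X w - u) hX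
  set B := (Polynomial.aeval (fun w => X w - u) : Polynomial ℤ →ₐ[ℤ] (Ω → ZMod (p ^ K))).range with hBdef
  have hXB : X ∈ B := by
    refine ⟨Polynomial.X + Polynomial.C u, ?_⟩
    change (Polynomial.aeval (fun w => X w - u) : Polynomial ℤ →ₐ[ℤ] (Ω → ZMod (p ^ K))) _ = _
    simp
    ext w
    simp
  refine ⟨B, hXB, ?_, S, hS, hB⟩
  have hfin : Finite B := Set.Finite.subset S.finite_toSet (fun f hf => hB f hf)
  have dvdG : ∀ (H : MvPolynomial (Fin 4) ℤ) w, (p : ZMod (p ^ K)) ∣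
      aeval ![1, X w, 1, (v : ZMod (p ^ K))] H - aeval ![1, X w, 1, Y w] H := by
    intro H w
    refine dvd_aeval_sub _ _ _ ?_ H
    intro i; fin_cases i
    · simp
    · simp
    · simp
    · simpa using (dvd_sub_comm).mp (hY w)
  have hnil : IsNilpotent (aeval ![1, X, 1, (v : Ω → ZMod (p ^ K))] G) := by
    refine nil_fun p K _ fun w => ?_
    rw [aeval_pi]
    have := dvdG G w
    rw [hG, sub_zero] at this
    simpa using this
  have hunit : IsUnit (aeval ![1, X, 1, (v : Ω → ZMod (p ^ K))] (pderiv 3 G)) := by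
    have h1 : IsNilpotent (aeval ![1, X, 1, (v : Ω → ZMod (p ^ K))] (pderiv 3 G) -
        aeval ![1, X, 1, Y] (pderiv 3 G)) := by
      refine nil_fun p K _ fun w => ?_
      rw [Pi.sub_apply, aeval_pi, aeval_pi]
      simpa using dvdG (pderiv 3 G) w
    have h2 : IsUnit (aeval ![1, X, 1, Y] (pderiv 3 G) : Ω → ZMod (p ^ K)) := by
      rw [Pi.isUnit_iff]
      intro w
      rw [aeval_pi]; exact hD w
    have := h1.isUnit_add_right_of_commute h2 (Commute.all _ _)
    simpa using this
  let xB : B := ⟨X, hXB⟩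
  have hval : ∀ (H : MvPolynomial (Fin 4) ℤ) (y : B), ((aeval ![1, xB, 1, y] H : B) : Ω → ZMod (p ^ K)) = 
      aeval ![1, X, 1, (y : Ω → ZMod (p ^ K))] H := by
    intro H y
    rw [aeval_sum, aeval_sum]
    simp [xB]
  have hinj : Function.Injective B.val := Subtype.val_injective
  have hnilB : IsNilpotent (aeval ![1, xB, 1, (v : B)] G) := by
    rw [← IsNilpotent.map_iff hinj]
    change IsNilpotent ((aeval ![1, xB, 1, (v : B)] G : B) : Ω → ZMod (p ^ K))
    rw [hval]
    simpa using hnil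
  have hunitB : IsUnit (aeval ![1, xB, 1, (v : B)] (pderiv 3 G)) := by
    set w := aeval ![1, xB, 1, (v : B)] (pderiv 3 G) with hw
    have hwu : IsUnit (w : Ω → ZMod (p ^ K)) := by
      rw [hw, hval]; simpa using hunit
    have hi : Function.Injective (fun z : B => w * z) := by
      intro z z' e
      apply Subtype.ext
      have := congrArg Subtype.val e
      exact hwu.mul_left_cancel (by simpa using this)
    obtain ⟨z, hz⟩ := (Finite.injective_iff_surjective.mp hi) 1
    exact IsUnit.of_mul_eq_one z hz
  obtain ⟨r, ⟨hr1, hr2⟩, -⟩ := Polynomial.existsUnique_nilpotent_sub_and_aeval_eq_zero (R := B) (S := B)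
    (P := aeval ![1, Polynomial.C xB, 1, Polynomial.X] G) (x := (v : B))
    (by rw [Polynomial.coe_aeval_eq_eval, eval_spec1]; exact hnilB)
    (by rw [derivative_spec, Polynomial.coe_aeval_eq_eval, eval_spec1]; exact hunitB)
  have huniq := (Polynomial.existsUnique_nilpotent_sub_and_aeval_eq_zero (R := Ω → ZMod (p ^ K)) (S := Ω → ZMod (p ^ K))
    (P := aeval ![1, Polynomial.C X, 1, Polynomial.X] G) (x := (v : Ω → ZMod (p ^ K)))
    (by rw [Polynomial.coe_aeval_eq_eval, eval_spec1]; exact hnil)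
    (by rw [derivative_spec, Polynomial.coe_aeval_eq_eval, eval_spec1]; exact hunit)).unique
    (y₁ := (r : Ω → ZMod (p ^ K))) (y₂ := Y)
    (by
      constructor
      · have := hr1.map B.val
        simpa using this
      · rw [Polynomial.coe_aeval_eq_eval, eval_spec1] at hr2 ⊢
        rw [← hval, hr2]; rfl)
    (by
      constructor
      · refine nil_fun p K _ fun w => ?_
        simpa using (dvd_sub_comm).mp (hY w)
      · rw [Polynomial.coe_aeval_eq_eval, eval_spec1]
        ext w
        rw [aeval_pi, hG]; rfl)
  rw [← huniq]
  exact r.2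

lemma pigeon {Ω : Type*} (p K h d b : ℕ) (hp : 2 ≤ p) (hc : K * (K + 1) / 2 < h * ((d + 1) * b))
    (G : MvPolynomial (Fin 4) ℤ) (X Y : Ω → ZMod (p ^ K)) (u v : ℤ)
    (hX : ∀ w, (p : ZMod (p ^ K)) ∣ X w - u) (hY : ∀ w, (p : ZMod (p ^ K)) ∣ Y w - v)
    (hG : ∀ w, aeval ![1, X w, 1, Y w] G = 0)
    (hD : ∀ w, IsUnit (aeval ![1, X w, 1, Y w] (pderiv 3 G))) :
    ∃ c : Fin (d + 1) × Fin b → ℤ, c ≠ 0 ∧ (∀ k, |c k| ≤ (p ^ h : ℕ)) ∧ 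
      ∀ w, ∑ k, (c k : ZMod (p ^ K)) * (X w ^ (k.1 : ℕ) * Y w ^ (k.2 : ℕ)) = 0 := by
  obtain ⟨B, hXB, hYB, S, hS, hB⟩ := mem_range_Y p K (by omega) G X Y u v hX hY hG hD
  let F : (Fin (d + 1) × Fin b → Fin (p ^ h)) → (Ω → ZMod (p ^ K)) :=
    fun c => ∑ k, ((c k : ℕ) : Ω → ZMod (p ^ K)) * (X ^ (k.1 : ℕ) * Y ^ (k.2 : ℕ))
  obtain ⟨c, -, c', -, hne, he⟩ := Finset.exists_ne_map_eq_of_card_lt_of_maps_to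
    (s := Finset.univ) (t := S) (f := F) (by
      refine hS.trans_lt ?_
      rw [Finset.card_univ, Fintype.card_fun]
      simp only [Fintype.card_fin, Fintype.card_prod]
      rw [← pow_mul]
      exact Nat.pow_lt_pow_right (by omega) hc)
    (by
      intro c _
      refine hB _ ?_
      refine B.sum_mem fun k _ => B.mul_mem (B.natCast_mem _) (B.mul_mem (B.pow_mem hXB _) (B.pow_mem hYB _)))
  refine ⟨fun k => ((c k : ℕ) : ℤ) - ((c' k : ℕ) : ℤ), ?_, ?_, ?_⟩
  · intro h0
    apply hne
    ext k
    have := congrFun h0 k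
    simp at this
    omega
  · intro k
    have h1 := (c k).2
    have h2 := (c' k).2
    change |((c k : ℕ) : ℤ) - ((c' k : ℕ) : ℤ)| ≤ _
    rw [abs_le]
    constructor <;> omega
  · intro w
    have := congrFun he w
    simp only [F, Finset.sum_apply] at this
    simp only [Pi.mul_apply, Pi.natCast_apply, Pi.pow_apply] at this
    push_cast
    simp only [sub_mul, Finset.sum_sub_distrib]
    rw [this, sub_self]

end BH

namespace BH

lemma cast_aeval {R : Type*} [CommRing R] [Algebra ℤ R] (G : MvPolynomial (Fin 4) ℤ) (x1 x2 y1 y2 : ℤ) :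
    aeval ![(x1 : R), (x2 : R), (y1 : R), (y2 : R)] G = ((aeval ![x1, x2, y1, y2] G : ℤ) : R) := by
  rw [aeval_sum, aeval_sum]
  push_cast
  rfl

/-- integer value at a rational point -/
noncomputable def ival (G : MvPolynomial (Fin 4) ℤ) (z : ℚ × ℚ) : ℤ :=
  aeval ![(z.1.den : ℤ), z.1.num, (z.2.den : ℤ), z.2.num] G

lemma ival_ring {R : Type*} [CommRing R] [Algebra ℤ R] {G : MvPolynomial (Fin 4) ℤ} {a b : ℕ}
    (h : IsBihomogeneous G a b) (z : ℚ × ℚ) (x y : R)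
    (hx : (z.1.den : R) * x = z.1.num) (hy : (z.2.den : R) * y = z.2.num) :
    ((ival G z : ℤ) : R) = (z.1.den : R) ^ a * (z.2.den : R) ^ b * aeval ![1, x, 1, y] G := by
  rw [← scale h, mul_one, mul_one, hx, hy, ival, ← cast_aeval]
  simp

lemma ival_rat {G : MvPolynomial (Fin 4) ℤ} {a b : ℕ}
    (h : IsBihomogeneous G a b) (z : ℚ × ℚ) :
    ((ival G z : ℤ) : ℚ) = (z.1.den : ℚ) ^ a * (z.2.den : ℚ) ^ b * aeval ![1, z.1, 1, z.2] G :=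
  ival_ring h z z.1 z.2 (by rw [mul_comm, Rat.mul_den_eq_num]) (by rw [mul_comm, Rat.mul_den_eq_num])

lemma ival_zero {G : MvPolynomial (Fin 4) ℤ} {a b : ℕ}
    (h : IsBihomogeneous G a b) (z : ℚ × ℚ) : ival G z = 0 ↔ (aeval ![1, z.1, 1, z.2] G : ℚ) = 0 := by
  have := ival_rat h z
  have h1 : (z.1.den : ℚ) ≠ 0 := by exact_mod_cast z.1.den_nz
  have h2 : (z.2.den : ℚ) ≠ 0 := by exact_mod_cast z.2.den_nz
  rw [← Int.cast_eq_zero (α := ℚ), this]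
  simp [h1, h2]

/-- exponent vector -/
noncomputable def ex (d e : ℕ) (k : ℕ × ℕ) : Fin 4 →₀ ℕ :=
  Finsupp.equivFunOnFinite.symm ![d - k.1, k.1, e - k.2, k.2]

lemma mkA (d b : ℕ) (c : Fin (d + 1) × Fin b → ℤ) (hc : c ≠ 0) (H : ℕ)
    (hH : ∀ k, |c k| ≤ H) :
    ∃ A : MvPolynomial (Fin 4) ℤ, IsBihomogeneous A d (b - 1) ∧ A ≠ 0 ∧ polyNorm A ≤ H ∧
      ∀ (R : Type) [CommRing R] [Algebra ℤ R] (x y : R), aeval ![1, x, 1, y] A =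
        ∑ k, (c k : R) * (x ^ (k.1 : ℕ) * y ^ (k.2 : ℕ)) := by
  classical
  let A : MvPolynomial (Fin 4) ℤ := ∑ k, monomial (ex d (b - 1) (k.1, k.2)) (c k)
  have hinj : Function.Injective (fun k : Fin (d + 1) × Fin b => ex d (b - 1) (k.1, k.2)) := by
    intro k k' e
    have h1 := DFunLike.congr_fun e 1
    have h3 := DFunLike.congr_fun e 3
    simp [ex] at h1 h3
    ext <;> omega
  have hco : ∀ k, coeff (ex d (b - 1) (k.1, k.2)) A = c k := by
    intro k
    simp only [A, coeff_sum, coeff_monomial]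
    rw [Finset.sum_eq_single k]
    · simp
    · intro k' _ hk'
      rw [if_neg]
      intro e
      exact hk' (hinj e)
    · simp
  have hsupp : ∀ m ∈ A.support, ∃ k : Fin (d + 1) × Fin b, m = ex d (b - 1) (k.1, k.2) := by
    intro m hm
    by_contra! hcon
    rw [mem_support_iff] at hm
    apply hm
    simp only [A, coeff_sum, coeff_monomial]
    refine Finset.sum_eq_zero fun k _ => ?_
    rw [if_neg (hcon k).symm]
  refine ⟨A, ?_, ?_, ?_, ?_⟩
  · intro m hm
    obtain ⟨k, rfl⟩ := hsupp m hm
    have := k.1.2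
    have := k.2.2
    simp [ex]
    omega
  · intro h0
    apply hc
    ext k
    rw [← hco k, h0]; simp
  · refine Finset.sup_le fun m hm => ?_
    obtain ⟨k, rfl⟩ := hsupp m hm
    rw [hco]
    have := hH k
    rw [Int.abs_eq_natAbs] at this
    exact_mod_cast this
  · intro R _ _ x y
    simp only [A, map_sum, aeval_monomial]
    refine Finset.sum_congr rfl fun k _ => ?_
    rw [eq_intCast, Finsupp.prod_fintype _ _ (by simp), Fin.prod_univ_four]
    simp [ex]

lemma zmod_inv (p K : ℕ) (hp : p.Prime) (n : ℕ) (h : ¬ p ∣ n) :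
    (n : ZMod (p ^ K)) * (n : ZMod (p ^ K))⁻¹ = 1 := by
  apply ZMod.coe_mul_inv_eq_one
  exact Nat.Coprime.pow_right _ ((hp.coprime_iff_not_dvd.mpr h).symm)

/-- good points -/
def Good (G : MvPolynomial (Fin 4) ℤ) (p : ℕ) (z : ℚ × ℚ) : Prop :=
  ¬ p ∣ z.1.den ∧ ¬ p ∣ z.2.den ∧ ¬ (p : ℤ) ∣ ival (pderiv 3 G) z

lemma class_card {G : MvPolynomial (Fin 4) ℤ} {a b : ℕ} (ha : 1 ≤ a) (hb : 1 ≤ b)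
    (h : IsBihomogeneous G a b) (hi : Irreducible (MvPolynomial.map (Int.castRingHom ℚ) G))
    (p K e d N Y : ℕ) (hp : p.Prime) (hc : K * (K + 1) / 2 < e * ((d + 1) * b))
    (hbig : (d + 1) * b * p ^ e * N ^ d * Y ^ (b - 1) < p ^ K) (u v : ℤ)
    (T : Finset (ℚ × ℚ)) (hT : ∀ z ∈ T, (aeval ![1, z.1, 1, z.2] G : ℚ) = 0 ∧
      z.1.den ≤ N ∧ |z.1.num| ≤ N ∧ z.2.den ≤ Y ∧ |z.2.num| ≤ Y ∧ Good G p z ∧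
      (p : ℤ) ∣ z.1.num - u * z.1.den ∧ (p : ℤ) ∣ z.2.num - v * z.2.den) :
    T.card ≤ b * ((b + b) * (a + b + d)) := by
  have hxu : ∀ w : T, (w.1.1.den : ZMod (p ^ K)) * ((w.1.1.den : ZMod (p ^ K))⁻¹ * w.1.1.num) = w.1.1.num := by
    intro w
    rw [← mul_assoc, zmod_inv p K hp _ (hT w.1 w.2).2.2.2.2.2.1.1, one_mul]
  have hyu : ∀ w : T, (w.1.2.den : ZMod (p ^ K)) * ((w.1.2.den : ZMod (p ^ K))⁻¹ * w.1.2.num) = w.1.2.num := by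
    intro w
    rw [← mul_assoc, zmod_inv p K hp _ (hT w.1 w.2).2.2.2.2.2.1.2.1, one_mul]
  have u1 : ∀ w : T, IsUnit (w.1.1.den : ZMod (p ^ K)) := fun w =>
    IsUnit.of_mul_eq_one _ (zmod_inv p K hp _ (hT w.1 w.2).2.2.2.2.2.1.1)
  have u2 : ∀ w : T, IsUnit (w.1.2.den : ZMod (p ^ K)) := fun w =>
    IsUnit.of_mul_eq_one _ (zmod_inv p K hp _ (hT w.1 w.2).2.2.2.2.2.1.2.1)
  obtain ⟨c, hc0, hcb, hcz⟩ := pigeon (Ω := T) p K e d b hp.two_le hc G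
    (fun w => (w.1.1.den : ZMod (p ^ K))⁻¹ * w.1.1.num)
    (fun w => (w.1.2.den : ZMod (p ^ K))⁻¹ * w.1.2.num) u v
    (by
      intro w
      obtain ⟨t, ht⟩ := (hT w.1 w.2).2.2.2.2.2.2.1
      refine ⟨(w.1.1.den : ZMod (p ^ K))⁻¹ * t, (u1 w).mul_left_cancel ?_⟩
      have := congrArg (Int.cast : ℤ → ZMod (p ^ K)) ht
      push_cast at this
      have h2 := zmod_inv p K hp _ (hT w.1 w.2).2.2.2.2.2.1.1
      rw [mul_sub, hxu]
      linear_combination this - (p : ZMod (p ^ K)) * t * h2)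
    (by
      intro w
      obtain ⟨t, ht⟩ := (hT w.1 w.2).2.2.2.2.2.2.2
      refine ⟨(w.1.2.den : ZMod (p ^ K))⁻¹ * t, (u2 w).mul_left_cancel ?_⟩
      have := congrArg (Int.cast : ℤ → ZMod (p ^ K)) ht
      push_cast at this
      have h2 := zmod_inv p K hp _ (hT w.1 w.2).2.2.2.2.2.1.2.1
      rw [mul_sub, hyu]
      linear_combination this - (p : ZMod (p ^ K)) * t * h2)
    (by
      intro w
      have h1 := ival_ring h w.1 _ _ (hxu w) (hyu w)
      rw [(ival_zero h w.1).mpr (hT w.1 w.2).1, Int.cast_zero] at h1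
      refine (((u1 w).pow a).mul ((u2 w).pow b)).mul_left_cancel ?_
      rw [← h1, mul_zero])
    (by
      intro w
      have h1 := ival_ring (pderiv_bh h) w.1 _ _ (hxu w) (hyu w)
      refine isUnit_of_mul_isUnit_right (x := (w.1.1.den : ZMod (p ^ K)) ^ a * (w.1.2.den : ZMod (p ^ K)) ^ (b - 1)) ?_
      rw [← h1, ZMod.coe_int_isUnit_iff_isCoprime]
      push_cast
      refine IsCoprime.pow_left ?_
      exact (Nat.prime_iff_prime_int.mp hp).coprime_iff_not_dvd.mpr (hT w.1 w.2).2.2.2.2.2.1.2.2)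
  obtain ⟨A, hA, hA0, hAn, hAe⟩ := mkA d b c hc0 (p ^ e) hcb
  refine inter ha hb h hi hA hA0 T fun z hz => ⟨(hT z hz).1, ?_⟩
  rw [← ival_zero hA]
  have h1 := ival_ring hA z _ _ (hxu ⟨z, hz⟩) (hyu ⟨z, hz⟩)
  rw [hAe, hcz ⟨z, hz⟩, mul_zero, ZMod.intCast_zmod_eq_zero_iff_dvd] at h1
  apply Int.eq_zero_of_abs_lt_dvd h1
  obtain ⟨-, b1, b2, b3, b4, -⟩ := hT z hz
  have h2 : |ival A z| ≤ _ := bound hA (x1 := (z.1.den : ℤ)) (x2 := z.1.num) (y1 := (z.2.den : ℤ)) (y2 := z.2.num) (N := N) (Y := Y)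
    (by rw [abs_of_nonneg (by positivity)]; exact_mod_cast b1) b2
    (by rw [abs_of_nonneg (by positivity)]; exact_mod_cast b3) b4
  refine h2.trans_lt ?_
  have h3 : (d + 1) * (b - 1 + 1) * polyNorm A * N ^ d * Y ^ (b - 1) ≤
      (d + 1) * b * p ^ e * N ^ d * Y ^ (b - 1) := by
    rw [Nat.sub_add_cancel hb]
    gcongr
  exact_mod_cast h3.trans_lt hbig

lemma prime_count {G : MvPolynomial (Fin 4) ℤ} {a b : ℕ} (ha : 1 ≤ a) (hb : 1 ≤ b)
    (h : IsBihomogeneous G a b) (hi : Irreducible (MvPolynomial.map (Int.castRingHom ℚ) G))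
    (p K e d N Y : ℕ) (hp : p.Prime) (hc : K * (K + 1) / 2 < e * ((d + 1) * b))
    (hbig : (d + 1) * b * p ^ e * N ^ d * Y ^ (b - 1) < p ^ K)
    (T : Finset (ℚ × ℚ)) (hT : ∀ z ∈ T, (aeval ![1, z.1, 1, z.2] G : ℚ) = 0 ∧
      z.1.den ≤ N ∧ |z.1.num| ≤ N ∧ z.2.den ≤ Y ∧ |z.2.num| ≤ Y ∧ Good G p z) :
    T.card ≤ b * ((b + b) * (a + b + d)) * (p * b) := by
  classical
  have := Fact.mk hp
  have nz : ∀ n : ℕ, ¬ p ∣ n → (n : ZMod p) ≠ 0 := by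
    intro n hn
    rwa [Ne, ZMod.natCast_eq_zero_iff]
  let f : ℚ × ℚ → ZMod p × ZMod p := fun z =>
    ((z.1.den : ZMod p)⁻¹ * z.1.num, (z.2.den : ZMod p)⁻¹ * z.2.num)
  have hfx : ∀ z ∈ T, (z.1.den : ZMod p) * (f z).1 = z.1.num := by
    intro z hz
    exact mul_inv_cancel_left₀ (nz _ (hT z hz).2.2.2.2.2.1) _
  have hfy : ∀ z ∈ T, (z.2.den : ZMod p) * (f z).2 = z.2.num := by
    intro z hz
    exact mul_inv_cancel_left₀ (nz _ (hT z hz).2.2.2.2.2.2.1) _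
  have himg : (T.image f).card ≤ p * b := by
    have hsub : T.image f ⊆ Finset.univ.biUnion fun u : ZMod p =>
        ((aeval ![1, Polynomial.C u, 1, Polynomial.X] G : Polynomial (ZMod p)).roots.toFinset).image
          (fun v => (u, v)) := by
      intro q hq
      obtain ⟨z, hz, rfl⟩ := Finset.mem_image.mp hq
      rw [Finset.mem_biUnion]
      refine ⟨(f z).1, Finset.mem_univ _, ?_⟩
      rw [Finset.mem_image]
      refine ⟨(f z).2, ?_, rfl⟩
      have hD : (aeval ![1, (f z).1, 1, (f z).2] (pderiv 3 G) : ZMod p) ≠ 0 := by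
        intro h0
        have h1 := ival_ring (pderiv_bh h) z _ _ (hfx z hz) (hfy z hz)
        rw [h0, mul_zero, ZMod.intCast_zmod_eq_zero_iff_dvd] at h1
        exact (hT z hz).2.2.2.2.2.2.2 h1
      rw [Multiset.mem_toFinset, Polynomial.mem_roots]
      · rw [Polynomial.IsRoot.def, eval_spec1]
        have h1 := ival_ring h z _ _ (hfx z hz) (hfy z hz)
        rw [(ival_zero h z).mpr (hT z hz).1, Int.cast_zero] at h1
        have n1 := nz _ (hT z hz).2.2.2.2.2.1
        have n2 := nz _ (hT z hz).2.2.2.2.2.2.1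
        rcases mul_eq_zero.mp h1.symm with h2 | h2
        · exact absurd h2 (mul_ne_zero (pow_ne_zero _ n1) (pow_ne_zero _ n2))
        · exact h2
      · intro h0
        apply hD
        rw [← eval_spec1, ← derivative_spec, h0]; simp
    refine (Finset.card_le_card hsub).trans (Finset.card_biUnion_le.trans ?_)
    refine (Finset.sum_le_card_nsmul _ _ b ?_).trans (by simp [ZMod.card])
    intro u _
    refine Finset.card_image_le.trans ((Multiset.toFinset_card_le _).trans
      ((Polynomial.card_roots' _).trans ?_))
    have := natDegree_spec h (1 : ZMod p) u
    simpa using this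
  refine (Finset.card_le_mul_card_image T (f := f) (b * ((b + b) * (a + b + d))) ?_).trans
    (Nat.mul_le_mul_left _ himg)
  rintro ⟨u, v⟩ -
  refine class_card ha hb h hi p K e d N Y hp hc hbig (u.val : ℤ) (v.val : ℤ) _ fun z hz => ?_
  obtain ⟨hz, hf⟩ := Finset.mem_filter.mp hz
  obtain ⟨c1, c2, c3, c4, c5, c6⟩ := hT z hz
  refine ⟨c1, c2, c3, c4, c5, c6, ?_, ?_⟩
  · rw [← ZMod.intCast_zmod_eq_zero_iff_dvd]
    have := hfx z hz
    rw [hf] at this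
    push_cast
    rw [← this, ZMod.natCast_zmod_val]; ring
  · rw [← ZMod.intCast_zmod_eq_zero_iff_dvd]
    have := hfy z hz
    rw [hf] at this
    push_cast
    rw [← this, ZMod.natCast_zmod_val]; ring

end BH

namespace BH

lemma height (g : Polynomial ℤ) (hg : g ≠ 0) (B : ℕ) (hB : ∀ i, |g.coeff i| ≤ B) (r : ℚ)
    (hr : Polynomial.aeval r g = 0) : r.den ≤ B ∧ |r.num| ≤ ((B + 1) * B : ℕ) := by
  have hl : g.leadingCoeff ≠ 0 := Polynomial.leadingCoeff_ne_zero.mpr hg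
  have hl1 : 1 ≤ |g.leadingCoeff| := Int.one_le_abs hl
  have h1 : (r.den : ℤ) ∣ g.leadingCoeff := by
    have := den_dvd_of_is_root hr
    rw [← Rat.isFractionRingDen]
    exact Int.natAbs_dvd.mpr this
  have h2 : r.den ≤ B := by
    have := Int.le_of_dvd (by omega) ((dvd_abs _ _).mpr h1)
    have h3 : |g.leadingCoeff| ≤ _ := hB g.natDegree
    omega
  refine ⟨h2, ?_⟩
  have hq : (g.map (Int.castRingHom ℚ)) ≠ 0 := by
    rwa [Ne, Polynomial.map_eq_zero_iff (Int.cast_injective)]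
  have hroot : (g.map (Int.castRingHom ℚ)).IsRoot r := by
    rw [Polynomial.IsRoot.def, Polynomial.eval_map]
    rw [Polynomial.aeval_def] at hr
    exact hr
  have h3 := hroot.norm_lt_cauchyBound hq
  have h4 : Polynomial.cauchyBound (g.map (Int.castRingHom ℚ)) ≤ (B + 1 : NNReal) := by
    unfold Polynomial.cauchyBound
    gcongr
    refine div_le_of_le_mul₀ (by positivity) (by positivity) ?_
    refine Finset.sup_le fun i _ => ?_
    have e1 : ‖(g.map (Int.castRingHom ℚ)).coeff i‖₊ ≤ (B : NNReal) := by
      rw [← NNReal.coe_le_coe, coe_nnnorm, Polynomial.coeff_map]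
      have := hB i
      simp only [eq_intCast, NNReal.coe_natCast]
      rw [← Rat.norm_cast_real, Real.norm_eq_abs]
      push_cast
      exact_mod_cast this
    have e2 : (1 : NNReal) ≤ ‖(g.map (Int.castRingHom ℚ)).leadingCoeff‖₊ := by
      rw [← NNReal.coe_le_coe, coe_nnnorm, Polynomial.leadingCoeff_map_of_injective Int.cast_injective]
      simp only [eq_intCast, NNReal.coe_one]
      rw [← Rat.norm_cast_real, Real.norm_eq_abs]
      push_cast
      exact_mod_cast hl1
    calc _ ≤ (B : NNReal) := e1
      _ = B * 1 := (mul_one _).symm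
      _ ≤ _ := by gcongr
  have h5 : |r| ≤ ((B + 1 : ℕ) : ℚ) := by
    have := (h3.trans_le h4).le
    rw [← NNReal.coe_le_coe, coe_nnnorm, ← Rat.norm_cast_real, Real.norm_eq_abs] at this
    push_cast at this
    exact_mod_cast this
  have h6 : ((|r.num| : ℤ) : ℚ) = |r| * r.den := by
    rw [Int.cast_abs, ← Rat.mul_den_eq_num, abs_mul, abs_of_nonneg (a := (r.den : ℚ)) (by positivity)]
  have h7 : ((|r.num| : ℤ) : ℚ) ≤ (((B + 1) * B : ℕ) : ℚ) := by
    rw [h6, Nat.cast_mul]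
    gcongr
  exact_mod_cast h7

lemma eta_bound {G : MvPolynomial (Fin 4) ℤ} {a b : ℕ} (hb : 1 ≤ b)
    (h : IsBihomogeneous G a b) (hi : Irreducible (MvPolynomial.map (Int.castRingHom ℚ) G))
    (N B : ℕ) (hB : (a + 1) * (b + 1) * polyNorm G * N ^ a ≤ B) (z : ℚ × ℚ) (hz : (aeval ![1, z.1, 1, z.2] G : ℚ) = 0)
    (h1 : z.1.den ≤ N) (h2 : |z.1.num| ≤ N) : z.2.den ≤ B ∧ |z.2.num| ≤ ((B + 1) * B : ℕ) := by
  have hd : (z.1.den : ℚ) ≠ 0 := by exact_mod_cast z.1.den_nz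
  let g : Polynomial ℤ := aeval ![Polynomial.C (z.1.den : ℤ), Polynomial.C z.1.num, 1, Polynomial.X] G
  have hmap : g.map (Int.castRingHom ℚ) =
      aeval ![Polynomial.C (z.1.den : ℚ), Polynomial.C (z.1.num : ℚ), 1, Polynomial.X] G := by
    simp only [g]
    rw [aeval_sum, aeval_sum, Polynomial.map_sum]
    simp
  refine height g ?_ B ?_ z.2 ?_
  · intro h0
    rw [h0, Polynomial.map_zero] at hmap
    exact spec_ne_zero hb h hi (z.1.den : ℚ) (z.1.num : ℚ) (Or.inl hd) hmap.symm
  · intro i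
    simp only [g]
    rw [aeval_sum, Polynomial.finsetSum_coeff]
    refine (Finset.abs_sum_le_sum_abs _ _).trans ?_
    have : ∀ m ∈ G.support, |(((G.coeff m : ℤ) : Polynomial ℤ) * (Polynomial.C (z.1.den : ℤ) ^ m 0 *
        Polynomial.C z.1.num ^ m 1 * 1 ^ m 2 * Polynomial.X ^ m 3)).coeff i| ≤
        polyNorm G * (N : ℤ) ^ a := by
      intro m hm
      have e : ((G.coeff m : ℤ) : Polynomial ℤ) * (Polynomial.C (z.1.den : ℤ) ^ m 0 *
        Polynomial.C z.1.num ^ m 1 * 1 ^ m 2 * Polynomial.X ^ m 3) =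
        Polynomial.C (G.coeff m * ((z.1.den : ℤ) ^ m 0 * z.1.num ^ m 1)) * Polynomial.X ^ m 3 := by
        simp
        ring
      rw [e, Polynomial.coeff_C_mul_X_pow]
      have hN : (z.1.den : ℤ) ≤ N := by exact_mod_cast h1
      split_ifs
      · rw [abs_mul, abs_mul, abs_pow, abs_pow, ← (h m hm).1, pow_add, abs_of_nonneg (a := (z.1.den : ℤ)) (by positivity)]
        have := coeff_le (G := G) m
        gcongr
      · rw [abs_zero]; positivity
    refine (Finset.sum_le_card_nsmul _ _ _ this).trans ?_
    have hcs := card_support h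
    rw [nsmul_eq_mul]
    have : G.support.card * (polyNorm G * N ^ a) ≤ B := by
      refine le_trans ?_ hB
      rw [mul_assoc ((a + 1) * (b + 1))]
      gcongr
    exact_mod_cast this
  · have e : Polynomial.aeval z.2 g = Polynomial.eval z.2 (g.map (Int.castRingHom ℚ)) := by
      rw [Polynomial.eval_map, Polynomial.aeval_def]
      rfl
    rw [e, hmap, eval_spec]
    have := scale h 1 z.1 1 z.2 (z.1.den : ℚ) 1
    rw [hz, mul_zero, mul_one, mul_one, one_mul, mul_comm (z.1.den : ℚ), Rat.mul_den_eq_num] at this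
    exact this

lemma primes (P : ℕ) (hP : 1 ≤ P) (k : ℕ) : ∃ S : Finset ℕ, S.card = k ∧
    ∀ p ∈ S, p.Prime ∧ P < p ∧ p ≤ 2 ^ k * P := by
  induction k with
  | zero => exact ⟨∅, by simp, by simp⟩
  | succ k ih =>
    obtain ⟨S, hS, hp⟩ := ih
    obtain ⟨q, hq, h1, h2⟩ := Nat.exists_prime_lt_and_le_two_mul (2 ^ k * P) (by positivity)
    have hk : 1 ≤ 2 ^ k := Nat.one_le_two_pow
    refine ⟨insert q S, ?_, ?_⟩
    · rw [Finset.card_insert_of_notMem, hS]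
      intro hqS
      have := (hp q hqS).2.2
      omega
    · intro p hpi
      rw [pow_succ]
      rcases Finset.mem_insert.mp hpi with rfl | hpi
      · refine ⟨hq, ?_, by linarith⟩
        nlinarith
      · obtain ⟨c1, c2, c3⟩ := hp p hpi
        exact ⟨c1, c2, by nlinarith⟩

lemma assemble {G : MvPolynomial (Fin 4) ℤ} {a b : ℕ} (ha : 1 ≤ a) (hb : 1 ≤ b)
    (h : IsBihomogeneous G a b) (hi : Irreducible (MvPolynomial.map (Int.castRingHom ℚ) G))
    (K e d N Y P k : ℕ) (hP : 1 ≤ P) (hc : K * (K + 1) / 2 < e * ((d + 1) * b))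
    (hbig : ∀ p, P < p → (d + 1) * b * p ^ e * N ^ d * Y ^ (b - 1) < p ^ K)
    (hY : ∃ B, (a + 1) * (b + 1) * polyNorm G * N ^ a ≤ B ∧ (B + 1) * B ≤ Y)
    (hprod : N * Y * ((a + 1) * b * (b * polyNorm G) * N ^ a * Y ^ (b - 1)) < P ^ k)
    (T : Finset (ℚ × ℚ)) (hT : ∀ z ∈ T, (aeval ![1, z.1, 1, z.2] G : ℚ) = 0 ∧
      z.1.den ≤ N ∧ |z.1.num| ≤ N) :
    T.card ≤ b * ((b + b) * (a + b + a)) +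
      k * (b * ((b + b) * (a + b + d)) * (2 ^ k * P * b)) := by
  classical
  obtain ⟨B, hB, hBY⟩ := hY
  obtain ⟨S, hS, hSp⟩ := primes P hP k
  have hT2 : ∀ z ∈ T, z.2.den ≤ Y ∧ |z.2.num| ≤ Y := by
    intro z hz
    obtain ⟨c1, c2, c3⟩ := hT z hz
    obtain ⟨d1, d2⟩ := eta_bound hb h hi N B hB z c1 c2 c3
    refine ⟨?_, d2.trans (by exact_mod_cast hBY)⟩
    nlinarith
  let T0 := T.filter fun z => ival (pderiv 3 G) z = 0
  let Tp := fun p => T.filter fun z => Good G p z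
  have hcov : T ⊆ T0 ∪ S.biUnion Tp := by
    intro z hz
    rw [Finset.mem_union]
    by_cases h0 : ival (pderiv 3 G) z = 0
    · left; exact Finset.mem_filter.mpr ⟨hz, h0⟩
    · right
      by_contra hcon
      simp only [Finset.mem_biUnion, Tp, Finset.mem_filter, not_exists, not_and] at hcon
      have hdv : ∀ p ∈ S, p ∣ z.1.den * z.2.den * (ival (pderiv 3 G) z).natAbs := by
        intro p hp
        have := hcon p hp hz
        unfold Good at this
        by_contra hnd
        apply this
        refine ⟨fun hh => hnd ?_, fun hh => hnd ?_, fun hh => hnd ?_⟩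
        · exact Dvd.dvd.mul_right (Dvd.dvd.mul_right hh _) _
        · exact Dvd.dvd.mul_right (Dvd.dvd.mul_left hh _) _
        · exact Dvd.dvd.mul_left (Int.natCast_dvd.mp hh) _
      have hpd : ∏ p ∈ S, p ∣ z.1.den * z.2.den * (ival (pderiv 3 G) z).natAbs :=
        Finset.prod_primes_dvd _ (fun p hp => (hSp p hp).1.prime) hdv
      have hpos : 0 < z.1.den * z.2.den * (ival (pderiv 3 G) z).natAbs := by
        have := z.1.den_pos
        have := z.2.den_pos
        have := Int.natAbs_pos.mpr h0
        positivity
      have hle := Nat.le_of_dvd hpos hpd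
      have hge : P ^ k ≤ ∏ p ∈ S, p := by
        rw [← hS]
        exact Finset.pow_card_le_prod S (fun p => p) P fun p hp => (hSp p hp).2.1.le
      obtain ⟨c1, c2, c3⟩ := hT z hz
      obtain ⟨d1, d2⟩ := hT2 z hz
      have hb2 : |ival (pderiv 3 G) z| ≤ _ := bound (pderiv_bh h) (x1 := (z.1.den : ℤ)) (x2 := z.1.num) (y1 := (z.2.den : ℤ)) (y2 := z.2.num) (N := N) (Y := Y)
        (by rw [abs_of_nonneg (by positivity)]; exact_mod_cast c2) c3
        (by rw [abs_of_nonneg (by positivity)]; exact_mod_cast d1) d2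
      have hb3 : (ival (pderiv 3 G) z).natAbs ≤
          (a + 1) * b * (b * polyNorm G) * N ^ a * Y ^ (b - 1) := by
        rw [Int.abs_eq_natAbs] at hb2
        have hb4 : (ival (pderiv 3 G) z).natAbs ≤
          (a + 1) * (b - 1 + 1) * polyNorm (pderiv 3 G) * N ^ a * Y ^ (b - 1) := by exact_mod_cast hb2
        refine hb4.trans ?_
        rw [Nat.sub_add_cancel hb]
        have := pderiv_norm h
        gcongr
      have : z.1.den * z.2.den * (ival (pderiv 3 G) z).natAbs ≤
        N * Y * ((a + 1) * b * (b * polyNorm G) * N ^ a * Y ^ (b - 1)) := by gcongr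
      omega
  refine (Finset.card_le_card hcov).trans ((Finset.card_union_le _ _).trans ?_)
  refine add_le_add ?_ ?_
  · refine inter ha hb h hi (pderiv_bh h) (pderiv_ne ha hb h hi) T0 fun z hz => ?_
    obtain ⟨hz1, hz2⟩ := Finset.mem_filter.mp hz
    exact ⟨(hT z hz1).1, (ival_zero (pderiv_bh h) z).mp hz2⟩
  · refine Finset.card_biUnion_le.trans ((Finset.sum_le_card_nsmul _ _
      (b * ((b + b) * (a + b + d)) * (2 ^ k * P * b)) ?_).trans ?_)
    · intro p hp
      obtain ⟨c1, c2, c3⟩ := hSp p hp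
      refine (prime_count ha hb h hi p K e d N Y c1 hc (hbig p c2) (Tp p) ?_).trans ?_
      · intro z hz
        obtain ⟨hz1, hz2⟩ := Finset.mem_filter.mp hz
        exact ⟨(hT z hz1).1, (hT z hz1).2.1, (hT z hz1).2.2, (hT2 z hz1).1, (hT2 z hz1).2, hz2⟩
      · gcongr
    · rw [hS]; simp

end BH

namespace BH

lemma pw (ε δ : ℝ) (N H c P n α β : ℕ) (hN : 1 ≤ N) (hH : 1 ≤ H) (hc : 1 ≤ c) (hn : 1 ≤ n)
    (hP : (c : ℝ) * ((N : ℝ) ^ δ * (H : ℝ) ^ ε) ≤ P) (h1 : (α : ℝ) ≤ n * δ) (h2 : (β : ℝ) ≤ n * ε) :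
    c * (N ^ α * H ^ β) ≤ P ^ n := by
  have hN' : (1 : ℝ) ≤ N := by exact_mod_cast hN
  have hH' : (1 : ℝ) ≤ H := by exact_mod_cast hH
  have hc' : (1 : ℝ) ≤ c := by exact_mod_cast hc
  have e1 : (N : ℝ) ^ α ≤ ((N : ℝ) ^ δ) ^ n := by
    rw [← Real.rpow_natCast, ← Real.rpow_natCast, ← Real.rpow_mul (by positivity)]
    exact Real.rpow_le_rpow_of_exponent_le hN' (by linarith)
  have e2 : (H : ℝ) ^ β ≤ ((H : ℝ) ^ ε) ^ n := by
    rw [← Real.rpow_natCast, ← Real.rpow_natCast, ← Real.rpow_mul (by positivity)]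
    exact Real.rpow_le_rpow_of_exponent_le hH' (by linarith)
  have e3 : (c : ℝ) ≤ (c : ℝ) ^ n := le_self_pow₀ hc' (by omega)
  have : (c : ℝ) * ((N : ℝ) ^ α * (H : ℝ) ^ β) ≤ (P : ℝ) ^ n := by
    calc (c : ℝ) * ((N : ℝ) ^ α * (H : ℝ) ^ β) ≤ (c : ℝ) ^ n * (((N : ℝ) ^ δ) ^ n * ((H : ℝ) ^ ε) ^ n) := by
          gcongr
      _ = ((c : ℝ) * ((N : ℝ) ^ δ * (H : ℝ) ^ ε)) ^ n := by rw [mul_pow, mul_pow]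
      _ ≤ _ := by gcongr
  exact_mod_cast this

set_option maxHeartbeats 1000000 in
lemma rat_count (ε : ℝ) (hε : 0 < ε) (a b : ℕ) (ha : 1 ≤ a) (hb : 1 ≤ b) :
    ∃ C : ℝ, 0 ≤ C ∧ ∀ G : MvPolynomial (Fin 4) ℤ, IsBihomogeneous G a b →
      Irreducible (MvPolynomial.map (Int.castRingHom ℚ) G) → ∀ N : ℕ, 1 ≤ N →
      ∀ T : Finset (ℚ × ℚ), (∀ z ∈ T, (aeval ![1, z.1, 1, z.2] G : ℚ) = 0 ∧
        z.1.den ≤ N ∧ |z.1.num| ≤ N) →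
      (T.card : ℝ) ≤ C * ((N : ℝ) ^ ((2 : ℝ) / b + ε) * (polyNorm G : ℝ) ^ ε) := by
  obtain ⟨k, hk⟩ := exists_nat_gt ((4 * a * b + 4 * b + 4 + a) / ε)
  rw [div_lt_iff₀ hε] at hk
  have hk1 : 1 ≤ k := by
    rcases Nat.eq_zero_or_pos k with rfl | h
    · exfalso
      have : (0 : ℝ) ≤ 4 * a * b + 4 * b + 4 + a := by positivity
      simp at hk
      linarith
    · exact h
  set e0 := k + 2 with he0
  obtain ⟨n, hn⟩ : ∃ n, e0 * b = n + 1 := ⟨e0 * b - 1, by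
    have : 0 < e0 * b := by positivity
    omega⟩
  have hnk : k ≤ n := by nlinarith
  set β := (a + 1) * (b + 1) with hβ
  set c1 := 2 * e0 * b * (2 * β ^ 2) ^ (b - 1) with hc1
  set c2 := (2 * β ^ 2) ^ b * (a + 1) * b ^ 2 with hc2
  set c := c1 + c2 + 1 with hc
  refine ⟨((b * ((b + b) * (a + b + a)) : ℕ) : ℝ) +
    k * (((b * ((b + b) * (a + b + (2 * e0 - 1))) : ℕ) : ℝ) * (2 ^ k * (c + 1) * b)), by positivity, ?_⟩
  intro G h hi N hN T hT
  have hG0 : G ≠ 0 := by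
    rintro rfl
    simp at hi
  have hH := norm_pos hG0
  set H := polyNorm G with hHdef
  set R := (N : ℝ) ^ ((2 : ℝ) / b + ε) * (H : ℝ) ^ ε with hR
  have hN' : (1 : ℝ) ≤ N := by exact_mod_cast hN
  have hH' : (1 : ℝ) ≤ H := by exact_mod_cast hH
  have hR1 : 1 ≤ R := by
    have e1 := Real.one_le_rpow hN' (show 0 ≤ (2 : ℝ) / b + ε by positivity)
    have e2 := Real.one_le_rpow hH' hε.le
    nlinarith
  set P := ⌈(c : ℝ) * R⌉₊ with hPdef
  have hP : (c : ℝ) * R ≤ P := Nat.le_ceil _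
  have hP1 : 1 ≤ P := by
    rw [hPdef, Nat.one_le_ceil_iff]; positivity
  have hPle : (P : ℝ) ≤ (c + 1) * R := by
    have := Nat.ceil_lt_add_one (show 0 ≤ (c : ℝ) * R by positivity)
    linarith
  have hb' : (1 : ℝ) ≤ b := by exact_mod_cast hb
  have ha' : (1 : ℝ) ≤ a := by exact_mod_cast ha
  have hnk' : (k : ℝ) ≤ n := by exact_mod_cast hnk
  have hkn : (k : ℝ) * ε ≤ n * ε := by gcongr
  have hsub : ((b - 1 : ℕ) : ℝ) = (b : ℝ) - 1 := by push_cast [hb]; ring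
  have hab : (1 : ℝ) ≤ a * b := by nlinarith
  have key := assemble ha hb h hi (2 * (e0 * b)) (e0 * b + 1) (2 * e0 - 1) N (2 * β ^ 2 * H ^ 2 * N ^ (2 * a)) P k hP1
    (by
      have e1 : 2 * e0 - 1 + 1 = 2 * e0 := by omega
      rw [e1, mul_assoc 2 e0 b, Nat.div_lt_iff_lt_mul (by norm_num)]
      have : 0 < e0 * b := by positivity
      nlinarith)
    (by
      intro p hp
      have e1 : 2 * e0 - 1 + 1 = 2 * e0 := by omega
      have e2 : 2 * (e0 * b) = (e0 * b + 1) + n := by omega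
      rw [e1, e2, pow_add p (e0 * b + 1) n]
      have e3 : c * (N ^ (2 * e0 - 1 + 2 * a * (b - 1)) * H ^ (2 * (b - 1))) ≤ P ^ n := by
        refine pw ε _ N H c P n _ _ hN hH (by omega) (by omega) hP ?_ ?_
        · have e4 : ((2 * e0 - 1 : ℕ) : ℝ) = 2 * e0 - 1 := by
            rw [Nat.cast_sub (by omega)]; push_cast; ring
          rw [Nat.cast_add, e4]
          push_cast
          rw [hsub]
          have e5 : (e0 : ℝ) * b = n + 1 := by exact_mod_cast hn
          have e6 : (n : ℝ) * (2 / b) = 2 * e0 - 2 / b := by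
            field_simp
            linarith
          have e7 : (2 : ℝ) / b ≤ 2 := by
            rw [div_le_iff₀ (by linarith)]; linarith
          rw [mul_add, e6]
          linarith
        · push_cast
          rw [hsub]
          linarith
      have e4 : P ^ n < p ^ n := Nat.pow_lt_pow_left hp (by omega)
      have e5 : 2 * e0 * b * N ^ (2 * e0 - 1) * (2 * β ^ 2 * H ^ 2 * N ^ (2 * a)) ^ (b - 1) < p ^ n := by
        refine lt_of_le_of_lt ?_ e4
        refine le_trans ?_ e3
        have : 2 * e0 * b * N ^ (2 * e0 - 1) * (2 * β ^ 2 * H ^ 2 * N ^ (2 * a)) ^ (b - 1) =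
            c1 * (N ^ (2 * e0 - 1 + 2 * a * (b - 1)) * H ^ (2 * (b - 1))) := by
          rw [hc1, mul_pow, mul_pow, ← pow_mul, ← pow_mul, pow_add]
          ring
        rw [this]
        gcongr
        omega
      have hpp : 0 < p ^ (e0 * b + 1) := by
        have : 0 < p := by omega
        positivity
      calc _ = p ^ (e0 * b + 1) * (2 * e0 * b * N ^ (2 * e0 - 1) * (2 * β ^ 2 * H ^ 2 * N ^ (2 * a)) ^ (b - 1)) := by ring
        _ < _ := Nat.mul_lt_mul_of_pos_left e5 hpp)
    ⟨β * H * N ^ a, le_rfl, by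
      have : 1 ≤ β * H * N ^ a := by
        have : 0 < β * H * N ^ a := by positivity
        omega
      have e : 2 * β ^ 2 * H ^ 2 * N ^ (2 * a) = 2 * ((β * H * N ^ a) * (β * H * N ^ a)) := by ring
      rw [e]
      nlinarith⟩
    (by
      have e3 : c * (N ^ (2 * a * b + a + 1) * H ^ (2 * b + 1)) ≤ P ^ k := by
        refine pw ε _ N H c P k _ _ hN hH (by omega) (by omega) hP ?_ ?_
        · push_cast
          have : (0 : ℝ) ≤ k * (2 / b) := by positivity
          rw [mul_add]
          linarith
        · push_cast
          linarith
      refine lt_of_lt_of_le ?_ e3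
      obtain ⟨b', rfl⟩ : ∃ b', b = b' + 1 := ⟨b - 1, by omega⟩
      have e4 : N * (2 * β ^ 2 * H ^ 2 * N ^ (2 * a)) * ((a + 1) * (b' + 1) * ((b' + 1) * H) * N ^ a *
          (2 * β ^ 2 * H ^ 2 * N ^ (2 * a)) ^ (b' + 1 - 1)) =
          c2 * (N ^ (2 * a * (b' + 1) + a + 1) * H ^ (2 * (b' + 1) + 1)) := by
        rw [hc2, Nat.add_sub_cancel]
        generalize 2 * β ^ 2 = D
        rw [mul_pow, mul_pow, ← pow_mul, ← pow_mul]
        ring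
      rw [e4]
      have : 0 < N ^ (2 * a * (b' + 1) + a + 1) * H ^ (2 * (b' + 1) + 1) := by positivity
      refine Nat.mul_lt_mul_of_pos_right ?_ this
      omega)
    T hT
  have key' : (T.card : ℝ) ≤ ((b * ((b + b) * (a + b + a)) : ℕ) : ℝ) +
    k * (((b * ((b + b) * (a + b + (2 * e0 - 1))) : ℕ) : ℝ) * (2 ^ k * P * b)) := by
    exact_mod_cast key
  refine key'.trans ?_
  rw [add_mul _ _ R]
  refine add_le_add (le_mul_of_one_le_right (by positivity) hR1) ?_
  calc _ ≤ k * (((b * ((b + b) * (a + b + (2 * e0 - 1))) : ℕ) : ℝ) * (2 ^ k * ((c + 1) * R) * b)) := by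
        gcongr
    _ = _ := by ring

end BH

namespace BH

/-- representative of a projective point -/
def rp : Option ℚ → ℤ × ℤ
  | none => (0, 1)
  | some q => ((q.den : ℤ), q.num)

lemma rep (x1 x2 : ℤ) (h : Int.gcd x1 x2 = 1) :
    ∃ s : ℤ, (s = 1 ∨ s = -1) ∧ ∃ o, x1 = s * (rp o).1 ∧ x2 = s * (rp o).2 := by
  rcases lt_trichotomy x1 0 with hx | hx | hx
  · refine ⟨-1, Or.inr rfl, some (((-x2 : ℤ) : ℚ) / ((-x1 : ℤ) : ℚ)), ?_, ?_⟩
    · have := Rat.den_div_eq_of_coprime (a := -x2) (b := -x1) (by omega) (by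
        rw [Int.natAbs_neg, Int.natAbs_neg, Nat.coprime_comm]; exact h)
      simp only [rp, this]; ring
    · have := Rat.num_div_eq_of_coprime (a := -x2) (b := -x1) (by omega) (by
        rw [Int.natAbs_neg, Int.natAbs_neg, Nat.coprime_comm]; exact h)
      simp only [rp, this]; ring
  · subst hx
    rw [Int.gcd_zero_left] at h
    refine ⟨x2, by omega, none, ?_, ?_⟩ <;> simp [rp]
  · refine ⟨1, Or.inl rfl, some ((x2 : ℚ) / (x1 : ℚ)), ?_, ?_⟩
    · have := Rat.den_div_eq_of_coprime (a := x2) (b := x1) (by omega) (by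
        rw [Nat.coprime_comm]; exact h)
      simp only [rp, this]; ring
    · have := Rat.num_div_eq_of_coprime (a := x2) (b := x1) (by omega) (by
        rw [Nat.coprime_comm]; exact h)
      simp only [rp, this]; ring

lemma opt_count {G : MvPolynomial (Fin 4) ℤ} {a b : ℕ} (ha : 1 ≤ a) (hb : 1 ≤ b)
    (h : IsBihomogeneous G a b) (hi : Irreducible (MvPolynomial.map (Int.castRingHom ℚ) G)) (N : ℕ)
    (T : Finset (Option ℚ × Option ℚ))
    (hT : ∀ o ∈ T, aeval ![(rp o.1).1, (rp o.1).2, (rp o.2).1, (rp o.2).2] G = (0 : ℤ) ∧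
      |(rp o.1).1| ≤ N ∧ |(rp o.1).2| ≤ N) :
    ∃ T' : Finset (ℚ × ℚ), (∀ z ∈ T', (aeval ![1, z.1, 1, z.2] G : ℚ) = 0 ∧
        z.1.den ≤ N ∧ |z.1.num| ≤ N) ∧ T.card ≤ T'.card + (1 + a + b) := by
  classical
  let T' : Finset (ℚ × ℚ) := T.preimage (fun z => (some z.1, some z.2)) (by
    intro z _ z' _ e
    simpa [Prod.ext_iff] using e)
  let T1 : Finset ℚ := T.preimage (fun z => (some z, none)) (by
    intro z _ z' _ e
    simpa [Prod.ext_iff] using e)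
  let T2 : Finset ℚ := T.preimage (fun z => (none, some z)) (by
    intro z _ z' _ e
    simpa [Prod.ext_iff] using e)
  refine ⟨T', ?_, ?_⟩
  · intro z hz
    have hz' := Finset.mem_preimage.mp hz
    obtain ⟨h1, h2, h3⟩ := hT _ hz'
    simp only [rp] at h1 h2 h3
    refine ⟨(ival_zero h z).mp h1, ?_, h3⟩
    rw [abs_of_nonneg (by positivity)] at h2
    exact_mod_cast h2
  · have c1 : T1.card ≤ a := by
      have hne := spec_y_ne_zero ha h hi
      have hsub : T1 ⊆ (aeval ![1, Polynomial.X, 0, 1] G : Polynomial ℚ).roots.toFinset := by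
        intro q hq
        have hq' := Finset.mem_preimage.mp hq
        obtain ⟨h1, -, -⟩ := hT _ hq'
        simp only [rp] at h1
        rw [Multiset.mem_toFinset, Polynomial.mem_roots hne, Polynomial.IsRoot.def]
        have e1 : Polynomial.eval q (aeval ![1, Polynomial.X, 0, 1] G) = aeval ![1, q, 0, 1] G := by
          rw [aeval_sum, aeval_sum]; simp [Polynomial.eval_finsetSum]
        rw [e1]
        have e2 := cast_aeval (R := ℚ) G (q.den : ℤ) q.num 0 1
        rw [h1] at e2
        have e3 := scale h 1 q 0 1 (q.den : ℚ) 1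
        rw [mul_comm (q.den : ℚ) q, Rat.mul_den_eq_num] at e3
        push_cast at e2
        simp only [mul_one, one_mul, mul_zero, one_pow] at e3
        rw [e2] at e3
        have hd : (q.den : ℚ) ≠ 0 := by exact_mod_cast q.den_nz
        rcases mul_eq_zero.mp e3.symm with h4 | h4
        · exact absurd h4 (pow_ne_zero _ hd)
        · exact h4
      refine (Finset.card_le_card hsub).trans ((Multiset.toFinset_card_le _).trans
        ((Polynomial.card_roots' _).trans ?_))
      rw [aeval_sum]
      refine Polynomial.natDegree_sum_le_of_forall_le _ _ fun m hm => ?_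
      obtain ⟨h1, h2⟩ := h m hm
      have e : ((G.coeff m : ℤ) : Polynomial ℚ) * (1 ^ m 0 * Polynomial.X ^ m 1 * 0 ^ m 2 * 1 ^ m 3) =
          Polynomial.C (((G.coeff m : ℤ) : ℚ) * 0 ^ m 2) * Polynomial.X ^ m 1 := by
        simp; ring
      rw [e]
      exact (Polynomial.natDegree_C_mul_X_pow_le _ _).trans (by omega)
    have c2 : T2.card ≤ b := by
      refine card_eta hb h hi 0 1 (Or.inr one_ne_zero) T2 fun q hq => ?_
      have hq' := Finset.mem_preimage.mp hq
      obtain ⟨h1, -, -⟩ := hT _ hq'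
      simp only [rp] at h1
      have e2 := cast_aeval (R := ℚ) G 0 1 (q.den : ℤ) q.num
      rw [h1] at e2
      have e3 := scale h 0 1 1 q 1 (q.den : ℚ)
      rw [mul_comm (q.den : ℚ) q, Rat.mul_den_eq_num] at e3
      push_cast at e2
      simp only [mul_one, one_mul, mul_zero, one_pow] at e3
      rw [e2] at e3
      have hd : (q.den : ℚ) ≠ 0 := by exact_mod_cast q.den_nz
      rcases mul_eq_zero.mp e3.symm with h4 | h4
      · exact absurd h4 (pow_ne_zero _ hd)
      · exact h4
    have hcov : T ⊆ T'.image (fun z => (some z.1, some z.2)) ∪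
        ({(none, none)} ∪ T1.image (fun z => (some z, none)) ∪ T2.image (fun z => (none, some z))) := by
      rintro ⟨o1, o2⟩ ho
      rcases o1 with _ | q1 <;> rcases o2 with _ | q2
      · simp
      · have : q2 ∈ T2 := Finset.mem_preimage.mpr ho
        simp [this]
      · have : q1 ∈ T1 := Finset.mem_preimage.mpr ho
        simp [this]
      · have : (q1, q2) ∈ T' := Finset.mem_preimage.mpr ho
        simp [this]
    refine (Finset.card_le_card hcov).trans ((Finset.card_union_le _ _).trans ?_)
    refine add_le_add Finset.card_image_le ((Finset.card_union_le _ _).trans ?_)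
    refine add_le_add ((Finset.card_union_le _ _).trans ?_) (Finset.card_image_le.trans c2)
    exact add_le_add (by simp) (Finset.card_image_le.trans c1)

lemma int_count {G : MvPolynomial (Fin 4) ℤ} {a b : ℕ} (ha : 1 ≤ a) (hb : 1 ≤ b)
    (h : IsBihomogeneous G a b) (hi : Irreducible (MvPolynomial.map (Int.castRingHom ℚ) G)) (N : ℕ)
    (F : Finset (ℤ × ℤ × ℤ × ℤ))
    (hF : ∀ v ∈ F, Int.gcd v.1 v.2.1 = 1 ∧ Int.gcd v.2.2.1 v.2.2.2 = 1 ∧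
      eval ![v.1, v.2.1, v.2.2.1, v.2.2.2] G = 0 ∧ |v.1| ≤ N ∧ |v.2.1| ≤ N) :
    ∃ T' : Finset (ℚ × ℚ), (∀ z ∈ T', (aeval ![1, z.1, 1, z.2] G : ℚ) = 0 ∧
        z.1.den ≤ N ∧ |z.1.num| ≤ N) ∧ F.card ≤ 4 * (T'.card + (1 + a + b)) := by
  classical
  let f : (ℤ × ℤ) × (Option ℚ × Option ℚ) → ℤ × ℤ × ℤ × ℤ := fun w =>
    (w.1.1 * (rp w.2.1).1, w.1.1 * (rp w.2.1).2, w.1.2 * (rp w.2.2).1, w.1.2 * (rp w.2.2).2)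
  let S : Finset (ℤ × ℤ) := {1, -1} ×ˢ {1, -1}
  have hrep : ∀ v ∈ F, ∃ w : (ℤ × ℤ) × (Option ℚ × Option ℚ), w.1 ∈ S ∧ f w = v := by
    intro v hv
    obtain ⟨h1, h2, -⟩ := hF v hv
    obtain ⟨s, hs, o, e1, e2⟩ := rep _ _ h1
    obtain ⟨t, ht, o', e3, e4⟩ := rep _ _ h2
    refine ⟨((s, t), (o, o')), ?_, ?_⟩
    · simp [S, hs, ht]
    · simp only [f]
      rw [← e1, ← e2, ← e3, ← e4]
  choose! g hg1 hg2 using hrep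
  obtain ⟨T', hT', hc⟩ := opt_count ha hb h hi N (F.image fun v => (g v).2) (by
    intro o ho
    obtain ⟨v, hv, rfl⟩ := Finset.mem_image.mp ho
    obtain ⟨-, -, h3, h4, h5⟩ := hF v hv
    have hS := hg1 v hv
    have hfv := hg2 v hv
    rw [← hfv] at h3 h4 h5
    simp only [f] at h3 h4 h5
    rw [← coe_aeval_eq_eval] at h3
    have h3' : aeval ![(g v).1.1 * (rp (g v).2.1).1, (g v).1.1 * (rp (g v).2.1).2,
      (g v).1.2 * (rp (g v).2.2).1, (g v).1.2 * (rp (g v).2.2).2] G = (0 : ℤ) := h3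
    rw [scale h] at h3'
    simp only [S, Finset.mem_product, Finset.mem_insert, Finset.mem_singleton] at hS
    have hs1 : |(g v).1.1| = 1 := by rcases hS.1 with e | e <;> simp [e]
    have hs2 : |(g v).1.2| = 1 := by rcases hS.2 with e | e <;> simp [e]
    have n1 : (g v).1.1 ≠ 0 := by intro e; simp [e] at hs1
    have n2 : (g v).1.2 ≠ 0 := by intro e; simp [e] at hs2
    rw [abs_mul, hs1, one_mul] at h4 h5
    refine ⟨?_, h4, h5⟩
    rcases mul_eq_zero.mp h3' with h6 | h6
    · exact absurd h6 (mul_ne_zero (pow_ne_zero _ n1) (pow_ne_zero _ n2))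
    · exact h6)
  refine ⟨T', hT', ?_⟩
  have hsub : F ⊆ (S ×ˢ (F.image fun v => (g v).2)).image f := by
    intro v hv
    rw [Finset.mem_image]
    refine ⟨g v, ?_, hg2 v hv⟩
    rw [Finset.mem_product]
    exact ⟨hg1 v hv, Finset.mem_image_of_mem _ hv⟩
  refine (Finset.card_le_card hsub).trans (Finset.card_image_le.trans ?_)
  rw [Finset.card_product]
  refine Nat.mul_le_mul ?_ hc
  simp [S]

end BH

/-- Lemma 2 of the paper: counting coprime integer points on an absolutely irreducible
bi-homogeneous curve, with no size constraint on `y₁, y₂`. -/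
theorem bihomogeneous_point_count (ε : ℝ) (hε : 0 < ε) (a b : ℕ)
    (ha : 1 ≤ a) (hb : 1 ≤ b) :
    ∃ C : ℝ, ∀ G : MvPolynomial (Fin 4) ℤ,
      IsBihomogeneous G a b →
      Irreducible (MvPolynomial.map (Int.castRingHom (AlgebraicClosure ℚ)) G) →
      ∀ X : ℝ, 1 ≤ X →
        (Nat.card {v : ℤ × ℤ × ℤ × ℤ |
            Int.gcd v.1 v.2.1 = 1 ∧ Int.gcd v.2.2.1 v.2.2.2 = 1 ∧
            eval ![v.1, v.2.1, v.2.2.1, v.2.2.2] G = 0 ∧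
            (|v.1| : ℝ) ≤ X ∧ (|v.2.1| : ℝ) ≤ X} : ℝ) ≤
          C * X ^ ((2 : ℝ) / b + ε) * (polyNorm G : ℝ) ^ ε := by
  obtain ⟨C, hC, hcount⟩ := BH.rat_count ε hε a b ha hb
  refine ⟨4 * (C + (1 + a + b)), ?_⟩
  intro G h hirr X hX
  have hi := BH.irrQ hirr
  have hG0 : G ≠ 0 := by
    rintro rfl
    simp at hi
  have hH := BH.norm_pos hG0
  have hH' : (1 : ℝ) ≤ polyNorm G := by exact_mod_cast hH
  have hX0 : 0 ≤ X := by linarith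
  have hR1 : 1 ≤ X ^ ((2 : ℝ) / b + ε) * (polyNorm G : ℝ) ^ ε := by
    have e1 := Real.one_le_rpow hX (show 0 ≤ (2 : ℝ) / b + ε by positivity)
    have e2 := Real.one_le_rpow hH' hε.le
    nlinarith
  rw [mul_assoc]
  by_cases hfin : Set.Finite {v : ℤ × ℤ × ℤ × ℤ |
            Int.gcd v.1 v.2.1 = 1 ∧ Int.gcd v.2.2.1 v.2.2.2 = 1 ∧
            eval ![v.1, v.2.1, v.2.2.1, v.2.2.2] G = 0 ∧
            (|v.1| : ℝ) ≤ X ∧ (|v.2.1| : ℝ) ≤ X}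
  · rw [Nat.card_coe_set_eq, Set.ncard_eq_toFinset_card _ hfin]
    have hN : 1 ≤ ⌊X⌋₊ := (Nat.one_le_floor_iff X).mpr hX
    obtain ⟨T', hT', hc⟩ := BH.int_count ha hb h hi ⌊X⌋₊ hfin.toFinset (by
      intro v hv
      rw [Set.Finite.mem_toFinset] at hv
      obtain ⟨h1, h2, h3, h4, h5⟩ := hv
      have key : ∀ n : ℤ, |(n : ℝ)| ≤ X → |n| ≤ (⌊X⌋₊ : ℤ) := by
        intro n hn
        rw [Int.abs_eq_natAbs]
        rw [← Int.cast_abs, Int.abs_eq_natAbs, Int.cast_natCast] at hn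
        exact_mod_cast Nat.le_floor hn
      exact ⟨h1, h2, h3, key _ h4, key _ h5⟩)
    have hT := hcount G h hi ⌊X⌋₊ hN T' hT'
    have hNX : ((⌊X⌋₊ : ℕ) : ℝ) ≤ X := Nat.floor_le hX0
    have hR2 : ((⌊X⌋₊ : ℕ) : ℝ) ^ ((2 : ℝ) / b + ε) * (polyNorm G : ℝ) ^ ε ≤
        X ^ ((2 : ℝ) / b + ε) * (polyNorm G : ℝ) ^ ε := by
      gcongr
    have hc' : (hfin.toFinset.card : ℝ) ≤ 4 * (T'.card + (1 + a + b)) := by exact_mod_cast hc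
    have hT2 := hT.trans (mul_le_mul_of_nonneg_left hR2 hC)
    have h0 : (0 : ℝ) ≤ 1 + a + b := by positivity
    have h1 := le_mul_of_one_le_right h0 hR1
    linarith
  · rw [Nat.card_coe_set_eq, Set.Infinite.ncard hfin]
    simp only [Nat.cast_zero]
    positivity
end
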